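/- (Theorem 1.1(i), upper bound, n ≥ 3.) Let n ≥ 3, assume λ ≤ det D²u ≤ Λ in Ω, and let V ⊂⊂ Ω be open. Then there is a constant C > 0 depending only on V, Ω, n, λ, Λ such that: for every x₀ ∈ V, every 0 < t < 1/4 with S_u(x₀, 2t) ⊂⊂ V, and every Green's function g_V(·, x₀) of L_u in V with pole x₀, one has g_V(x, x₀) ≤ C · t^{-(n-2)/2} for all x ∈ ∂S_u(x₀, t). -/

import Mathlib

open MeasureTheory

noncomputable section

/-- Euclidean space `ℝⁿ`. -/
abbrev E (n : ℕ) := EuclideanSpace ℝ (Fin n)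

/-- First partial derivative `∂_i f (x)`. -/
noncomputable def pd {n : ℕ} (f : E n → ℝ) (x : E n) (i : Fin n) : ℝ :=
  fderiv ℝ f x (EuclideanSpace.single i 1)

/-- Second partial derivative `∂_{ij} f (x)`. -/
noncomputable def pd2 {n : ℕ} (f : E n → ℝ) (x : E n) (i j : Fin n) : ℝ :=
  fderiv ℝ (fun y => fderiv ℝ f y (EuclideanSpace.single j 1)) x (EuclideanSpace.single i 1)

/-- Hessian matrix `D²f(x)`. -/
noncomputable def Hess {n : ℕ} (f : E n → ℝ) (x : E n) : Matrix (Fin n) (Fin n) ℝ :=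
  Matrix.of fun i j => pd2 f x i j

/-- The cofactor matrix `U = (det D²u)(D²u)⁻¹` of the Hessian of `u`,
realized as the adjugate. -/
noncomputable def cofU {n : ℕ} (u : E n → ℝ) (x : E n) : Matrix (Fin n) (Fin n) ℝ :=
  (Hess u x).adjugate

/-- Section of the convex function `u`:
`S_u(x₀,t) = {x ∈ cl Ω : u x < u x₀ + ∇u(x₀)·(x - x₀) + t}`. -/
def MASection {n : ℕ} (Ω : Set (E n)) (u : E n → ℝ) (x₀ : E n) (t : ℝ) : Set (E n) :=
  {x ∈ closure Ω | u x < u x₀ + fderiv ℝ u x₀ (x - x₀) + t}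

/-- `A ⊂⊂ B`: the closure of `A` is a compact subset of `B`. -/
def CptIn {n : ℕ} (A B : Set (E n)) : Prop :=
  IsCompact (closure A) ∧ closure A ⊆ B

/-- Uniform convexity of a domain: balls of radius proportional to `‖x - y‖²`
centered at midpoints of points of the closure stay in the closure. -/
def UnifConvex {n : ℕ} (Ω : Set (E n)) : Prop :=
  ∃ δ > 0, ∀ x ∈ closure Ω, ∀ y ∈ closure Ω,
    Metric.closedBall (midpoint ℝ x y) (δ * ‖x - y‖ ^ 2) ⊆ closure Ω

/-- Standing assumptions: `Ω` is a bounded, open, nonempty, uniformly convex domain and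
`u` is a smooth convex function on `cl Ω` vanishing on `∂Ω`. -/
def MASetup {n : ℕ} (Ω : Set (E n)) (u : E n → ℝ) : Prop :=
  IsOpen Ω ∧ Bornology.IsBounded Ω ∧ Ω.Nonempty ∧ UnifConvex Ω ∧
  ContDiffOn ℝ (⊤ : ℕ∞) u (closure Ω) ∧ ConvexOn ℝ (closure Ω) u ∧
  ∀ x ∈ frontier Ω, u x = 0

/-- `λ ≤ det D²u ≤ Λ` in `Ω`. -/
def DetBounds {n : ℕ} (Ω : Set (E n)) (u : E n → ℝ) (lam Lam : ℝ) : Prop :=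
  ∀ x ∈ Ω, lam ≤ (Hess u x).det ∧ (Hess u x).det ≤ Lam

/-- The Monge-Ampère measure of `u`: `μ(A) = ∫_A det D²u`. -/
noncomputable def maMeasure {n : ℕ} (u : E n → ℝ) (A : Set (E n)) : ℝ :=
  ∫ x in A, (Hess u x).det

/-- Center of mass of a set. -/
noncomputable def centerOfMass {n : ℕ} (S : Set (E n)) : E n :=
  (volume S).toReal⁻¹ • ∫ x in S, x

/-- The `α`-dilation of `S` with respect to its center of mass. -/
def dilateCM {n : ℕ} (α : ℝ) (S : Set (E n)) : Set (E n) :=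
  (fun x => centerOfMass S + α • (x - centerOfMass S)) '' S

/-- The Monge-Ampère measure of `u` is doubling with respect to the center of mass
on the sections of `u`, with constants `0 < α < 1 < β`. -/
def DoublingCM {n : ℕ} (Ω : Set (E n)) (u : E n → ℝ) (α β : ℝ) : Prop :=
  0 < α ∧ α < 1 ∧ 1 < β ∧
  ∀ x₀ ∈ Ω, ∀ t : ℝ, 0 < t → CptIn (MASection Ω u x₀ t) Ω →
    maMeasure u (MASection Ω u x₀ t) ≤ β * maMeasure u (dilateCM α (MASection Ω u x₀ (t / 2)))

/-- `g` is a Green's function of the linearized Monge-Ampère operator `L_u` in `V`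
with pole `y`: positive and smooth on `V \ {y}`, `L_u`-harmonic there, vanishing
continuously on `∂V`, and `∫_V g · (L_u φ) = φ(y)` (i.e. `∫_V g · U^{ij}∂_{ij}φ = -φ(y)`)
for all test functions `φ`. -/
def IsGreen {n : ℕ} (u : E n → ℝ) (V : Set (E n)) (y : E n) (g : E n → ℝ) : Prop :=
  (∀ x ∈ V \ {y}, 0 < g x) ∧
  ContDiffOn ℝ (⊤ : ℕ∞) g (V \ {y}) ∧
  (∀ x ∈ V \ {y}, ∑ i, ∑ j, cofU u x i j * pd2 g x i j = 0) ∧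
  ContinuousOn g (closure V \ {y}) ∧
  (∀ x ∈ frontier V, g x = 0) ∧
  ∀ φ : E n → ℝ, ContDiff ℝ (⊤ : ℕ∞) φ → HasCompactSupport φ → tsupport φ ⊆ V →
    (∫ x in V, g x * ∑ i, ∑ j, cofU u x i j * pd2 φ x i j) = -φ y

/-- Capacity of a compact set `K` relative to `V` for the operator `L_u`:
the infimum of `∫_V U^{ij} ∂_iΦ ∂_jΦ` over Lipschitz `Φ` compactly supported in `V`
with `Φ ≥ 1` on `K`. -/
noncomputable def capacity {n : ℕ} (u : E n → ℝ) (K V : Set (E n)) : ℝ :=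
  sInf { e : ℝ | ∃ Φ : E n → ℝ, (∃ L : NNReal, LipschitzWith L Φ) ∧
    HasCompactSupport Φ ∧ tsupport Φ ⊆ V ∧ (∀ x ∈ K, 1 ≤ Φ x) ∧
    e = ∫ x in V, ∑ i, ∑ j, cofU u x i j * pd Φ x i * pd Φ x j }

/-- AM-GM comparison of determinants through the trace. -/
theorem Matrix.PosSemidef.det_le_one_of_trace_le {n : ℕ} {A : Matrix (Fin n) (Fin n) ℝ}
    (hA : A.PosSemidef) (h : A.trace ≤ n) : A.det ≤ 1 := by
  have h1 := hA.isHermitian.det_eq_prod_eigenvalues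
  have h2 := hA.isHermitian.trace_eq_sum_eigenvalues
  simp only [RCLike.ofReal_real_eq_id, id] at h1 h2
  rw [h1]
  calc ∏ i, hA.isHermitian.eigenvalues i
      ≤ ∏ i, Real.exp (hA.isHermitian.eigenvalues i - 1) := by
        apply Finset.prod_le_prod
        · intro i _; exact hA.eigenvalues_nonneg i
        · intro i _
          have := Real.add_one_le_exp (hA.isHermitian.eigenvalues i - 1)
          linarith
    _ = Real.exp (∑ i, (hA.isHermitian.eigenvalues i - 1)) := (Real.exp_sum _ _).symm
    _ ≤ 1 := by
        rw [Real.exp_le_one_iff, Finset.sum_sub_distrib, ← h2]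
        simpa using h

open scoped ComplexOrder MatrixOrder in
theorem Matrix.PosSemidef.det_le_det_of_trace_le {n : ℕ} {A B : Matrix (Fin n) (Fin n) ℝ}
    (hA : A.PosSemidef) (hB : B.PosDef) (h : (B.adjugate * A).trace ≤ n * B.det) :
    A.det ≤ B.det := by
  have hBd := hB.det_pos
  obtain ⟨R, hR⟩ := CStarAlgebra.nonneg_iff_eq_star_mul_self.mp hB.inv.posSemidef.nonneg
  have hC : (R * A * star R).PosSemidef := hA.mul_mul_conjTranspose_same R
  have htr : (R * A * star R).trace = (B⁻¹ * A).trace := by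
    rw [hR, Matrix.trace_mul_comm, ← Matrix.mul_assoc]
  have hinv : B⁻¹ = B.det⁻¹ • B.adjugate := by
    rw [Matrix.inv_def, Ring.inverse_eq_inv']
  have h1 : (R * A * star R).trace ≤ n := by
    rw [htr, hinv, Matrix.smul_mul, Matrix.trace_smul, smul_eq_mul, inv_mul_le_iff₀ hBd]
    linarith
  have h2 := hC.det_le_one_of_trace_le h1
  have h3 : (R * A * star R).det = B.det⁻¹ * A.det := by
    have : (B⁻¹).det = B.det⁻¹ := by
      rw [Matrix.det_nonsing_inv, Ring.inverse_eq_inv']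
    rw [← this, hR, Matrix.det_mul, Matrix.det_mul, Matrix.det_mul]; ring
  rw [h3, inv_mul_le_iff₀ hBd] at h2
  linarith

open scoped ComplexOrder MatrixOrder in
theorem Matrix.PosSemidef.det_le_det {n : ℕ} {A B : Matrix (Fin n) (Fin n) ℝ}
    (hA : A.PosSemidef) (hB : B.PosDef) (h : (B - A).PosSemidef) : A.det ≤ B.det := by
  apply hA.det_le_det_of_trace_le hB
  have hBd := hB.det_pos
  have hadj : B.adjugate = B.det • B⁻¹ := by
    rw [Matrix.inv_def, Ring.inverse_eq_inv', smul_smul, mul_inv_cancel₀ hBd.ne', one_smul]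
  obtain ⟨R, hR⟩ := CStarAlgebra.nonneg_iff_eq_star_mul_self.mp hB.inv.posSemidef.nonneg
  have hC : 0 ≤ (R * (B - A) * star R).trace := (h.mul_mul_conjTranspose_same R).trace_nonneg
  have htr : (R * (B - A) * star R).trace = (B⁻¹ * (B - A)).trace := by
    rw [hR, Matrix.trace_mul_comm, ← Matrix.mul_assoc]
  rw [htr, Matrix.mul_sub, Matrix.nonsing_inv_mul _ (isUnit_iff_ne_zero.mpr hBd.ne'),
    Matrix.trace_sub, Matrix.trace_one, Fintype.card_fin] at hC
  rw [hadj, Matrix.smul_mul, Matrix.trace_smul, smul_eq_mul, mul_comm]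
  exact mul_le_mul_of_nonneg_right (by linarith) hBd.le

section

variable {n : ℕ}

theorem pd2_eq {f : E n → ℝ} {x : E n} (hf : ContDiffAt ℝ 2 f x) (i j : Fin n) :
    pd2 f x i j =
      fderiv ℝ (fderiv ℝ f) x (EuclideanSpace.single i 1) (EuclideanSpace.single j 1) := by
  have h : DifferentiableAt ℝ (fderiv ℝ f) x :=
    (hf.fderiv_right (m := 1) (by norm_num)).differentiableAt (by norm_num)
  unfold pd2
  rw [fderiv_clm_apply h (by fun_prop)]
  simp

theorem Hess_isSymm {f : E n → ℝ} {x : E n} (hf : ContDiffAt ℝ 2 f x) : (Hess f x).IsSymm := by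
  ext i j
  simp only [Hess, Matrix.transpose_apply, Matrix.of_apply]
  rw [pd2_eq hf, pd2_eq hf]
  exact (hf.isSymmSndFDerivAt (by simp)).eq _ _

theorem sum_single_eq (ξ : E n) : ξ = ∑ i, ξ i • EuclideanSpace.single i (1 : ℝ) := by
  ext j
  simp [Finset.sum_apply, Pi.single_apply]

theorem Hess_quadratic {f : E n → ℝ} {x : E n} (hf : ContDiffAt ℝ 2 f x) (ξ : Fin n → ℝ) :
    ξ ⬝ᵥ (Hess f x).mulVec ξ =
      fderiv ℝ (fderiv ℝ f) x (WithLp.toLp 2 ξ) (WithLp.toLp 2 ξ) := by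
  have : (WithLp.toLp 2 ξ : E n) = ∑ i, ξ i • EuclideanSpace.single i (1 : ℝ) :=
    sum_single_eq _
  rw [this]
  simp only [map_sum, map_smul, _root_.sum_apply, _root_.smul_apply,
    dotProduct, Matrix.mulVec, Hess, Matrix.of_apply, smul_eq_mul, Finset.mul_sum]
  rw [Finset.sum_comm]
  refine Finset.sum_congr rfl fun i _ => Finset.sum_congr rfl fun j _ => ?_
  rw [pd2_eq hf]
  ring

theorem deriv_deriv_nonneg_of_isLocalMin {h : ℝ → ℝ} (hc : ContinuousAt h 0)
    (hmin : IsLocalMin h 0) (hd : ∀ᶠ t in nhds 0, DifferentiableAt ℝ h t)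
    (hd2 : DifferentiableAt ℝ (deriv h) 0) :
    0 ≤ deriv (deriv h) 0 := by
  by_contra! hneg
  set c := -deriv (deriv h) 0 / 2 with hcdef
  have hcpos : 0 < c := by rw [hcdef]; linarith
  have hk : deriv (fun t => h t + c / 2 * t ^ 2) =ᶠ[nhds 0] fun t => deriv h t + c * t := by
    filter_upwards [hd] with t ht
    have := ht.hasDerivAt.add (((hasDerivAt_id t).pow 2).const_mul (c / 2))
    simp only [id] at this
    refine Eq.trans this.deriv ?_
    simp; ring
  have hk2 : deriv (deriv fun t => h t + c / 2 * t ^ 2) 0 = deriv (deriv h) 0 + c := by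
    rw [hk.deriv_eq]
    have := hd2.hasDerivAt.add ((hasDerivAt_id (0 : ℝ)).const_mul c)
    simp only [id] at this
    refine Eq.trans this.deriv ?_
    simp
  have hmax : IsLocalMax (fun t => h t + c / 2 * t ^ 2) 0 := by
    apply isLocalMax_of_deriv_deriv_neg
    · rw [hk2]; rw [hcdef]; linarith
    · rw [hk.eq_of_nhds]; simp [hmin.deriv_eq_zero]
    · fun_prop
  have : ∀ᶠ t in nhds (0 : ℝ), t = 0 := by
    filter_upwards [hmax, hmin] with t h1 h2
    have h1' : h t + c / 2 * t ^ 2 ≤ h 0 := by simpa using h1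
    have : t ^ 2 ≤ 0 := by
      by_contra! hh
      have : 0 < c / 2 * t ^ 2 := by positivity
      linarith [show h 0 ≤ h t from h2]
    nlinarith
  obtain ⟨ε, hε, hb⟩ := Metric.eventually_nhds_iff.mp this
  have := hb (y := ε / 2) (by simp [abs_of_pos hε, hε])
  linarith

theorem Hess_posSemidef_of_isLocalMin {f : E n → ℝ} {x : E n} (hf : ContDiffAt ℝ 2 f x)
    (hmin : IsLocalMin f x) : (Hess f x).PosSemidef := by
  refine Matrix.PosSemidef.of_dotProduct_mulVec_nonneg ?_ ?_
  · have := Hess_isSymm hf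
    rw [Matrix.IsHermitian, Matrix.conjTranspose_eq_transpose_of_trivial]
    exact this
  intro ξ
  simp only [star_trivial]
  rw [Hess_quadratic hf]
  set v : E n := WithLp.toLp 2 ξ
  have hline : ∀ t : ℝ, HasDerivAt (fun t : ℝ => x + t • v) v t := fun t => by
    simpa using ((hasDerivAt_id t).smul_const v).const_add x
  have hcont : Filter.Tendsto (fun t : ℝ => x + t • v) (nhds 0) (nhds x) := by
    have : Continuous fun t : ℝ => x + t • v := by fun_prop
    simpa using this.tendsto 0
  have hev : ∀ᶠ y in nhds x, DifferentiableAt ℝ f y :=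
    (hf.eventually (by simp)).mono fun y hy => hy.differentiableAt (by norm_num)
  have hd : ∀ᶠ t in nhds (0 : ℝ),
      HasDerivAt (fun t : ℝ => f (x + t • v)) (fderiv ℝ f (x + t • v) v) t := by
    filter_upwards [hcont.eventually hev] with t ht
    exact ht.hasFDerivAt.comp_hasDerivAt t (hline t)
  have hder : deriv (fun t : ℝ => f (x + t • v)) =ᶠ[nhds 0] fun t : ℝ => fderiv ℝ f (x + t • v) v := by
    filter_upwards [hd] with t ht using ht.deriv
  have hD : DifferentiableAt ℝ (fderiv ℝ f) x :=
    (hf.fderiv_right (m := 1) (by norm_num)).differentiableAt (by norm_num)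
  have hD2 : HasDerivAt (fun t : ℝ => fderiv ℝ f (x + t • v) v) (fderiv ℝ (fderiv ℝ f) x v v) 0 := by
    have h0 : HasFDerivAt (fderiv ℝ f) (fderiv ℝ (fderiv ℝ f) x) (x + (0 : ℝ) • v) := by
      simpa using hD.hasFDerivAt
    have h3 : HasDerivAt (fun t : ℝ => fderiv ℝ f (x + t • v)) (fderiv ℝ (fderiv ℝ f) x v) 0 :=
      HasFDerivAt.comp_hasDerivAt (0 : ℝ) h0 (hline 0)
    have h4 := h3.clm_apply (hasDerivAt_const (0 : ℝ) v)
    simpa using h4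
  have hmin' : IsLocalMin (fun t : ℝ => f (x + t • v)) 0 := by
    have := hcont.eventually hmin
    simpa [IsLocalMin, IsMinFilter] using this
  have key := deriv_deriv_nonneg_of_isLocalMin (h := fun t : ℝ => f (x + t • v))
    (hd.self_of_nhds.continuousAt) hmin' (hd.mono fun t ht => ht.differentiableAt)
    (hder.symm.differentiableAt_iff.mp hD2.differentiableAt)
  rwa [hder.deriv_eq, hD2.deriv] at key

theorem pd2_sub {f g : E n → ℝ} {x : E n} (hf : ContDiffAt ℝ 2 f x) (hg : ContDiffAt ℝ 2 g x)
    (i j : Fin n) : pd2 (fun y => f y - g y) x i j = pd2 f x i j - pd2 g x i j := by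
  rw [pd2_eq hf, pd2_eq hg, pd2_eq (hf.sub hg)]
  have : fderiv ℝ (fun y => f y - g y) =ᶠ[nhds x] fun y => fderiv ℝ f y - fderiv ℝ g y := by
    filter_upwards [hf.eventually (by simp), hg.eventually (by simp)] with y h1 h2
    exact fderiv_fun_sub (h1.differentiableAt (by norm_num)) (h2.differentiableAt (by norm_num))
  rw [this.fderiv_eq, fderiv_fun_sub]
  · simp
  · exact (hf.fderiv_right (m := 1) (by norm_num)).differentiableAt (by norm_num)
  · exact (hg.fderiv_right (m := 1) (by norm_num)).differentiableAt (by norm_num)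

theorem Hess_sub {f g : E n → ℝ} {x : E n} (hf : ContDiffAt ℝ 2 f x) (hg : ContDiffAt ℝ 2 g x) :
    Hess (fun y => f y - g y) x = Hess f x - Hess g x := by
  ext i j; simp [Hess, pd2_sub hf hg]

theorem pd2_congr {f g : E n → ℝ} {x : E n} (h : f =ᶠ[nhds x] g) (i j : Fin n) :
    pd2 f x i j = pd2 g x i j := by
  unfold pd2
  have : (fun y => fderiv ℝ f y (EuclideanSpace.single j 1)) =ᶠ[nhds x]
      fun y => fderiv ℝ g y (EuclideanSpace.single j 1) := by
    filter_upwards [h.eventuallyEq_nhds] with y hy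
    rw [hy.fderiv_eq]
  rw [this.fderiv_eq]

/-- An affine function plus a weighted sum of squares of affine functions. -/
def quadFn {ι : Type*} [Fintype ι] (L : E n →L[ℝ] ℝ) (b : ℝ) (l : ι → E n →L[ℝ] ℝ) (α β : ι → ℝ)
    (x : E n) : ℝ :=
  b + L x + ∑ k, α k * (l k x + β k) ^ 2

section quad
variable {ι : Type*} [Fintype ι] (L : E n →L[ℝ] ℝ) (b : ℝ) (l : ι → E n →L[ℝ] ℝ) (α β : ι → ℝ)

theorem quadFn_contDiff (m : WithTop ℕ∞) : ContDiff ℝ m (quadFn L b l α β) := by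
  unfold quadFn
  fun_prop

theorem quadFn_hasFDerivAt (x : E n) :
    HasFDerivAt (quadFn L b l α β) (L + ∑ k, (2 * α k * (l k x + β k)) • l k) x := by
  unfold quadFn
  have h1 : HasFDerivAt (fun x => b + L x) L x := by
    simpa using (L.hasFDerivAt (x := x)).const_add b
  have h2 : HasFDerivAt (fun x => ∑ k, α k * (l k x + β k) ^ 2)
      (∑ k, (2 * α k * (l k x + β k)) • l k) x := by
    apply HasFDerivAt.fun_sum
    intro k _
    have := ((((l k).hasFDerivAt (x := x)).add_const (β k)).pow 2).const_mul (α k)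
    exact this.congr_fderiv (by ext v; simp; ring)
  exact h1.add h2

theorem Hess_quadFn (x : E n) :
    Hess (quadFn L b l α β) x = Matrix.of fun i j =>
      ∑ k, 2 * α k * l k (EuclideanSpace.single i 1) * l k (EuclideanSpace.single j 1) := by
  ext i j
  simp only [Hess, Matrix.of_apply, pd2]
  have : (fun y => fderiv ℝ (quadFn L b l α β) y (EuclideanSpace.single j 1)) =
      fun y => L (EuclideanSpace.single j 1) +
        ∑ k, 2 * α k * (l k y + β k) * l k (EuclideanSpace.single j 1) := by
    ext y
    rw [(quadFn_hasFDerivAt L b l α β y).fderiv]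
    simp
  rw [this]
  have h : HasFDerivAt (fun y => L (EuclideanSpace.single j 1) +
        ∑ k, 2 * α k * (l k y + β k) * l k (EuclideanSpace.single j 1))
      (∑ k, (2 * α k * l k (EuclideanSpace.single j 1)) • l k) x := by
    apply HasFDerivAt.const_add
    apply HasFDerivAt.fun_sum
    intro k _
    have := ((((l k).hasFDerivAt (x := x)).add_const (β k)).const_mul (2 * α k)).mul_const
      (l k (EuclideanSpace.single j 1))
    exact this.congr_fderiv (by ext v; simp; ring)
  rw [h.fderiv]
  simp only [_root_.sum_apply, _root_.smul_apply, smul_eq_mul]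
  exact Finset.sum_congr rfl fun k _ => by ring

end quad

end

/-- The Bregman distance `u(y) - u(x) - ∇u(x)·(y - x)`. -/
def breg {n : ℕ} (u : E n → ℝ) (x y : E n) : ℝ := u y - u x - fderiv ℝ u x (y - x)

/-- The standing assumptions in the form in which they are used. -/
structure MAData {n : ℕ} (Ω : Set (E n)) (u : E n → ℝ) (lam Lam : ℝ) : Prop where
  isOpen : IsOpen Ω
  bounded : Bornology.IsBounded Ω
  convex : ConvexOn ℝ (closure Ω) u
  cont : ContinuousOn u (closure Ω)
  smooth : ∀ x ∈ Ω, ContDiffAt ℝ (⊤ : ℕ∞) u x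
  zero_bdry : ∀ x ∈ frontier Ω, u x = 0
  lam_pos : 0 < lam
  le_det : ∀ x ∈ Ω, lam ≤ (Hess u x).det
  det_le : ∀ x ∈ Ω, (Hess u x).det ≤ Lam

theorem MASetup.toMAData {n : ℕ} {Ω : Set (E n)} {u : E n → ℝ} {lam Lam : ℝ} (h : MASetup Ω u)
    (hd : DetBounds Ω u lam Lam) (hl : 0 < lam) : MAData Ω u lam Lam where
  isOpen := h.1
  bounded := h.2.1
  convex := h.2.2.2.2.2.1
  cont := h.2.2.2.2.1.continuousOn
  smooth _ hx := h.2.2.2.2.1.contDiffAt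
    (Filter.mem_of_superset (h.1.mem_nhds hx) subset_closure)
  zero_bdry := h.2.2.2.2.2.2
  lam_pos := hl
  le_det x hx := (hd x hx).1
  det_le x hx := (hd x hx).2

theorem two_le_smooth : (2 : WithTop ℕ∞) ≤ ((⊤ : ℕ∞) : WithTop ℕ∞) :=
  WithTop.coe_le_coe.2 (le_top : (2 : ℕ∞) ≤ ⊤)

section basics
variable {n : ℕ} {Ω : Set (E n)} {u : E n → ℝ} {lam Lam : ℝ}

theorem breg_self (x : E n) : breg u x x = 0 := by simp [breg]

namespace MAData

theorem isCompact_closure (h : MAData Ω u lam Lam) : IsCompact (closure Ω) :=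
  h.bounded.isCompact_closure

theorem smooth_two (h : MAData Ω u lam Lam) {x : E n} (hx : x ∈ Ω) : ContDiffAt ℝ 2 u x :=
  (h.smooth x hx).of_le two_le_smooth

theorem differentiableAt (h : MAData Ω u lam Lam) {x : E n} (hx : x ∈ Ω) :
    DifferentiableAt ℝ u x :=
  (h.smooth x hx).differentiableAt (by simp)

theorem breg_nonneg (h : MAData Ω u lam Lam) {x y : E n} (hx : x ∈ Ω) (hy : y ∈ closure Ω) :
    0 ≤ breg u x y := by
  have hd : HasDerivAt (fun t : ℝ => u (x + t • (y - x))) (fderiv ℝ u x (y - x)) 0 := by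
    have h1 : HasDerivAt (fun t : ℝ => x + t • (y - x)) (y - x) 0 := by
      simpa using ((hasDerivAt_id (0 : ℝ)).smul_const (y - x)).const_add x
    have h2 : HasFDerivAt u (fderiv ℝ u x) (x + (0 : ℝ) • (y - x)) := by
      simpa using (h.differentiableAt hx).hasFDerivAt
    exact h2.comp_hasDerivAt 0 h1
  have ht := hd.tendsto_slope_zero_right
  have : fderiv ℝ u x (y - x) ≤ u y - u x := by
    refine le_of_tendsto ht ?_
    filter_upwards [Ioo_mem_nhdsGT (show (0 : ℝ) < 1 by norm_num)] with t htt
    have hc := h.convex.2 (subset_closure hx) hy (show (0 : ℝ) ≤ 1 - t by linarith [htt.2])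
      htt.1.le (by ring)
    have he : (1 - t) • x + t • y = x + t • (y - x) := by
      rw [smul_sub, sub_smul, one_smul]; abel
    rw [he] at hc
    simp only [smul_eq_mul] at hc
    simp only [zero_add, zero_smul, add_zero, smul_eq_mul]
    rw [inv_mul_le_iff₀ htt.1]
    linarith
  unfold breg
  linarith

theorem breg_contDiffAt (h : MAData Ω u lam Lam) (x : E n) {y : E n} (hy : y ∈ Ω) :
    ContDiffAt ℝ (⊤ : ℕ∞) (breg u x) y := by
  unfold breg
  refine ((h.smooth y hy).sub contDiffAt_const).sub ?_
  exact (fderiv ℝ u x).contDiff.contDiffAt.comp y (contDiffAt_id.sub contDiffAt_const)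

theorem breg_continuousOn (h : MAData Ω u lam Lam) (x : E n) :
    ContinuousOn (breg u x) (closure Ω) := by
  unfold breg
  refine (h.cont.sub continuousOn_const).sub (Continuous.continuousOn ?_)
  fun_prop

theorem breg_convexOn (h : MAData Ω u lam Lam) (x : E n) :
    ConvexOn ℝ (closure Ω) (breg u x) := by
  refine ⟨h.convex.1, fun y hy z hz a b ha hb hab => ?_⟩
  have := h.convex.2 hy hz ha hb hab
  unfold breg
  simp only [smul_eq_mul, map_sub, map_add, map_smul] at this ⊢
  have hb' : b = 1 - a := by linarith
  subst hb'
  linarith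

theorem Hess_breg (h : MAData Ω u lam Lam) (x : E n) {y : E n} (hy : y ∈ Ω) :
    Hess (breg u x) y = Hess u y := by
  have e : breg u x = fun y => u y - quadFn (ι := Fin 0) (fderiv ℝ u x) (u x - fderiv ℝ u x x)
      (fun _ => 0) (fun _ => 0) (fun _ => 0) y := by
    funext z; simp [breg, quadFn]; ring
  rw [e, Hess_sub (h.smooth_two hy) (quadFn_contDiff _ _ _ _ _ 2).contDiffAt, Hess_quadFn]
  ext i j; simp

theorem Hess_posSemidef (h : MAData Ω u lam Lam) {x : E n} (hx : x ∈ Ω) :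
    (Hess u x).PosSemidef := by
  rw [← h.Hess_breg x hx]
  refine Hess_posSemidef_of_isLocalMin ((h.breg_contDiffAt x hx).of_le
    two_le_smooth) ?_
  filter_upwards [h.isOpen.mem_nhds hx] with y hy
  rw [breg_self]
  exact h.breg_nonneg hx (subset_closure hy)

theorem Hess_posDef (h : MAData Ω u lam Lam) {x : E n} (hx : x ∈ Ω) :
    (Hess u x).PosDef := by
  refine (h.Hess_posSemidef hx).posDef_iff_isUnit.2 ?_
  rw [Matrix.isUnit_iff_isUnit_det]
  exact isUnit_iff_ne_zero.2 (h.lam_pos.trans_le (h.le_det x hx)).ne'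

theorem cmp_above (h : MAData Ω u lam Lam) {K : Set (E n)} (hK : IsCompact K)
    (hKΩ : K ⊆ closure Ω) {q : E n → ℝ} (hq : ContDiff ℝ 2 q)
    (hb : ∀ x ∈ K, u x ≤ q x ∨ (x ∈ Ω ∧ K ∈ nhds x ∧ (Hess q x).PosDef ∧ (Hess q x).det < lam))
    {x : E n} (hx : x ∈ K) : u x ≤ q x := by
  obtain ⟨z, hz, hmax⟩ := hK.exists_isMaxOn ⟨x, hx⟩
    ((h.cont.mono hKΩ).sub hq.continuous.continuousOn)
  have hxz : u x - q x ≤ u z - q z := hmax hx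
  rcases hb z hz with h1 | ⟨hzΩ, hn, hpd, hdet⟩
  · linarith
  exfalso
  have hloc : IsLocalMin (fun y => q y - u y) z := by
    filter_upwards [hn] with y hy
    have : u y - q y ≤ u z - q z := hmax hy
    linarith
  have hps := Hess_posSemidef_of_isLocalMin (hq.contDiffAt.sub (h.smooth_two hzΩ)) hloc
  rw [Hess_sub hq.contDiffAt (h.smooth_two hzΩ)] at hps
  have := Matrix.PosSemidef.det_le_det (h.Hess_posSemidef hzΩ) hpd hps
  linarith [h.le_det z hzΩ]

theorem cmp_below (h : MAData Ω u lam Lam) {K : Set (E n)} (hK : IsCompact K)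
    (hKΩ : K ⊆ closure Ω) {q : E n → ℝ} (hq : ContDiff ℝ 2 q)
    (hb : ∀ x ∈ K, q x ≤ u x ∨ (x ∈ Ω ∧ K ∈ nhds x ∧ (Hess q x).PosDef ∧ Lam < (Hess q x).det))
    {x : E n} (hx : x ∈ K) : q x ≤ u x := by
  obtain ⟨z, hz, hmax⟩ := hK.exists_isMaxOn ⟨x, hx⟩
    (hq.continuous.continuousOn.sub (h.cont.mono hKΩ))
  have hxz : q x - u x ≤ q z - u z := hmax hx
  rcases hb z hz with h1 | ⟨hzΩ, hn, hpd, hdet⟩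
  · linarith
  exfalso
  have hloc : IsLocalMin (fun y => u y - q y) z := by
    filter_upwards [hn] with y hy
    have : q y - u y ≤ q z - u z := hmax hy
    linarith
  have hps := Hess_posSemidef_of_isLocalMin ((h.smooth_two hzΩ).sub hq.contDiffAt) hloc
  rw [Hess_sub (h.smooth_two hzΩ) hq.contDiffAt] at hps
  have := Matrix.PosSemidef.det_le_det hpd.posSemidef (h.Hess_posDef hzΩ) hps
  linarith [h.det_le z hzΩ]

end MAData
end basics

theorem Module.Basis.det_update_eq_mul_repr {ι R M : Type*} [Fintype ι] [DecidableEq ι]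
    [CommRing R] [AddCommGroup M] [Module R M] (e b : Module.Basis ι R M) (i : ι) (w : M) :
    e.det (Function.update b i w) = e.det b * b.repr w i := by
  conv_lhs => rw [AlternatingMap.eq_smul_basis_det b e.det]
  rw [AlternatingMap.smul_apply, smul_eq_mul, Module.Basis.det_apply b,
    Module.Basis.toMatrix_update, Module.Basis.toMatrix_self, ← Matrix.cramer_apply,
    Matrix.cramer_one]
  rfl

theorem exists_frame_max {n : ℕ} {K : Set (E n)} (hK : IsCompact K) (hi : (interior K).Nonempty) :
    ∃ z ∈ K, ∃ p : Fin n → E n, (∀ i, p i ∈ K) ∧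
      0 < |(EuclideanSpace.basisFun (Fin n) ℝ).toBasis.det fun i => p i - z| ∧
      ∀ i, ∀ x ∈ K,
        |(EuclideanSpace.basisFun (Fin n) ℝ).toBasis.det fun j => Function.update p i x j - z| ≤
          |(EuclideanSpace.basisFun (Fin n) ℝ).toBasis.det fun i => p i - z| := by
  obtain ⟨e, he⟩ : ∃ e, e = (EuclideanSpace.basisFun (Fin n) ℝ).toBasis := ⟨_, rfl⟩
  rw [← he]
  have hS : IsCompact (K ×ˢ Set.univ.pi fun _ : Fin n => K) :=
    hK.prod (isCompact_univ_pi fun _ => hK)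
  have hf : Continuous fun p : E n × (Fin n → E n) => |e.det fun i => p.2 i - p.1| := by
    refine Continuous.abs ?_
    simp only [Module.Basis.det_apply]
    refine Continuous.matrix_det ?_
    refine continuous_matrix fun i j => ?_
    have : ∀ p : E n × (Fin n → E n), (e.toMatrix fun i => p.2 i - p.1) i j = p.2 j i - p.1 i := by
      intro p
      rw [Module.Basis.toMatrix_apply, he]
      simp
    simp only [this]
    fun_prop
  obtain ⟨w, hw⟩ := hi
  obtain ⟨ε, hε, hball⟩ := Metric.mem_nhds_iff.1 (mem_interior_iff_mem_nhds.1 hw)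
  have hp : ∀ i, w + (ε / 2) • e i ∈ K := by
    intro i
    apply hball
    simp [he, norm_smul, abs_of_pos hε, hε]
  obtain ⟨q, hzp, hmax⟩ := hS.exists_isMaxOn
    ⟨(w, fun i => w + (ε / 2) • e i), hball (Metric.mem_ball_self hε), fun i _ => hp i⟩
    hf.continuousOn
  obtain ⟨z, p⟩ := q
  have hmax' : ∀ (z' : E n) (p' : Fin n → E n), z' ∈ K → (∀ i, p' i ∈ K) →
      |e.det fun i => p' i - z'| ≤ |e.det fun i => p i - z| := fun z' p' h h' =>
    isMaxOn_iff.1 hmax (z', p') ⟨h, fun i _ => h' i⟩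
  clear hmax hf
  have hpos : 0 < |e.det fun i => p i - z| := by
    refine lt_of_lt_of_le ?_ (hmax' w (fun i => w + (ε / 2) • e i)
      (hball (Metric.mem_ball_self hε)) hp)
    simp only [add_sub_cancel_left]
    rw [show (fun i => (ε / 2) • e i) = fun i => (fun _ : Fin n => ε / 2) i • e i from rfl,
      AlternatingMap.map_smul_univ, e.det_self]
    have : (0 : ℝ) < (ε / 2) ^ n := by positivity
    simpa using this.ne'
  refine ⟨z, hzp.1, p, fun i => hzp.2 i (Set.mem_univ _), hpos, fun i x hx => ?_⟩
  refine hmax' z (Function.update p i x) hzp.1 fun j => ?_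
  by_cases hj : j = i
  · subst hj; simpa using hx
  · simpa [hj] using hzp.2 j (Set.mem_univ _)

/-- A frame of points of `K` in whose coordinates `K` lies in the unit cube. -/
theorem exists_frame {n : ℕ} {K : Set (E n)} (hK : IsCompact K) (hi : (interior K).Nonempty) :
    ∃ z ∈ K, ∃ b : Module.Basis (Fin n) ℝ (E n), (∀ i, z + b i ∈ K) ∧
      ∀ x ∈ K, ∀ i, |b.repr (x - z) i| ≤ 1 := by
  obtain ⟨z, hz, p, hp, hpos, hmax⟩ := exists_frame_max hK hi
  set e := (EuclideanSpace.basisFun (Fin n) ℝ).toBasis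
  clear_value e
  have hb := (Module.Basis.is_basis_iff_det e).2 (isUnit_iff_ne_zero.2 (abs_pos.1 hpos))
  obtain ⟨b, hbi⟩ : ∃ b : Module.Basis (Fin n) ℝ (E n), ∀ i, b i = p i - z :=
    ⟨Module.Basis.mk hb.1 hb.2.ge, fun i => by simp⟩
  have h3 : (fun i => p i - z) = b := by funext j; rw [hbi]
  refine ⟨z, hz, b, fun i => ?_, fun x hx i => ?_⟩
  · rw [hbi]; simpa using hp i
  have key := hmax i x hx
  have h2 : (fun j => Function.update p i x j - z) = Function.update b i (x - z) := by
    funext j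
    by_cases hj : j = i
    · subst hj; simp
    · simp [hj, hbi]
  rw [h3] at hpos key
  rw [h2, Module.Basis.det_update_eq_mul_repr e b i (x - z), abs_mul] at key
  nlinarith

section frame
variable {n : ℕ}

/-- Coordinates of the standard basis in the frame `b`. -/
def frameMat (b : Module.Basis (Fin n) ℝ (E n)) : Matrix (Fin n) (Fin n) ℝ :=
  Matrix.of fun k i => b.repr (EuclideanSpace.single i 1) k

/-- The `k`-th coordinate in the frame `b`. -/
def frameCoord (b : Module.Basis (Fin n) ℝ (E n)) (k : Fin n) : E n →L[ℝ] ℝ :=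
  LinearMap.toContinuousLinearMap (b.coord k)

@[simp] theorem frameCoord_apply (b : Module.Basis (Fin n) ℝ (E n)) (k : Fin n) (x : E n) :
    frameCoord b k x = b.repr x k := rfl

theorem frameMat_eq (b : Module.Basis (Fin n) ℝ (E n)) :
    frameMat b = b.toMatrix (EuclideanSpace.basisFun (Fin n) ℝ).toBasis := by
  ext k i
  simp [frameMat, Module.Basis.toMatrix_apply]

theorem frameMat_det_ne_zero (b : Module.Basis (Fin n) ℝ (E n)) : (frameMat b).det ≠ 0 := by
  rw [frameMat_eq, ← Module.Basis.det_apply]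
  exact (Module.Basis.isUnit_det b _).ne_zero

/-- An affine function plus `M` times the square of an affine function plus `κ` times
a sum of squared frame coordinates. -/
def frameQuad (b : Module.Basis (Fin n) ℝ (E n)) (L : E n →L[ℝ] ℝ) (c : ℝ) (M : ℝ)
    (l : E n →L[ℝ] ℝ) (s : ℝ) (κ : ℝ) (β : Fin n → ℝ) : E n → ℝ :=
  quadFn L c (fun o : Option (Fin n) => o.elim l (frameCoord b)) (fun o => o.elim M fun _ => κ)
    (fun o => o.elim s β)

variable (b : Module.Basis (Fin n) ℝ (E n)) (L : E n →L[ℝ] ℝ) (c : ℝ) (M : ℝ)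
    (l : E n →L[ℝ] ℝ) (s : ℝ) (κ : ℝ) (β : Fin n → ℝ)

theorem frameQuad_apply (x : E n) : frameQuad b L c M l s κ β x =
    c + L x + (M * (l x + s) ^ 2 + κ * ∑ k, (b.repr x k + β k) ^ 2) := by
  simp [frameQuad, quadFn, Finset.mul_sum]

theorem frameQuad_contDiff : ContDiff ℝ 2 (frameQuad b L c M l s κ β) := quadFn_contDiff _ _ _ _ _ 2

theorem Hess_frameQuad (x : E n) : Hess (frameQuad b L c M l s κ β) x =
    (frameMat b).transpose * ((2 * κ) • 1 + (2 * M) • Matrix.vecMulVec (fun k => l (b k)) (fun k => l (b k))) *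
      frameMat b := by
  have hl : ∀ i, l (EuclideanSpace.single i 1) = ∑ k, frameMat b k i * l (b k) := by
    intro i
    conv_lhs => rw [← b.sum_repr (EuclideanSpace.single i 1)]
    rw [map_sum]
    simp [frameMat]
  rw [frameQuad, Hess_quadFn, Matrix.mul_add, Matrix.add_mul]
  ext i j
  rw [Matrix.of_apply, Fintype.sum_option]
  simp only [Option.elim, Matrix.add_apply, Matrix.mul_smul, Matrix.smul_mul, Matrix.mul_one,
    Matrix.smul_apply, smul_eq_mul, Matrix.mul_vecMulVec, Matrix.vecMulVec_mul]
  rw [add_comm]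
  congr 1
  · rw [Matrix.mul_apply, Finset.mul_sum]
    refine Finset.sum_congr rfl fun k _ => ?_
    simp [frameMat]
    ring
  · rw [Matrix.vecMulVec_apply, hl, hl]
    simp only [Matrix.mulVec, Matrix.vecMul, dotProduct, Matrix.transpose_apply]
    rw [mul_assoc]
    congr 2
    exact Finset.sum_congr rfl fun k _ => by ring

theorem Hess_frameQuad_posDef (hκ : 0 < κ) (hM : 0 ≤ M) (x : E n) :
    (Hess (frameQuad b L c M l s κ β) x).PosDef := by
  rw [Hess_frameQuad]
  have h1 : ((2 * κ) • (1 : Matrix (Fin n) (Fin n) ℝ)).PosDef :=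
    Matrix.PosDef.one.smul (by positivity)
  have h2 : ((2 * M) • Matrix.vecMulVec (fun k => l (b k)) (fun k => l (b k))).PosSemidef := by
    refine Matrix.PosSemidef.smul ?_ (by positivity)
    simpa using Matrix.posSemidef_vecMulVec_self_star (fun k => l (b k))
  have h3 := h1.add_posSemidef h2
  have := h3.conjTranspose_mul_mul_same (B := frameMat b)
    (Matrix.mulVec_injective_of_isUnit
      ((Matrix.isUnit_iff_isUnit_det _).2 (isUnit_iff_ne_zero.2 (frameMat_det_ne_zero b))))
  simpa using this

theorem det_Hess_frameQuad (hκ : κ ≠ 0) (x : E n) :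
    (Hess (frameQuad b L c M l s κ β) x).det =
      (frameMat b).det ^ 2 * ((2 * κ) ^ n * (1 + M / κ * ∑ k, l (b k) ^ 2)) := by
  rw [Hess_frameQuad, Matrix.det_mul, Matrix.det_mul, Matrix.det_transpose]
  have : (2 * κ) • (1 : Matrix (Fin n) (Fin n) ℝ) +
      (2 * M) • Matrix.vecMulVec (fun k => l (b k)) (fun k => l (b k)) =
      (2 * κ) • (1 + Matrix.vecMulVec (fun k => M / κ * l (b k)) (fun k => l (b k))) := by
    ext i j
    simp [Matrix.vecMulVec_apply]
    field_simp
  rw [this, Matrix.det_smul, Fintype.card_fin, Matrix.vecMulVec_eq Unit,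
    Matrix.det_one_add_replicateCol_mul_replicateRow]
  simp only [dotProduct, Finset.mul_sum]
  have : ∑ k, l (b k) * (M / κ * l (b k)) = ∑ k, M / κ * l (b k) ^ 2 :=
    Finset.sum_congr rfl fun k _ => by ring
  rw [this]
  ring

end frame

section

variable {n : ℕ} {Ω : Set (E n)} {u : E n → ℝ} {lam Lam : ℝ}

/-- The part of the closed domain on which `u` lies below the affine function `c + L`. -/
def capSet (Ω : Set (E n)) (u : E n → ℝ) (L : E n →L[ℝ] ℝ) (c : ℝ) : Set (E n) :=
  {x ∈ closure Ω | u x ≤ c + L x}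

theorem Convex.mem_of_frame {K : Set (E n)} (hK : Convex ℝ K) {b : Module.Basis (Fin n) ℝ (E n)}
    {z : E n} (hz : z ∈ K) (hb : ∀ i, z + b i ∈ K) {x : E n} (h0 : ∀ k, 0 ≤ b.repr (x - z) k)
    (h1 : ∑ k, b.repr (x - z) k ≤ 1) : x ∈ K := by
  have := hK.sum_mem (t := Finset.univ)
    (w := fun o : Option (Fin n) => o.elim (1 - ∑ k, b.repr (x - z) k) fun k => b.repr (x - z) k)
    (z := fun o => o.elim z fun k => z + b k)
    (fun o _ => by cases o <;> simp_all)
    (by simp [Fintype.sum_option])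
    (fun o _ => by cases o <;> simp_all)
  convert this using 1
  simp only [Fintype.sum_option, Option.elim, smul_add, Finset.sum_add_distrib, ← Finset.sum_smul]
  rw [b.sum_repr, sub_smul, one_smul]
  abel

namespace MAData

theorem capSet_convex (h : MAData Ω u lam Lam) (L : E n →L[ℝ] ℝ) (c : ℝ) :
    Convex ℝ (capSet Ω u L c) := by
  intro x hx y hy a b ha hb hab
  refine ⟨h.convex.1 hx.1 hy.1 ha hb hab, (h.convex.2 hx.1 hy.1 ha hb hab).trans ?_⟩
  have h1 := mul_le_mul_of_nonneg_left hx.2 ha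
  have h2 := mul_le_mul_of_nonneg_left hy.2 hb
  simp only [smul_eq_mul, map_add, map_smul]
  have hb' : b = 1 - a := by linarith
  subst hb'
  linarith

theorem capSet_isClosed (h : MAData Ω u lam Lam) (L : E n →L[ℝ] ℝ) (c : ℝ) :
    IsClosed (capSet Ω u L c) := by
  have : capSet Ω u L c = closure Ω ∩ (fun x => u x - L x) ⁻¹' Set.Iic c := by
    ext x; simp [capSet]
  rw [this]
  exact (h.cont.sub L.continuous.continuousOn).preimage_isClosed_of_isClosed isClosed_closure
    isClosed_Iic

theorem capSet_isCompact (h : MAData Ω u lam Lam) (L : E n →L[ℝ] ℝ) (c : ℝ) :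
    IsCompact (capSet Ω u L c) :=
  h.isCompact_closure.of_isClosed_subset (h.capSet_isClosed L c) fun _ hx => hx.1

theorem capSet_mem_nhds (h : MAData Ω u lam Lam) {L : E n →L[ℝ] ℝ} {c : ℝ} {x : E n}
    (hx : x ∈ Ω) (hlt : u x < c + L x) : capSet Ω u L c ∈ nhds x := by
  have h1 : ContinuousAt (fun y => c + L y - u y) x :=
    ((continuous_const.add L.continuous).continuousAt).sub (h.smooth x hx).continuousAt
  filter_upwards [h.isOpen.mem_nhds hx, h1.eventually (lt_mem_nhds (show 0 < c + L x - u x by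
    linarith))] with y hy hy'
  exact ⟨subset_closure hy, by linarith⟩

theorem frame_lower (h : MAData Ω u lam Lam) (hn : 0 < n) {L : E n →L[ℝ] ℝ} {c H : ℝ}
    (hK : capSet Ω u L c ⊆ Ω) (hH : 0 < H) (hle : ∀ x ∈ capSet Ω u L c, c + L x - u x ≤ H)
    {b : Module.Basis (Fin n) ℝ (E n)} {z : E n} (hz : z ∈ capSet Ω u L c)
    (hb : ∀ i, z + b i ∈ capSet Ω u L c) :
    lam ≤ (16 * n ^ 2 * H) ^ n * (frameMat b).det ^ 2 := by
  by_contra! hcon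
  have hn' : (0 : ℝ) < n := by exact_mod_cast hn
  set κ : ℝ := 8 * n ^ 2 * H with hκ
  have hκ0 : 0 < κ := by positivity
  set r : ℝ := 1 / (2 * n) with hr
  have hr0 : 0 < r := by positivity
  set q := frameQuad b L (c - κ * r ^ 2) 0 0 0 κ (fun k => - b.repr z k - r) with hq
  set Q : E n → ℝ := fun x => ∑ k, (b.repr x k + (- b.repr z k - r)) ^ 2 with hQ
  have hqQ : ∀ x, q x = c + L x + κ * (Q x - r ^ 2) := by
    intro x
    rw [hq, frameQuad_apply]
    ring
  have hQc : Continuous Q := by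
    have : ∀ k, Continuous fun x : E n => b.repr x k := fun k => (frameCoord b k).continuous
    simp only [hQ]
    fun_prop
  set K := {x | Q x ≤ r ^ 2} with hKdef
  have hKsub : K ⊆ capSet Ω u L c := by
    intro x hx
    have hk : ∀ k, (b.repr x k - b.repr z k - r) ^ 2 ≤ r ^ 2 := by
      intro k
      refine le_trans ?_ hx
      have := Finset.single_le_sum (f := fun k => (b.repr x k + (- b.repr z k - r)) ^ 2)
        (fun i _ => sq_nonneg _) (Finset.mem_univ k)
      refine le_trans (le_of_eq ?_) this
      ring
    have hk' : ∀ k, 0 ≤ b.repr (x - z) k ∧ b.repr (x - z) k ≤ 1 / n := by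
      intro k
      have := abs_le_of_sq_le_sq' (hk k) hr0.le
      have e : (1 : ℝ) / n = 2 * r := by rw [hr]; field_simp
      simp only [map_sub, Finsupp.sub_apply]
      rw [e]
      constructor <;> linarith [this.1, this.2]
    refine (h.capSet_convex L c).mem_of_frame hz hb (fun k => (hk' k).1) ?_
    refine (Finset.sum_le_sum fun k _ => (hk' k).2).trans ?_
    simp [hn'.ne']
  have hKc : IsCompact K := (h.capSet_isCompact L c).of_isClosed_subset
    (isClosed_le hQc continuous_const) hKsub
  obtain ⟨x, hx⟩ : ∃ x : E n, Q x = 0 := by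
    refine ⟨z + ∑ k, r • b k, ?_⟩
    simp [hQ, map_sum, Finsupp.single_apply]
  have hxK : x ∈ K := by
    show Q x ≤ r ^ 2
    rw [hx]; positivity
  have hbd : ∀ y ∈ K, u y ≤ q y ∨
      (y ∈ Ω ∧ K ∈ nhds y ∧ (Hess q y).PosDef ∧ (Hess q y).det < lam) := by
    intro y hy
    rcases (show Q y ≤ r ^ 2 from hy).lt_or_eq with hlt | heq
    · refine Or.inr ⟨hK (hKsub hy), ?_, Hess_frameQuad_posDef b L _ 0 0 0 κ _ hκ0 le_rfl y, ?_⟩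
      · filter_upwards [hQc.continuousAt.eventually (gt_mem_nhds hlt)] with w hw using le_of_lt hw
      · rw [hq, det_Hess_frameQuad _ _ _ _ _ _ _ _ hκ0.ne']
        refine lt_of_le_of_lt (le_of_eq ?_) hcon
        rw [hκ]; simp; ring
    · left
      rw [hqQ, heq]
      have := (hKsub hy).2
      linarith
  have hcmp : u x ≤ q x := h.cmp_above hKc (fun y hy => (hKsub hy).1) (frameQuad_contDiff b L _ 0 0 0 κ _)
    hbd hxK
  rw [hqQ, hx] at hcmp
  have := hle x (hKsub hxK)
  have e : κ * r ^ 2 = 2 * H := by rw [hκ, hr]; field_simp; norm_num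
  linarith

end MAData

end

section

variable {n : ℕ} {Ω : Set (E n)} {u : E n → ℝ} {lam Lam : ℝ}

/-- The constant of `MAData.star`. -/
def starC (n : ℕ) (lam Lam : ℝ) : ℝ := min (1 / 2) (lam / (64 * Lam * (64 * n ^ 3) ^ n))

theorem starC_pos_of_le (hn : 0 < n) (hlam : 0 < lam) (hlL : lam ≤ Lam) :
    0 < starC n lam Lam := by
  have := hlam.trans_le hlL
  exact lt_min (by norm_num) (by positivity)

namespace MAData

theorem Lam_pos (h : MAData Ω u lam Lam) {x : E n} (hx : x ∈ Ω) : 0 < Lam :=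
  h.lam_pos.trans_le ((h.le_det x hx).trans (h.det_le x hx))

theorem star_normalized (h : MAData Ω u lam Lam) (hn : 0 < n) {L : E n →L[ℝ] ℝ} {c H : ℝ}
    (hK : capSet Ω u L c ⊆ Ω) (hH : 0 < H) (hle : ∀ x ∈ capSet Ω u L c, c + L x - u x ≤ H)
    {y z : E n} (hy : y ∈ capSet Ω u L c) (hyH : H / 4 ≤ c + L y - u y) {m : E n →L[ℝ] ℝ} {s : ℝ}
    (hm0 : ∀ x ∈ capSet Ω u L c, 0 ≤ m x + s) (hm1 : ∀ x ∈ capSet Ω u L c, m x + s ≤ 1)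
    (hz : z ∈ capSet Ω u L c) (hmz : m z + s = 1) :
    starC n lam Lam ≤ m y + s := by
  have hLam := h.Lam_pos (hK hy)
  have hlam := h.lam_pos
  rcases le_or_gt (1 / 2) (m y + s) with hc | hc
  · exact (min_le_left _ _).trans hc
  refine (min_le_right _ _).trans ?_
  have hn' : (0 : ℝ) < n := by exact_mod_cast hn
  have hint : (interior (capSet Ω u L c)).Nonempty :=
    ⟨y, mem_interior_iff_mem_nhds.2 (h.capSet_mem_nhds (hK hy) (by linarith))⟩
  obtain ⟨w, hw, b, hb, hbK⟩ := exists_frame (h.capSet_isCompact L c) hint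
  have hA1 := h.frame_lower hn hK hH hle hw hb
  set D2 := (frameMat b).det ^ 2 with hD2
  have hD2pos : 0 < D2 := by
    have := frameMat_det_ne_zero b
    positivity
  have hsum : 1 / (16 * n) ≤ ∑ k, m (b k) ^ 2 := by
    have hdiff : ∀ x ∈ capSet Ω u L c, |m x - m w| ≤ ∑ k, |m (b k)| := by
      intro x hx
      have e : m x - m w = ∑ k, b.repr (x - w) k * m (b k) := by
        rw [← map_sub]
        conv_lhs => rw [← b.sum_repr (x - w)]
        rw [map_sum]
        simp
      rw [e]
      refine (Finset.abs_sum_le_sum_abs _ _).trans (Finset.sum_le_sum fun k _ => ?_)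
      rw [abs_mul]
      exact mul_le_of_le_one_left (abs_nonneg _) (hbK x hx k)
    have h1 := abs_le.1 (hdiff y hy)
    have h2 := abs_le.1 (hdiff z hz)
    have h3 : 1 / 4 ≤ ∑ k, |m (b k)| := by linarith [h1.1, h2.2]
    have h4 := sq_sum_le_card_mul_sum_sq (s := Finset.univ) (f := fun k => |m (b k)|)
    simp only [sq_abs, Finset.card_univ, Fintype.card_fin] at h4
    have h5 : (1 / 16 : ℝ) ≤ (∑ k, |m (b k)|) ^ 2 := by nlinarith
    rw [div_le_iff₀ (by positivity)]
    linarith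
  set ε : ℝ := H / (8 * n) with hε
  have hε0 : 0 < ε := by positivity
  set M : ℝ := 32 * n * ε * Lam / (D2 * (2 * ε) ^ n) with hM
  have hM0 : 0 < M := by positivity
  set q := frameQuad b L (c - M - ε * n) M m (s - 1) ε (fun k => - b.repr w k) with hq
  have hqv : ∀ x, q x = c + L x + M * ((m x + s - 1) ^ 2 - 1) +
      ε * (∑ k, (b.repr (x - w) k) ^ 2 - n) := by
    intro x
    rw [hq, frameQuad_apply]
    simp only [map_sub, Finsupp.sub_apply, ← sub_eq_add_neg]
    ring
  have hql : ∀ x ∈ capSet Ω u L c, q x ≤ c + L x := by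
    intro x hx
    rw [hqv]
    have h1 : (m x + s - 1) ^ 2 - 1 ≤ 0 := by nlinarith [hm0 x hx, hm1 x hx]
    have h2 : ∑ k, (b.repr (x - w) k) ^ 2 - n ≤ (0 : ℝ) := by
      have : ∑ k, (b.repr (x - w) k) ^ 2 ≤ ∑ k : Fin n, (1 : ℝ) :=
        Finset.sum_le_sum fun k _ => (sq_le_one_iff_abs_le_one _).2 (hbK x hx k)
      simp only [Finset.sum_const, Finset.card_univ, Fintype.card_fin, nsmul_eq_mul,
        mul_one] at this
      linarith
    nlinarith
  have hcmp : q y ≤ u y := by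
    refine h.cmp_below (h.capSet_isCompact L c) (fun x hx => hx.1)
      (frameQuad_contDiff b L _ M m _ ε _) (fun x hx => ?_) hy
    rw [← hq]
    rcases hx.2.lt_or_eq with hlt | heq
    · refine Or.inr ⟨hK hx, h.capSet_mem_nhds (hK hx) hlt,
        Hess_frameQuad_posDef b L _ M m _ ε _ hε0 hM0.le x, ?_⟩
      rw [hq, det_Hess_frameQuad _ _ _ _ _ _ _ _ hε0.ne', ← hD2]
      have h1 : M / ε * (1 / (16 * n)) ≤ M / ε * ∑ k, m (b k) ^ 2 :=
        mul_le_mul_of_nonneg_left hsum (by positivity)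
      have h2 : D2 * ((2 * ε) ^ n * (M / ε * (1 / (16 * n)))) = 2 * Lam := by
        rw [hM]; field_simp; norm_num
      have h3 : D2 * ((2 * ε) ^ n * (M / ε * (1 / (16 * n)))) ≤
          D2 * ((2 * ε) ^ n * (1 + M / ε * ∑ k, m (b k) ^ 2)) := by
        gcongr
        linarith
      linarith
    · left
      rw [heq]
      exact hql x hx
  rw [hqv] at hcmp
  have h1 : 0 ≤ ε * ∑ k, (b.repr (y - w) k) ^ 2 := by positivity
  have h2 : ε * n = H / 8 := by rw [hε]; field_simp
  have h3 : H / 8 ≤ 2 * M * (m y + s) := by nlinarith [hm0 y hy, sq_nonneg (m y + s)]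
  have h4 : M * (m y + s) * (D2 * (2 * ε) ^ n) = 32 * n * ε * Lam * (m y + s) := by
    rw [hM]; field_simp
  have h5 : H / 16 * (D2 * (2 * ε) ^ n) ≤ 32 * n * ε * Lam * (m y + s) := by
    rw [← h4]
    have : 0 ≤ D2 * (2 * ε) ^ n := by positivity
    have h6 : H / 16 ≤ M * (m y + s) := by linarith
    exact mul_le_mul_of_nonneg_right h6 this
  have h6 : H / 16 * (D2 * (2 * ε) ^ n) ≤ 4 * H * Lam * (m y + s) := by
    refine h5.trans (le_of_eq ?_)
    rw [hε]; field_simp; ring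
  have h7 : D2 * (2 * ε) ^ n ≤ 64 * Lam * (m y + s) := by
    by_contra! hcon
    nlinarith
  have h8 : lam ≤ (64 * n ^ 3) ^ n * (D2 * (2 * ε) ^ n) := by
    refine hA1.trans (le_of_eq ?_)
    rw [mul_comm D2, ← mul_assoc, ← mul_pow]
    congr 2
    rw [hε]; field_simp; norm_num
  rw [div_le_iff₀ (by positivity)]
  calc lam ≤ (64 * n ^ 3) ^ n * (D2 * (2 * ε) ^ n) := h8
    _ ≤ (64 * n ^ 3) ^ n * (64 * Lam * (m y + s)) := by gcongr
    _ = _ := by ring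

theorem star (h : MAData Ω u lam Lam) (hn : 0 < n) {L : E n →L[ℝ] ℝ} {c H : ℝ}
    (hK : capSet Ω u L c ⊆ Ω) (hH : 0 < H) (hle : ∀ x ∈ capSet Ω u L c, c + L x - u x ≤ H)
    {y z : E n} (hy : y ∈ capSet Ω u L c) (hyH : H / 4 ≤ c + L y - u y) {m : E n →L[ℝ] ℝ} {s : ℝ}
    (hm0 : ∀ x ∈ capSet Ω u L c, 0 ≤ m x + s) (hz : z ∈ capSet Ω u L c) :
    starC n lam Lam * (m z + s) ≤ m y + s := by
  have hLam := h.Lam_pos (hK hy)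
  have hlam := h.lam_pos
  have hC0 : 0 ≤ starC n lam Lam := le_min (by norm_num) (by positivity)
  obtain ⟨w, hw, hmax⟩ := (h.capSet_isCompact L c).exists_isMaxOn ⟨y, hy⟩
    (f := fun x => m x + s) (by fun_prop)
  have hmax' : ∀ x ∈ capSet Ω u L c, m x + s ≤ m w + s := fun x hx => hmax hx
  rcases (hm0 w hw).eq_or_lt with h0 | hpos
  · have h1 := hmax' z hz
    have h2 := hm0 z hz
    have : m z + s = 0 := by linarith
    rw [this, mul_zero]
    exact hm0 y hy
  set T := m w + s
  have hT : ∀ x, (T⁻¹ • m) x + T⁻¹ * s = T⁻¹ * (m x + s) := fun x => by simp; ring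
  have := h.star_normalized hn hK hH hle hy hyH (m := T⁻¹ • m) (s := T⁻¹ * s)
    (fun x hx => by rw [hT]; exact mul_nonneg (inv_nonneg.2 hpos.le) (hm0 x hx))
    (fun x hx => by
      rw [hT, inv_mul_le_iff₀ hpos, mul_one]; exact hmax' x hx) hw
    (by rw [hT]; exact inv_mul_cancel₀ hpos.ne')
  rw [hT, le_inv_mul_iff₀ hpos, mul_comm] at this
  exact (mul_le_mul_of_nonneg_left (hmax' z hz) hC0).trans this

theorem starC_pos (h : MAData Ω u lam Lam) (hn : 0 < n) {y : E n} (hy : y ∈ Ω) :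
    0 < starC n lam Lam :=
  starC_pos_of_le hn h.lam_pos ((h.le_det y hy).trans (h.det_le y hy))

end MAData

end

section

variable {n : ℕ} {Ω : Set (E n)} {u : E n → ℝ} {lam Lam : ℝ}

/-- Closed sections. -/
def csec (Ω : Set (E n)) (u : E n → ℝ) (x : E n) (t : ℝ) : Set (E n) :=
  {y ∈ closure Ω | breg u x y ≤ t}

theorem csec_mono (x : E n) {s t : ℝ} (hst : s ≤ t) : csec Ω u x s ⊆ csec Ω u x t :=
  fun _ hy => ⟨hy.1, hy.2.trans hst⟩

theorem csec_eq_capSet (x : E n) (t : ℝ) :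
    csec Ω u x t = capSet Ω u (fderiv ℝ u x) (u x - fderiv ℝ u x x + t) := by
  ext y
  simp only [csec, capSet, breg, Set.mem_ofPred_eq, map_sub]
  refine and_congr_right fun _ => ?_
  constructor <;> intro h <;> linarith

theorem mem_csec_self {x : E n} (hx : x ∈ Ω) {t : ℝ} (ht : 0 ≤ t) : x ∈ csec Ω u x t :=
  ⟨subset_closure hx, by rwa [breg_self]⟩

/-- The engulfing constant of sections. -/
def engC (n : ℕ) (lam Lam : ℝ) : ℝ := 1 + 1 / starC n lam Lam

theorem starC_le (n : ℕ) (lam Lam : ℝ) : starC n lam Lam ≤ 1 / 2 := min_le_left _ _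

theorem three_le_engC (hn : 0 < n) (hlam : 0 < lam) (hlL : lam ≤ Lam) :
    3 ≤ engC n lam Lam := by
  have h1 := starC_pos_of_le hn hlam hlL
  have h2 : 2 ≤ 1 / starC n lam Lam := by
    rw [le_div_iff₀ h1]
    linarith [starC_le n lam Lam]
  unfold engC
  linarith

namespace MAData

theorem csec_isCompact (h : MAData Ω u lam Lam) (x : E n) (t : ℝ) : IsCompact (csec Ω u x t) := by
  rw [csec_eq_capSet]; exact h.capSet_isCompact _ _

theorem csec_isClosed (h : MAData Ω u lam Lam) (x : E n) (t : ℝ) : IsClosed (csec Ω u x t) :=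
  (h.csec_isCompact x t).isClosed

theorem csec_mem_nhds (h : MAData Ω u lam Lam) {x y : E n} {t : ℝ} (hy : y ∈ Ω)
    (hlt : breg u x y < t) : csec Ω u x t ∈ nhds y := by
  rw [csec_eq_capSet]
  refine h.capSet_mem_nhds hy ?_
  simp only [breg, map_sub] at hlt
  linarith

theorem csec_extend (h : MAData Ω u lam Lam) (hn : 0 < n) {x z p : E n} {r : ℝ} (hx : x ∈ Ω)
    (hr : 0 < r) (hsub : csec Ω u x r ⊆ Ω) (hz : z ∈ csec Ω u x (r / 2)) (hp : p ∈ csec Ω u x r) :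
    z + starC n lam Lam • (z - p) ∈ csec Ω u x r := by
  set θ := starC n lam Lam with hθ
  have hθ0 : 0 < θ := h.starC_pos hn hx
  by_contra hcon
  have hz' : z ∈ csec Ω u x r := csec_mono x (by linarith) hz
  have hH : ∀ y ∈ csec Ω u x r, u x - fderiv ℝ u x x + r + fderiv ℝ u x y - u y ≤ r := by
    intro y hy
    have := h.breg_nonneg hx hy.1
    simp only [breg, map_sub] at this
    linarith
  have hzH : r / 4 ≤ u x - fderiv ℝ u x x + r + fderiv ℝ u x z - u z := by
    have := hz.2
    simp only [breg, map_sub] at this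
    linarith
  have hcv : Convex ℝ (csec Ω u x r) := by rw [csec_eq_capSet]; exact h.capSet_convex _ _
  obtain ⟨f, v, hf, hv⟩ := geometric_hahn_banach_closed_point hcv (h.csec_isClosed x r) hcon
  rw [csec_eq_capSet] at hsub hH hf hp hz'
  have := h.star hn hsub hr hH hz' hzH (m := -f) (s := v)
    (fun y hy => by have := hf y hy; simp; linarith) hp
  rw [← hθ] at this
  have hfp := hf p hp
  simp only [_root_.neg_apply, map_add, map_smul, map_sub, smul_eq_mul] at this hv
  nlinarith [mul_pos (mul_pos hθ0 hθ0) (sub_pos.2 hfp)]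

theorem csec_shrink (h : MAData Ω u lam Lam) (hn : 0 < n) {x : E n} {r : ℝ} (hx : x ∈ Ω)
    (hr : 0 < r) (hsub : csec Ω u x r ⊆ Ω) (j : ℕ) :
    ∀ z ∈ csec Ω u x (r / 2 ^ j), x + (1 + starC n lam Lam) ^ j • (z - x) ∈ csec Ω u x r := by
  induction j with
  | zero => intro z hz; simpa using hz
  | succ j ih =>
    intro z hz
    have h1 : r / 2 ^ j ≤ r := div_le_self hr.le (one_le_pow₀ (by norm_num))
    have h2 : 0 < r / 2 ^ j := by positivity
    have := ih _ (h.csec_extend hn hx h2 ((csec_mono x h1).trans hsub) (z := z)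
      (by rwa [pow_succ, ← div_div] at hz) (mem_csec_self hx h2.le))
    convert this using 2
    rw [pow_succ, mul_smul]
    congr 1
    rw [add_smul, one_smul]
    abel

theorem breg_change (u : E n → ℝ) (x y z : E n) :
    breg u y z = breg u x z - breg u x y - (fderiv ℝ u y - fderiv ℝ u x) (z - y) := by
  simp only [breg, map_sub, _root_.sub_apply]; ring

theorem three_le_engC (h : MAData Ω u lam Lam) (hn : 0 < n) {x : E n} (hx : x ∈ Ω) :
    3 ≤ engC n lam Lam :=
  _root_.three_le_engC hn h.lam_pos ((h.le_det x hx).trans (h.det_le x hx))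

theorem csec_engulf (h : MAData Ω u lam Lam) (hn : 0 < n) {x y : E n} {r : ℝ} (hx : x ∈ Ω)
    (hr : 0 < r) (hsub : csec Ω u x r ⊆ Ω) (hy : y ∈ csec Ω u x (r / 2)) :
    csec Ω u x r ⊆ csec Ω u y (engC n lam Lam * r) := by
  intro p hp
  refine ⟨hp.1, ?_⟩
  have hw := h.csec_extend hn hx hr hsub hy hp
  set θ := starC n lam Lam with hθ
  have hθ0 : 0 < θ := h.starC_pos hn hx
  have hyΩ : y ∈ Ω := hsub (csec_mono x (by linarith) hy)
  have h1 := h.breg_nonneg hyΩ hw.1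
  rw [breg_change u x y] at h1 ⊢
  have h2 := hw.2
  have h3 := h.breg_nonneg hx hy.1
  have e : y + θ • (y - p) - y = θ • (y - p) := by abel
  rw [e, map_smul, smul_eq_mul] at h1
  rw [← neg_sub y p, map_neg]
  set G := (fderiv ℝ u y - fderiv ℝ u x) (y - p)
  have h4 : G ≤ r / θ := by rw [le_div_iff₀ hθ0]; linarith
  have h5 := hp.2
  have : engC n lam Lam * r = r + r / θ := by unfold engC; rw [← hθ]; ring
  rw [this]
  linarith

theorem csec_engulf_symm (h : MAData Ω u lam Lam) (hn : 0 < n) {x y : E n} {r : ℝ} (hx : x ∈ Ω)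
    (hr : 0 < r) (hsub : csec Ω u x r ⊆ Ω) (hy : y ∈ csec Ω u x (r / 2))
    (hsub' : csec Ω u y (2 * engC n lam Lam * r) ⊆ Ω) :
    csec Ω u y r ⊆ csec Ω u x (2 * engC n lam Lam ^ 2 * r) := by
  have hC := h.three_le_engC hn hx
  have hyΩ : y ∈ Ω := hsub (csec_mono x (by linarith) hy)
  have h1 := h.csec_engulf hn hx hr hsub hy (mem_csec_self hx hr.le)
  have h2 := h.csec_engulf hn hyΩ (by positivity) hsub'
    (by rwa [show 2 * engC n lam Lam * r / 2 = engC n lam Lam * r by ring])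
  refine (csec_mono y (by nlinarith)).trans (h2.trans (csec_mono x (le_of_eq (by ring))))

theorem breg_chain (h : MAData Ω u lam Lam) (hn : 0 < n) {x y z : E n} {r : ℝ} (hx : x ∈ Ω)
    (hr : 0 < r) (hsub : csec Ω u x r ⊆ Ω) (hy : y ∈ csec Ω u x (r / 2))
    (hsub' : csec Ω u y (2 * engC n lam Lam * r) ⊆ Ω) (j : ℕ) (hz : z ∈ csec Ω u y (r / 2 ^ j)) :
    breg u x z ≤ breg u x y +
      2 * engC n lam Lam ^ 2 * r * (1 + starC n lam Lam)⁻¹ ^ j := by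
  have hC := h.three_le_engC hn hx
  have hyΩ : y ∈ Ω := hsub (csec_mono x (by linarith) hy)
  have hθ0 := h.starC_pos hn hx
  set θ := starC n lam Lam
  have hp := h.csec_shrink hn hyΩ hr
    ((csec_mono y (by nlinarith)).trans hsub') j z hz
  have hp' := (h.csec_engulf_symm hn hx hr hsub hy hsub' hp).2
  set p := y + (1 + θ) ^ j • (z - y) with hpdef
  set ε := (1 + θ)⁻¹ ^ j with hε
  have hε0 : 0 ≤ ε := by positivity
  have hε1 : ε ≤ 1 := pow_le_one₀ (by positivity) (inv_le_one_of_one_le₀ (by linarith))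
  have hcv := (h.breg_convexOn x).2 hy.1 hp.1 (sub_nonneg.2 hε1) hε0 (by ring)
  have e : (1 - ε) • y + ε • p = z := by
    have : ε * (1 + θ) ^ j = 1 := by
      rw [hε, ← mul_pow, inv_mul_cancel₀ (by positivity), one_pow]
    rw [hpdef, smul_add, smul_smul, this, sub_smul, one_smul, one_smul]
    abel
  rw [e] at hcv
  simp only [smul_eq_mul] at hcv
  have h0 := h.breg_nonneg hx hy.1
  nlinarith

end MAData

end

section

variable {n : ℕ} {Ω : Set (E n)} {u : E n → ℝ} {lam Lam : ℝ}

/-- The paraboloid `κ (|x - y|² - d²)`. -/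
def paraboloid (κ : ℝ) (y : E n) (d : ℝ) : E n → ℝ :=
  frameQuad (EuclideanSpace.basisFun (Fin n) ℝ).toBasis 0 (-κ * d ^ 2) 0 0 0 κ (fun k => - y k)

theorem paraboloid_apply (κ : ℝ) (y : E n) (d : ℝ) (x : E n) :
    paraboloid κ y d x = κ * (‖x - y‖ ^ 2 - d ^ 2) := by
  rw [paraboloid, frameQuad_apply, EuclideanSpace.norm_sq_eq]
  simp [← sub_eq_add_neg]
  ring

theorem det_Hess_paraboloid {κ : ℝ} (hκ : 0 < κ) (y : E n) (d : ℝ) (x : E n) :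
    (Hess (paraboloid κ y d) x).det = (2 * κ) ^ n := by
  rw [paraboloid, det_Hess_frameQuad _ _ _ _ _ _ _ _ hκ.ne', frameMat_eq,
    Module.Basis.toMatrix_self]
  simp

theorem exists_pow_two_mul_lt {n : ℕ} (hn : n ≠ 0) {lam : ℝ} (hlam : 0 < lam) :
    ∃ κ : ℝ, 0 < κ ∧ (2 * κ) ^ n < lam := by
  have hc : Filter.Tendsto (fun κ : ℝ => (2 * κ) ^ n) (nhdsWithin 0 (Set.Ioi 0)) (nhds 0) := by
    have h1 : Continuous fun κ : ℝ => (2 * κ) ^ n := by fun_prop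
    have h2 := h1.tendsto 0
    simp only [mul_zero, zero_pow hn] at h2
    exact h2.mono_left nhdsWithin_le_nhds
  have h3 : ∀ᶠ κ in nhdsWithin (0 : ℝ) (Set.Ioi 0), 0 < κ := self_mem_nhdsWithin
  exact (h3.and (hc.eventually (gt_mem_nhds hlam))).exists

namespace MAData

theorem le_paraboloid (h : MAData Ω u lam Lam) {κ : ℝ} (hκ : 0 < κ) (hκl : (2 * κ) ^ n < lam)
    {y : E n} {d : ℝ} (hd : 0 ≤ d) (hball : Metric.ball y d ⊆ Ω) {x : E n} (hx : x ∈ closure Ω) :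
    u x ≤ κ * (‖x - y‖ ^ 2 - d ^ 2) := by
  rw [← paraboloid_apply]
  refine h.cmp_above h.isCompact_closure le_rfl (frameQuad_contDiff _ _ _ _ _ _ _ _)
    (fun z hz => ?_) hx
  by_cases hzΩ : z ∈ Ω
  · exact Or.inr ⟨hzΩ, Filter.mem_of_superset (h.isOpen.mem_nhds hzΩ) subset_closure,
      Hess_frameQuad_posDef _ _ _ _ _ _ _ _ hκ le_rfl z,
      (det_Hess_paraboloid hκ y d z).trans_lt hκl⟩
  · left
    have hfr : z ∈ frontier Ω := by rw [h.isOpen.frontier_eq]; exact ⟨hz, hzΩ⟩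
    rw [h.zero_bdry z hfr]
    change 0 ≤ paraboloid κ y d z
    rw [paraboloid_apply]
    have h1 : d ≤ ‖z - y‖ := by
      by_contra! hcon
      exact hzΩ (hball (by rwa [Metric.mem_ball, dist_eq_norm]))
    have : d ^ 2 ≤ ‖z - y‖ ^ 2 := pow_le_pow_left₀ hd h1 2
    exact mul_nonneg hκ.le (by linarith)

theorem paraboloid_le (h : MAData Ω u lam Lam) {κ : ℝ} (hκ : 0 < κ) (hκl : Lam < (2 * κ) ^ n)
    {R : ℝ} (hball : closure Ω ⊆ Metric.closedBall 0 R) {x : E n}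
    (hx : x ∈ closure Ω) : - (κ * R ^ 2) ≤ u x := by
  have := h.cmp_below h.isCompact_closure le_rfl (q := paraboloid κ 0 R)
    (frameQuad_contDiff _ _ _ _ _ _ _ _)
    (fun z hz => ?_) hx
  · rw [paraboloid_apply] at this
    nlinarith [sq_nonneg ‖x - 0‖]
  by_cases hzΩ : z ∈ Ω
  · exact Or.inr ⟨hzΩ, Filter.mem_of_superset (h.isOpen.mem_nhds hzΩ) subset_closure,
      Hess_frameQuad_posDef _ _ _ _ _ _ _ _ hκ le_rfl z,
      hκl.trans_eq (det_Hess_paraboloid hκ 0 R z).symm⟩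
  · left
    have hfr : z ∈ frontier Ω := by rw [h.isOpen.frontier_eq]; exact ⟨hz, hzΩ⟩
    rw [h.zero_bdry z hfr, paraboloid_apply]
    have h1 : ‖z - 0‖ ≤ R := by simpa using hball hz
    have : ‖z - 0‖ ^ 2 ≤ R ^ 2 := pow_le_pow_left₀ (norm_nonneg _) h1 2
    nlinarith

end MAData

end

section

variable {n : ℕ} {Ω : Set (E n)} {u : E n → ℝ} {lam Lam : ℝ}

/-- The region `u ≤ l + δ(-l - m/2)`, where `l` is the tangent plane of `u` at `y`. -/
def tiltSec (Ω : Set (E n)) (u : E n → ℝ) (m : ℝ) (y : E n) (δ : ℝ) : Set (E n) :=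
  capSet Ω u ((1 - δ) • fderiv ℝ u y) ((1 - δ) * (u y - fderiv ℝ u y y) - δ * (m / 2))

theorem mem_tiltSec {m : ℝ} {y : E n} {δ : ℝ} {x : E n} : x ∈ tiltSec Ω u m y δ ↔
    x ∈ closure Ω ∧ breg u y x ≤ δ * (breg u y x - u x - m / 2) := by
  simp only [tiltSec, capSet, breg, Set.mem_ofPred_eq, map_sub, _root_.smul_apply, smul_eq_mul]
  refine and_congr_right fun _ => ?_
  constructor <;> intro h <;> linarith

namespace MAData

theorem csec_subset_of_bounds (h : MAData Ω u lam Lam) (hn : 0 < n) {m CN : ℝ} (hm : 0 < m)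
    (hCN0 : 0 < CN) (hCN : ∀ x ∈ closure Ω, -u x ≤ CN / 2) {y : E n} (hy : y ∈ Ω) (hym : u y ≤ -m)
    {K : ℕ} (hK : 4 * CN < K * (starC n lam Lam * m)) : csec Ω u y (m / 4 ^ (K + 1)) ⊆ Ω := by
  intro p hp
  by_contra hpΩ
  have hc := starC_le n lam Lam
  have hc0 := h.starC_pos hn hy
  set c := starC n lam Lam
  have hfr : ∀ x ∈ closure Ω, x ∉ Ω → u x = 0 := fun x hx hx' =>
    h.zero_bdry x (by rw [h.isOpen.frontier_eq]; exact ⟨hx, hx'⟩)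
  set ψ : E n → ℝ := fun x => breg u y x - u x with hψ
  have hψaff : ∀ x, ψ x = -(u y) + fderiv ℝ u y y + (-(fderiv ℝ u y)) x := by
    intro x; simp [hψ, breg]; ring
  have hv0 : ∀ x ∈ closure Ω, 0 ≤ breg u y x := fun x hx => h.breg_nonneg hy hx
  have hmem : ∀ δ x, x ∈ tiltSec Ω u m y δ ↔
    x ∈ closure Ω ∧ breg u y x ≤ δ * (ψ x - m / 2) := fun δ x => mem_tiltSec
  have hψy : m ≤ ψ y := by simp only [hψ, breg_self]; linarith
  have hsubΩ : ∀ δ, 0 < δ → δ ≤ 1 / 2 → tiltSec Ω u m y δ ⊆ Ω := by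
    intro δ h0 h1 x hx
    by_contra hxΩ
    obtain ⟨hx1, hx2⟩ := (hmem δ x).1 hx
    have : ψ x = breg u y x := by simp only [hψ]; rw [hfr x hx1 hxΩ, sub_zero]
    rw [this] at hx2
    nlinarith [hv0 x hx1]
  have hψge : ∀ δ, 0 < δ → ∀ x ∈ tiltSec Ω u m y δ, m / 2 ≤ ψ x := by
    intro δ h0 x hx
    obtain ⟨hx1, hx2⟩ := (hmem δ x).1 hx
    by_contra! hcon
    nlinarith [hv0 x hx1]
  have hmono : ∀ δ, 0 < δ → ∀ δ', δ ≤ δ' → tiltSec Ω u m y δ ⊆ tiltSec Ω u m y δ' := by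
    intro δ h0 δ' hd x hx
    have h1 := hψge δ h0 x hx
    obtain ⟨hx1, hx2⟩ := (hmem δ x).1 hx
    exact (hmem δ' x).2 ⟨hx1, hx2.trans (mul_le_mul_of_nonneg_right hd (by linarith))⟩
  have hyt : ∀ δ, 0 < δ → y ∈ tiltSec Ω u m y δ := by
    intro δ h0
    refine (hmem δ y).2 ⟨subset_closure hy, ?_⟩
    rw [breg_self]
    have : 0 ≤ ψ y - m / 2 := by linarith
    positivity
  set δ : ℕ → ℝ := fun k => 1 / 2 / 4 ^ k with hδ
  have hδ0 : ∀ k, 0 < δ k := fun k => by positivity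
  have hδ1 : ∀ k, δ k ≤ 1 / 2 := fun k => div_le_self (by norm_num) (one_le_pow₀ (by norm_num))
  have hδs : ∀ k, δ k = 4 * δ (k + 1) := fun k => by simp only [hδ, pow_succ]; field_simp
  have hex : ∀ k, ∃ w ∈ tiltSec Ω u m y (δ k), ∀ x ∈ tiltSec Ω u m y (δ k), ψ x ≤ ψ w := by
    intro k
    obtain ⟨w, hw, hmax⟩ := (h.capSet_isCompact _ _).exists_isMaxOn ⟨y, hyt (δ k) (hδ0 k)⟩
      (f := ψ) (Continuous.continuousOn (by
        have : ψ = _ := funext hψaff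
        rw [this]; fun_prop))
    exact ⟨w, hw, fun x hx => hmax hx⟩
  choose w hw hwmax using hex
  have hN0 : ψ (w 0) ≤ CN := by
    obtain ⟨hx1, hx2⟩ := (hmem _ _).1 (hw 0)
    have h2 := hCN _ hx1
    have h3 : δ 0 = 1 / 2 := by simp [hδ]
    rw [h3] at hx2
    simp only [hψ] at hx2 ⊢
    linarith
  have hNm : ∀ k, m ≤ ψ (w k) := fun k => hψy.trans (hwmax k y (hyt _ (hδ0 k)))
  have hKpos : (0 : ℝ) < K := by
    by_contra! hcon
    have : 0 < c * m := by positivity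
    nlinarith
  obtain ⟨k, hkK, hk⟩ : ∃ k < K, ψ (w k) - ψ (w (k + 1)) ≤ CN / K := by
    by_contra! hcon
    have hind : ∀ k ≤ K, ψ (w k) + k * (CN / K) ≤ ψ (w 0) := by
      intro k
      induction k with
      | zero => intro _; simp
      | succ k ih =>
        intro hk
        have h1 := ih (by omega)
        have h2 := hcon k (by omega)
        push_cast
        linarith
    have h1 := hind K le_rfl
    have h2 : (K : ℝ) * (CN / K) = CN := by field_simp
    linarith [hNm K]
  have hη : CN / K < c * m / 4 := by
    rw [div_lt_iff₀ hKpos]; linarith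
  have hcm : c * m ≤ m / 2 := by nlinarith
  set d := δ (k + 1) with hd
  have hd0 : 0 < d := hδ0 _
  have hN4 := hNm k
  have hN1 := hNm (k + 1)
  obtain ⟨hy'1, hy'2⟩ := (hmem _ _).1 (hw (k + 1))
  have haff : ∀ x, (1 - δ k) * (u y - fderiv ℝ u y y) - δ k * (m / 2) +
      ((1 - δ k) • fderiv ℝ u y) x - u x = δ k * (ψ x - m / 2) - breg u y x := by
    intro x
    simp only [hψ, breg, map_sub, _root_.smul_apply, smul_eq_mul]; ring
  obtain ⟨t, ht0, ht1, htz⟩ : ∃ t : ℝ, 0 ≤ t ∧ t ≤ 1 ∧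
      ψ ((1 - t) • y + t • p) = 3 * m / 4 := by
    have hpψ : ψ p ≤ m / 4 := by
      simp only [hψ]; rw [hfr p hp.1 hpΩ, sub_zero]
      refine hp.2.trans ?_
      rw [pow_succ, mul_comm, ← div_div]
      exact div_le_self (by positivity) (one_le_pow₀ (by norm_num))
    have hlin : ∀ t : ℝ, ψ ((1 - t) • y + t • p) = (1 - t) * ψ y + t * ψ p := by
      intro t
      simp only [hψaff, map_add, map_smul, smul_eq_mul]; ring
    have hgap : 0 < ψ y - ψ p := by linarith
    refine ⟨(ψ y - 3 * m / 4) / (ψ y - ψ p), div_nonneg (by linarith) hgap.le,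
      (div_le_one hgap).2 (by linarith), ?_⟩
    rw [hlin]
    field_simp
    ring
  set z := (1 - t) • y + t • p with hz
  have hzt : z ∈ tiltSec Ω u m y (δ k) := by
    refine (hmem _ _).2 ⟨h.convex.1 (subset_closure hy) hp.1 (by linarith) ht0 (by ring), ?_⟩
    have h1 := (h.breg_convexOn y).2 (subset_closure hy) hp.1 (sub_nonneg.2 ht1) ht0 (by ring)
    rw [← hz, breg_self] at h1
    simp only [smul_eq_mul, mul_zero, zero_add] at h1
    have h2 := hp.2
    have h3 := hv0 p hp.1
    have h4 : m / 4 ^ (K + 1) ≤ δ k * (m / 4) := by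
      have h5 : (4 : ℝ) ^ (k + 2) ≤ 4 ^ (K + 1) := pow_le_pow_right₀ (by norm_num) (by omega)
      calc m / 4 ^ (K + 1) ≤ m / 4 ^ (k + 2) := by gcongr
        _ = δ k * (m / 4) / 2 := by
          simp only [hδ, pow_succ]; field_simp; norm_num
        _ ≤ _ := half_le_self (mul_nonneg (hδ0 k).le (by linarith))
    rw [htz]
    nlinarith
  have hstar := h.star hn (L := (1 - δ k) • fderiv ℝ u y)
    (c := (1 - δ k) * (u y - fderiv ℝ u y y) - δ k * (m / 2))
    (H := δ k * (ψ (w k) - m / 2)) (y := w (k + 1)) (z := z) (m := fderiv ℝ u y)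
    (s := ψ (w k) - (-(u y) + fderiv ℝ u y y))
    (hsubΩ _ (hδ0 k) (hδ1 k)) (mul_pos (hδ0 k) (by linarith))
    (fun x hx => by
      rw [haff]
      have h1 := hwmax k x hx
      have h2 := hv0 x hx.1
      have h3 := mul_le_mul_of_nonneg_left h1 (hδ0 k).le
      linarith)
    (hmono _ hd0 _ (by rw [hδs k]; linarith) (hw (k + 1)))
    (by
      rw [haff, hδs k, ← hd]
      nlinarith)
    (fun x hx => by
      have h1 := hwmax k x hx
      rw [hψaff x] at h1
      simp only [_root_.neg_apply] at h1
      linarith)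
    hzt
  have e : ∀ x, fderiv ℝ u y x + (ψ (w k) - (-(u y) + fderiv ℝ u y y)) = ψ (w k) - ψ x := by
    intro x; rw [hψaff x]; simp only [_root_.neg_apply]; ring
  rw [e, e, htz] at hstar
  have : c * (m / 4) ≤ c * (ψ (w k) - 3 * m / 4) := by gcongr; linarith
  linarith

end MAData

end

theorem exists_uniform_bounds {n : ℕ} (hn : 0 < n) {Ω V : Set (E n)} {lam Lam : ℝ}
    (hlam : 0 < lam) (hlL : lam ≤ Lam) (ho : IsOpen Ω) (hbd : Bornology.IsBounded Ω)
    (hV : CptIn V Ω) :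
    ∃ c₀ > 0, ∃ m > 0, ∃ M > 0, ∀ u : E n → ℝ, MAData Ω u lam Lam →
      (∀ y ∈ V, csec Ω u y c₀ ⊆ Ω ∧ u y ≤ -m) ∧ ∀ x ∈ closure Ω, -u x ≤ M := by
  obtain ⟨d, hd, hdV⟩ := hV.1.exists_thickening_subset_open ho hV.2
  obtain ⟨κ, hκ, hκl⟩ := exists_pow_two_mul_lt hn.ne' hlam
  obtain ⟨R, hR⟩ := hbd.closure.subset_closedBall 0
  set K := max 1 Lam with hK
  have hK1 : 1 ≤ K := le_max_left _ _
  have hKL : Lam < (2 * K) ^ n := by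
    calc Lam ≤ K := le_max_right _ _
      _ < 2 * K := by linarith
      _ ≤ (2 * K) ^ n := le_self_pow₀ (by linarith) hn.ne'
  have hc0 : 0 < starC n lam Lam := lt_min (by norm_num) (by
    have : 0 < Lam := hlam.trans_le hlL
    positivity)
  set m := κ * d ^ 2 with hm
  have hm0 : 0 < m := by positivity
  set M := K * R ^ 2 + 1 with hM
  have hM0 : 0 < M := by positivity
  obtain ⟨N, hN⟩ := exists_nat_gt (4 * (2 * M) / (starC n lam Lam * m))
  rw [div_lt_iff₀ (by positivity)] at hN
  refine ⟨m / 4 ^ (N + 1), by positivity, m, hm0, M, hM0, fun u h => ?_⟩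
  have hB : ∀ x ∈ closure Ω, -u x ≤ M := fun x hx => by
    have := h.paraboloid_le (by linarith) hKL hR hx
    linarith
  refine ⟨fun y hy => ?_, hB⟩
  have hyΩ : y ∈ Ω := hV.2 (subset_closure hy)
  have hym : u y ≤ -m := by
    have := h.le_paraboloid hκ hκl hd.le (y := y) (fun z hz => hdV ?_) (subset_closure hyΩ)
    · simp only [sub_self, norm_zero] at this
      linarith
    · exact Metric.mem_thickening_iff.2 ⟨y, subset_closure hy, hz⟩
  exact ⟨h.csec_subset_of_bounds hn hm0 (by linarith) (fun x hx => by linarith [hB x hx]) hyΩ hym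
    hN, hym⟩

section

variable {n : ℕ}

theorem volume_setOf_forall_abs_le {s : ℝ} :
    volume {y : E n | ∀ i, |y i| ≤ s} = ENNReal.ofReal (2 * s) ^ n := by
  have h1 := (PiLp.volume_preserving_ofLp (Fin n)).measure_preimage
    (s := Set.Icc (fun _ => -s) (fun _ => s)) measurableSet_Icc.nullMeasurableSet
  rw [Real.volume_Icc_pi] at h1
  have h2 : {y : E n | ∀ i, |y i| ≤ s} =
      (@WithLp.ofLp 2 (Fin n → ℝ)) ⁻¹' Set.Icc (fun _ => -s) (fun _ => s) := by
    ext y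
    simp only [Set.mem_ofPred_eq, Set.mem_preimage, Set.mem_Icc, Pi.le_def, abs_le]
    exact forall_and
  rw [h2, h1]
  simp only [Finset.prod_const, Finset.card_univ, Fintype.card_fin]
  congr 2
  ring

/-- The map of slopes to their pairings with a frame. -/
def framePairing (b : Module.Basis (Fin n) ℝ (E n)) : E n →ₗ[ℝ] E n where
  toFun q := WithLp.toLp 2 fun i => inner ℝ q (b i)
  map_add' q q' := by ext i; simp [inner_add_left]
  map_smul' c q := by ext i; simp [inner_smul_left]

theorem det_framePairing (b : Module.Basis (Fin n) ℝ (E n)) :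
    (frameMat b).det * LinearMap.det (framePairing b) = 1 := by
  set e := (EuclideanSpace.basisFun (Fin n) ℝ).toBasis
  rw [← LinearMap.det_toMatrix e, ← Matrix.det_transpose, ← Matrix.det_mul]
  convert Matrix.det_one (n := Fin n) (R := ℝ) using 2
  ext i j
  rw [Matrix.mul_apply]
  have h1 := congrArg (fun v : E n => v j) (b.sum_repr (EuclideanSpace.single i (1 : ℝ)))
  simp only [WithLp.ofLp_sum, Finset.sum_apply, PiLp.smul_apply, smul_eq_mul] at h1
  have h2 : ∀ k, (LinearMap.toMatrix e e (framePairing b)) k j = b k j := by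
    intro k
    rw [LinearMap.toMatrix_apply]
    simp [e, framePairing, EuclideanSpace.inner_single_left]
  simp only [h2, Matrix.transpose_apply, frameMat, Matrix.of_apply]
  rw [h1]
  simp [Matrix.one_apply, eq_comm]

theorem volume_slope_box (b : Module.Basis (Fin n) ℝ (E n)) (s : ℝ) :
    volume {q : E n | ∀ i, |inner ℝ q (b i)| ≤ s} =
      ENNReal.ofReal |(frameMat b).det| * ENNReal.ofReal (2 * s) ^ n := by
  have h1 := det_framePairing b
  have hne : LinearMap.det (framePairing b) ≠ 0 := right_ne_zero_of_mul_eq_one h1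
  have h2 := Measure.addHaar_preimage_linearMap volume hne {y : E n | ∀ i, |y i| ≤ s}
  rw [volume_setOf_forall_abs_le, ← eq_inv_of_mul_eq_one_left h1] at h2
  exact h2

variable {Ω : Set (E n)} {u : E n → ℝ} {lam Lam : ℝ}

/-- Gradient as a vector of partial derivatives. -/
def gradVec (f : E n → ℝ) (x : E n) : E n := WithLp.toLp 2 fun i => pd f x i

theorem inner_gradVec (f : E n → ℝ) (x v : E n) : inner ℝ (gradVec f x) v = fderiv ℝ f x v := by
  conv_rhs => rw [sum_single_eq v, map_sum]
  simp [gradVec, pd, PiLp.inner_apply]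

theorem hasFDerivAt_gradVec {f : E n → ℝ} {x : E n} (hf : ContDiffAt ℝ 2 f x) :
    HasFDerivAt (gradVec f) (fderiv ℝ (gradVec f) x) x ∧
      (fderiv ℝ (gradVec f) x).det = (Hess f x).det := by
  have hd : ∀ i, HasFDerivAt (fun y => pd f y i) (fderiv ℝ (fun y => pd f y i) x) x := by
    intro i
    have h1 : DifferentiableAt ℝ (fderiv ℝ f) x :=
      (hf.fderiv_right (m := 1) (by norm_num)).differentiableAt (by norm_num)
    exact (h1.clm_apply (differentiableAt_const _)).hasFDerivAt
  have hD : DifferentiableAt ℝ (gradVec f) x :=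
    (differentiableAt_euclidean).2 fun i => (hd i).differentiableAt
  refine ⟨hD.hasFDerivAt, ?_⟩
  have hc : ∀ v i, (fderiv ℝ (gradVec f) x v) i = fderiv ℝ (fun y => pd f y i) x v := by
    intro v i
    have := ((EuclideanSpace.proj (𝕜 := ℝ) i).hasFDerivAt.comp x hD.hasFDerivAt).unique (hd i)
    exact congrArg (fun L => L v) this
  rw [ContinuousLinearMap.det, ← LinearMap.det_toMatrix (EuclideanSpace.basisFun (Fin n) ℝ).toBasis,
    ← Matrix.det_transpose (Hess f x)]
  congr 1
  ext i j
  rw [LinearMap.toMatrix_apply]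
  simp [Hess, pd2, hc]
  rfl

end

section criticalDensity
variable {n : ℕ} {Ω : Set (E n)} {u : E n → ℝ} {lam Lam : ℝ}

theorem fderiv_eq_and_Hess_posSemidef_of_isLocalMin_sub {m : E n → ℝ} {x : E n} {L : E n →L[ℝ] ℝ}
    (hm : ContDiffAt ℝ 2 m x) (hmin : IsLocalMin (fun y => m y - L y) x) :
    fderiv ℝ m x = L ∧ (Hess m x).PosSemidef := by
  have hL : ContDiffAt ℝ 2 (fun y => L y) x := L.contDiff.contDiffAt
  constructor
  · have h1 := hmin.fderiv_eq_zero
    rw [fderiv_fun_sub (hm.differentiableAt (by norm_num)) L.differentiableAt, L.fderiv] at h1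
    exact sub_eq_zero.1 h1
  · have h1 := Hess_posSemidef_of_isLocalMin (hm.sub hL) hmin
    rw [Hess_sub hm hL] at h1
    have h2 : Hess (fun y => L y) x = 0 := by
      ext i j
      have : (fun y : E n => fderiv ℝ (fun y => L y) y (EuclideanSpace.single j 1)) =
          fun _ => L (EuclideanSpace.single j 1) := by
        funext y; rw [L.fderiv]
      simp only [Hess, Matrix.of_apply, pd2, this]
      simp
    rwa [h2, sub_zero] at h1

theorem pd2_const_mul {f : E n → ℝ} {x : E n} (hf : ContDiffAt ℝ 2 f x) (c : ℝ) (i j : Fin n) :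
    pd2 (fun y => c * f y) x i j = c * pd2 f x i j := by
  have hev : (fun y => fderiv ℝ (fun y => c * f y) y (EuclideanSpace.single j 1)) =ᶠ[nhds x]
      fun y => c * fderiv ℝ f y (EuclideanSpace.single j 1) := by
    filter_upwards [hf.eventually (by norm_num)] with y hy
    rw [fderiv_const_mul (hy.differentiableAt (by norm_num))]
    rfl
  unfold pd2
  rw [hev.fderiv_eq, fderiv_const_mul]
  · rfl
  · exact (((hf.fderiv_right (m := 1) (by norm_num)).differentiableAt (by norm_num)).clm_apply
      (differentiableAt_const _))

theorem trace_adjugate_mul_Hess {f : E n → ℝ} {x : E n} (hf : ContDiffAt ℝ 2 f x) :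
    ((Hess u x).adjugate * Hess f x).trace = ∑ i, ∑ j, cofU u x i j * pd2 f x i j := by
  simp only [Matrix.trace, Matrix.diag, Matrix.mul_apply, cofU]
  refine Finset.sum_congr rfl fun i _ => Finset.sum_congr rfl fun j _ => ?_
  rw [show Hess f x j i = Hess f x i j from (Hess_isSymm hf).apply i j]
  rfl

theorem det_Hess_sub_le (h : MAData Ω u lam Lam) {f : E n → ℝ} {x : E n} (hx : x ∈ Ω)
    (hf : ContDiffAt ℝ 2 f x) (hLf : ∑ i, ∑ j, cofU u x i j * pd2 f x i j = 0) {c : ℝ}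
    (hps : (Hess (fun y => u y - c * f y) x).PosSemidef) :
    |(Hess (fun y => u y - c * f y) x).det| ≤ Lam := by
  rw [abs_of_nonneg hps.det_nonneg]
  refine le_trans ?_ (h.det_le x hx)
  refine hps.det_le_det_of_trace_le (h.Hess_posDef hx) ?_
  have hcf : ContDiffAt ℝ 2 (fun y => c * f y) x := contDiffAt_const.mul hf
  rw [Hess_sub (h.smooth_two hx) hcf, Matrix.mul_sub, Matrix.trace_sub,
    trace_adjugate_mul_Hess hcf]
  simp only [pd2_const_mul hf, mul_left_comm _ c, ← Finset.mul_sum]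
  rw [hLf, Matrix.adjugate_mul]
  simp [mul_comm]

theorem slope_mem_image (h : MAData Ω u lam Lam) {z : E n} {r : ℝ}
    (hr : 0 < r) (hF : csec Ω u z r ⊆ Ω) (hz : z ∈ Ω) {f : E n → ℝ}
    (hc : ContinuousOn f (csec Ω u z r))
    (hf : ∀ x ∈ csec Ω u z r, 0 < f x →
      ContDiffAt ℝ 2 f x ∧ ∑ i, ∑ j, cofU u x i j * pd2 f x i j = 0)
    {B : ℝ} (hz0 : 0 < f z) (hB : ∀ x ∈ csec Ω u z r, f x ≤ B * f z) {q : E n}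
    (hq : ∀ x ∈ csec Ω u z r, |inner ℝ q (x - z)| ≤ r / (4 * B)) :
    ∃ x ∈ csec Ω u z r, f z / 2 ≤ f x ∧
      |(fderiv ℝ (gradVec fun y => u y - r / (2 * B * f z) * f y) x).det| ≤ Lam ∧
      DifferentiableAt ℝ (gradVec fun y => u y - r / (2 * B * f z) * f y) x ∧
      gradVec (fun y => u y - r / (2 * B * f z) * f y) x = gradVec u z + q := by
  have hzF : z ∈ csec Ω u z r := mem_csec_self hz hr.le
  have hB1 : 1 ≤ B := by
    have := hB z hzF
    by_contra! hlt
    nlinarith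
  set c : ℝ := r / (2 * B * f z) with hcdef
  have hc0 : 0 < c := by positivity
  have hcB : c * (B * f z) = r / 2 := by rw [hcdef]; field_simp
  have hcz : c * (f z / 2) = r / (4 * B) := by rw [hcdef]; field_simp; norm_num
  obtain ⟨x, hxF, hmin⟩ := (h.csec_isCompact z r).exists_isMinOn ⟨z, hzF⟩
    (f := fun y => breg u z y - inner ℝ q (y - z) - c * f y)
    (((h.breg_continuousOn z).mono (fun y hy => hy.1)).sub (by fun_prop) |>.sub
      (continuousOn_const.mul hc))
  have hxz := hmin hzF
  simp only [Set.mem_ofPred_eq, breg_self, sub_self, inner_zero_right] at hxz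
  have hqx := abs_le.1 (hq x hxF)
  have hxΩ := hF hxF
  have hb0 : 0 ≤ breg u z x := h.breg_nonneg hz (subset_closure hxΩ)
  have hfx : f z / 2 ≤ f x := by
    have : c * (f z / 2) ≤ c * f x := by linarith
    exact le_of_mul_le_mul_left this hc0
  have hlt : breg u z x < r := by
    have h1 : c * f x ≤ c * (B * f z) := mul_le_mul_of_nonneg_left (hB x hxF) hc0.le
    have : 0 < c * f z := by positivity
    nlinarith
  have hnh := h.csec_mem_nhds hxΩ hlt
  obtain ⟨hfs, hLf⟩ := hf x hxF (by linarith)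
  have hm : ContDiffAt ℝ 2 (fun y => u y - c * f y) x :=
    (h.smooth_two hxΩ).sub (contDiffAt_const.mul hfs)
  have hloc : IsLocalMin (fun y => (u y - c * f y) - (fderiv ℝ u z + innerSL ℝ q) y) x := by
    filter_upwards [hnh] with y hy
    have := hmin hy
    simp only [Set.mem_ofPred_eq, breg, inner_sub_right, map_sub] at this
    simp only [_root_.add_apply, innerSL_apply_apply]
    linarith
  obtain ⟨hd, hps⟩ := fderiv_eq_and_Hess_posSemidef_of_isLocalMin_sub hm hloc
  obtain ⟨hg1, hg2⟩ := hasFDerivAt_gradVec hm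
  refine ⟨x, hxF, hfx, ?_, hg1.differentiableAt, ?_⟩
  · rw [hg2]
    exact det_Hess_sub_le h hxΩ hfs hLf hps
  · refine ext_inner_right ℝ fun v => ?_
    rw [inner_gradVec, hd, inner_add_left, inner_gradVec]
    rfl

end criticalDensity

section criticalDensityMeasure
variable {n : ℕ} {Ω : Set (E n)} {u : E n → ℝ} {lam Lam : ℝ}

/-- The constant in the critical density estimate. -/
def cdC (n : ℕ) (lam Lam B : ℝ) : ℝ :=
  Real.sqrt (lam / (16 * n ^ 2) ^ n) * (1 / (4 * B * n)) ^ n / Lam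

theorem abs_inner_sub_le_of_frame {b : Module.Basis (Fin n) ℝ (E n)} {z₀ x z q : E n} {s : ℝ}
    (hs : ∀ i, |inner ℝ q (b i)| ≤ s) (hx : ∀ i, |b.repr (x - z₀) i| ≤ 1)
    (hz : ∀ i, |b.repr (z - z₀) i| ≤ 1) : |inner ℝ q (x - z)| ≤ 2 * n * s := by
  have h1 : ∀ w, (∀ i, |b.repr (w - z₀) i| ≤ 1) → |inner ℝ q (w - z₀)| ≤ n * s := by
    intro w hw
    conv_lhs => rw [← b.sum_repr (w - z₀), inner_sum]
    refine (Finset.abs_sum_le_sum_abs _ _).trans ?_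
    refine (Finset.sum_le_card_nsmul _ _ s fun i _ => ?_).trans (by simp)
    rw [inner_smul_right, abs_mul]
    calc _ ≤ 1 * |inner ℝ q (b i)| := by gcongr; exact hw i
      _ ≤ s := by rw [one_mul]; exact hs i
  have : x - z = (x - z₀) - (z - z₀) := by abel
  rw [this, inner_sub_right]
  have h2 := abs_sub (inner ℝ q (x - z₀)) (inner ℝ q (z - z₀))
  linarith [h1 x hx, h1 z hz]

theorem MAData.critical_density (h : MAData Ω u lam Lam) (hn : 0 < n) {z : E n} {r : ℝ}
    (hr : 0 < r) (hF : csec Ω u z r ⊆ Ω) (hz : z ∈ Ω) {f : E n → ℝ}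
    (hc : ContinuousOn f (csec Ω u z r))
    (hf : ∀ x ∈ csec Ω u z r, 0 < f x →
      ContDiffAt ℝ 2 f x ∧ ∑ i, ∑ j, cofU u x i j * pd2 f x i j = 0)
    {B : ℝ} (hz0 : 0 < f z) (hB : ∀ x ∈ csec Ω u z r, f x ≤ B * f z) :
    ENNReal.ofReal (cdC n lam Lam B * Real.sqrt r ^ n) ≤
      volume {x ∈ csec Ω u z r | f z / 2 ≤ f x} := by
  have hzF : z ∈ csec Ω u z r := mem_csec_self hz hr.le
  have hB0 : 0 < B := by
    have := hB z hzF
    by_contra! hlt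
    nlinarith
  have hn' : (0 : ℝ) < n := by exact_mod_cast hn
  have hLam : 0 < Lam := h.Lam_pos hz
  have hcpt := h.csec_isCompact z r
  have hint : (interior (csec Ω u z r)).Nonempty :=
    ⟨z, mem_interior_iff_mem_nhds.2 (h.csec_mem_nhds hz (by rwa [breg_self]))⟩
  obtain ⟨z₀, hz₀, b, hb, hbF⟩ := exists_frame hcpt hint
  have hlow : lam ≤ (16 * n ^ 2 * r) ^ n * (frameMat b).det ^ 2 := by
    have hcs := csec_eq_capSet (Ω := Ω) (u := u) z r
    rw [hcs] at hF hz₀ hb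
    refine h.frame_lower hn hF hr ?_ hz₀ hb
    intro x hx
    have := h.breg_nonneg hz (subset_closure (hF hx))
    simp only [breg, map_sub] at this
    linarith
  set s : ℝ := r / (8 * B * n) with hs
  have hs0 : 0 < s := by positivity
  set m : E n → ℝ := fun y => u y - r / (2 * B * f z) * f y with hm
  set A : Set (E n) := {x ∈ csec Ω u z r | f z / 2 ≤ f x} ∩
    ({x | |(fderiv ℝ (gradVec m) x).det| ≤ Lam} ∩ {x | DifferentiableAt ℝ (gradVec m) x}) with hA
  have hAm : MeasurableSet A := by
    refine MeasurableSet.inter ?_ (MeasurableSet.inter ?_ ?_)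
    · exact (hc.preimage_isClosed_of_isClosed hcpt.isClosed isClosed_Ici).measurableSet
    · exact measurableSet_le ((ContinuousLinearMap.continuous_det.measurable.comp (measurable_fderiv ℝ (gradVec m))).abs) measurable_const
    · exact measurableSet_of_differentiableAt ℝ _
  have hbox : (fun q => gradVec u z + q) '' {q : E n | ∀ i, |inner ℝ q (b i)| ≤ s} ⊆
      gradVec m '' A := by
    rintro _ ⟨q, hq, rfl⟩
    obtain ⟨x, h1, h2, h3, h4, h5⟩ := slope_mem_image h hr hF hz hc hf hz0 hB (q := q) (by
      intro x hx
      refine (abs_inner_sub_le_of_frame hq (hbF x hx) (hbF z hzF)).trans_eq ?_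
      rw [hs]; field_simp; norm_num)
    exact ⟨x, ⟨⟨h1, h2⟩, h3, h4⟩, h5⟩
  have hvol : ENNReal.ofReal (|(frameMat b).det| * (2 * s) ^ n) ≤
      ENNReal.ofReal Lam * volume {x ∈ csec Ω u z r | f z / 2 ≤ f x} := by
    calc _ = volume ((fun q => gradVec u z + q) '' {q : E n | ∀ i, |inner ℝ q (b i)| ≤ s}) := by
          rw [Set.image_add_left, measure_preimage_add, volume_slope_box,
            ENNReal.ofReal_mul (abs_nonneg _), ENNReal.ofReal_pow (by positivity)]
      _ ≤ volume (gradVec m '' A) := measure_mono hbox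
      _ ≤ ∫⁻ x in A, ENNReal.ofReal |(fderiv ℝ (gradVec m) x).det| :=
          addHaar_image_le_lintegral_abs_det_fderiv volume hAm
            fun x hx => hx.2.2.hasFDerivAt.hasFDerivWithinAt
      _ ≤ ∫⁻ x in A, ENNReal.ofReal Lam :=
          setLIntegral_mono measurable_const fun x hx => ENNReal.ofReal_le_ofReal hx.2.1
      _ = ENNReal.ofReal Lam * volume A := by rw [setLIntegral_const]
      _ ≤ _ := by gcongr; exact Set.inter_subset_left
  have hreal : cdC n lam Lam B * Real.sqrt r ^ n * Lam ≤ |(frameMat b).det| * (2 * s) ^ n := by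
    have h1 : Real.sqrt (lam / (16 * n ^ 2) ^ n) * Real.sqrt r ^ n ≤ |(frameMat b).det| * r ^ n := by
      refine abs_le_of_sq_le_sq' ?_ (by positivity) |>.2
      rw [mul_pow, Real.sq_sqrt (div_nonneg h.lam_pos.le (by positivity)), ← pow_mul, mul_comm n 2,
        pow_mul, Real.sq_sqrt hr.le, mul_pow |(frameMat b).det|, sq_abs, div_mul_eq_mul_div,
        div_le_iff₀ (by positivity)]
      calc lam * r ^ n ≤ ((16 * n ^ 2 * r) ^ n * (frameMat b).det ^ 2) * r ^ n := by gcongr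
        _ = _ := by rw [mul_pow]; ring
    have h2 : (2 * s) ^ n = r ^ n * (1 / (4 * B * n)) ^ n := by
      rw [← mul_pow]; congr 1; rw [hs]; field_simp; norm_num
    rw [h2, cdC]
    calc _ = (Real.sqrt (lam / (16 * n ^ 2) ^ n) * Real.sqrt r ^ n) * (1 / (4 * B * n)) ^ n := by
          field_simp
      _ ≤ (|(frameMat b).det| * r ^ n) * (1 / (4 * B * n)) ^ n := by gcongr
      _ = _ := by ring
  have h3 := (ENNReal.ofReal_le_ofReal hreal).trans hvol
  rw [mul_comm, ENNReal.ofReal_mul hLam.le] at h3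
  exact (ENNReal.mul_le_mul_iff_right (by simpa using hLam) ENNReal.ofReal_ne_top).1 h3

end criticalDensityMeasure

section localMaximum
variable {n : ℕ}

theorem sqrt_div_two_pow_ge {ρ : ℝ} (j : ℕ) : Real.sqrt ρ / 2 ^ j ≤ Real.sqrt (ρ / 2 ^ j) := by
  rw [Real.sqrt_div' _ (by positivity)]
  have h1 : (1 : ℝ) ≤ 2 ^ j := one_le_pow₀ (by norm_num)
  have h2 : Real.sqrt (2 ^ j) ≤ 2 ^ j := Real.sqrt_le_self_iff.2 (Or.inr h1)
  have : 0 < Real.sqrt (2 ^ j) := by positivity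
  gcongr

/-- `LocalMax` records the local maximum principle for solutions on sections centred in `V`. -/
def LocalMax (n : ℕ) (Ω V : Set (E n)) (u : E n → ℝ) (lam Lam c₀ K : ℝ) : Prop :=
  ∀ x ∈ V, ∀ ρ > 0, 2 * engC n lam Lam * ρ ≤ c₀ → ∀ f : E n → ℝ,
    ContinuousOn f (csec Ω u x ρ) →
    (∀ y ∈ csec Ω u x ρ, 0 < f y →
      y ∈ V ∧ ContDiffAt ℝ 2 f y ∧ ∑ i, ∑ j, cofU u y i j * pd2 f y i j = 0) →
    ∀ I : ℝ, 0 ≤ I →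
    (∀ a > 0, ENNReal.ofReal a * volume {y ∈ csec Ω u x ρ | a ≤ f y} ≤ ENNReal.ofReal I) →
    f x * Real.sqrt ρ ^ n ≤ K * I

theorem exists_local_maximum_const (hn : 0 < n) {lam Lam : ℝ} (hlam : 0 < lam) (hlL : lam ≤ Lam) :
    ∃ K > 0, ∀ (Ω V : Set (E n)) (u : E n → ℝ), MAData Ω u lam Lam → V ⊆ Ω →
      ∀ c₀ : ℝ, (∀ y ∈ V, csec Ω u y c₀ ⊆ Ω) →
      LocalMax n Ω V u lam Lam c₀ K := by
  have hs := starC_pos_of_le hn hlam hlL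
  set τ : ℝ := (1 + starC n lam Lam)⁻¹ with hτ
  have hτ0 : 0 < τ := by positivity
  have hτ1 : τ < 1 := inv_lt_one_of_one_lt₀ (by linarith)
  have hC0 : 0 < engC n lam Lam := by unfold engC; positivity
  obtain ⟨j₀, hj₀⟩ := exists_pow_lt_of_lt_one
    (show 0 < (1 - τ) / (4 * engC n lam Lam ^ 2) from div_pos (by linarith) (by positivity)) hτ1
  have hLam : 0 < Lam := hlam.trans_le hlL
  have hn' : (0 : ℝ) < n := by exact_mod_cast hn
  have hcd : 0 < cdC n lam Lam (2 ^ n) := by unfold cdC; positivity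
  refine ⟨2 * (2 ^ j₀) ^ n / cdC n lam Lam (2 ^ n), by positivity, ?_⟩
  intro Ω V u h hVΩ c₀ hc₀ x hx ρ hρ hρc f hfc hf I hI hvol
  by_contra! hcon
  rw [div_mul_eq_mul_div, div_lt_iff₀ hcd] at hcon
  have hρ' : 0 < Real.sqrt ρ ^ n := by positivity
  have hfx : 0 < f x := by
    by_contra! hle
    have : f x * Real.sqrt ρ ^ n * cdC n lam Lam (2 ^ n) ≤ 0 :=
      mul_nonpos_of_nonpos_of_nonneg (mul_nonpos_of_nonpos_of_nonneg hle hρ'.le) hcd.le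
    have : 0 ≤ 2 * (2 ^ j₀ : ℝ) ^ n * I := by positivity
    linarith
  have hC3 : 1 ≤ engC n lam Lam := by linarith [h.three_le_engC hn (hVΩ hx)]
  have hsub : ∀ y ∈ V, ∀ s ≤ c₀, csec Ω u y s ⊆ Ω := fun y hy s hs =>
    (csec_mono y hs).trans (hc₀ y hy)
  have hρ1 : ρ ≤ c₀ := by nlinarith
  set D : ℝ := 2 * engC n lam Lam ^ 2 * ρ with hD
  have hD0 : 0 < D := by positivity
  have hDj : D * τ ^ j₀ / (1 - τ) ≤ ρ / 2 := by
    rw [div_le_iff₀ (by linarith)]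
    rw [lt_div_iff₀ (by positivity)] at hj₀
    rw [hD]
    nlinarith
  have hstep : ∀ k : ℕ, ∃ y ∈ V, breg u x y ≤ D * τ ^ j₀ / (1 - τ) * (1 - τ ^ k) ∧
      (2 ^ n) ^ k * f x ≤ f y := by
    intro k
    induction k with
    | zero => exact ⟨x, hx, by simp [breg_self], by simp⟩
    | succ k ih =>
      obtain ⟨y, hyV, hby, hfy⟩ := ih
      have hτk : 0 < τ ^ k := by positivity
      have hτk1 : τ ^ k ≤ 1 := pow_le_one₀ hτ0.le hτ1.le
      have hfy0 : 0 < f y := lt_of_lt_of_le (by positivity) hfy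
      have hyhalf : y ∈ csec Ω u x (ρ / 2) := by
        refine ⟨subset_closure (hVΩ hyV), hby.trans ?_⟩
        have : D * τ ^ j₀ / (1 - τ) * (1 - τ ^ k) ≤ ρ / 2 * 1 :=
          mul_le_mul hDj (by linarith) (by linarith) (by positivity)
        linarith
      have hnext : ∀ z ∈ csec Ω u y (ρ / 2 ^ (j₀ + k)),
          breg u x z ≤ D * τ ^ j₀ / (1 - τ) * (1 - τ ^ (k + 1)) := by
        intro z hz
        have := h.breg_chain hn (hVΩ hx) hρ (hsub x hx ρ hρ1) hyhalf
          (hsub y hyV _ hρc) (j := j₀ + k) hz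
        have h2 : D * τ ^ j₀ / (1 - τ) * (1 - τ ^ (k + 1)) =
            D * τ ^ j₀ / (1 - τ) * (1 - τ ^ k) + D * τ ^ (j₀ + k) := by
          have : 1 - τ ≠ 0 := by linarith
          field_simp
          ring
        rw [h2]
        linarith
      have hinc : csec Ω u y (ρ / 2 ^ (j₀ + k)) ⊆ csec Ω u x ρ := by
        intro z hz
        refine ⟨hz.1, (hnext z hz).trans ?_⟩
        have hτk : 0 < τ ^ (k + 1) := by positivity
        have hτk1 : τ ^ (k + 1) ≤ 1 := pow_le_one₀ hτ0.le hτ1.le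
        have : D * τ ^ j₀ / (1 - τ) * (1 - τ ^ (k + 1)) ≤ ρ / 2 * 1 :=
          mul_le_mul hDj (by linarith) (by linarith) (by positivity)
        linarith
      by_cases hB : ∀ z ∈ csec Ω u y (ρ / 2 ^ (j₀ + k)), f z ≤ 2 ^ n * f y
      · exfalso
        have hcrit := h.critical_density hn (r := ρ / 2 ^ (j₀ + k)) (by positivity)
          (hinc.trans (hsub x hx ρ hρ1)) (hVΩ hyV) (hfc.mono hinc)
          (fun z hz hz0 => (hf z (hinc hz) hz0).2) hfy0 hB
        have h1 := hvol (f y / 2) (by positivity)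
        have h2 : ENNReal.ofReal (f y / 2) * ENNReal.ofReal
            (cdC n lam Lam (2 ^ n) * Real.sqrt (ρ / 2 ^ (j₀ + k)) ^ n) ≤ ENNReal.ofReal I := by
          refine le_trans ?_ h1
          gcongr
          refine hcrit.trans (measure_mono ?_)
          exact fun z hz => ⟨hinc hz.1, hz.2⟩
        rw [← ENNReal.ofReal_mul (by positivity), ENNReal.ofReal_le_ofReal_iff hI] at h2
        have h3 := pow_le_pow_left₀ (by positivity) (sqrt_div_two_pow_ge (ρ := ρ) (j₀ + k)) n
        have h4 : f x * Real.sqrt ρ ^ n * cdC n lam Lam (2 ^ n) ≤ 2 * (2 ^ j₀) ^ n * I := by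
          calc f x * Real.sqrt ρ ^ n * cdC n lam Lam (2 ^ n)
              = 2 * (2 ^ j₀) ^ n * (((2 ^ n) ^ k * f x) / 2 * (cdC n lam Lam (2 ^ n) *
                  (Real.sqrt ρ / 2 ^ (j₀ + k)) ^ n)) := by
                rw [div_pow, pow_add, mul_pow, ← pow_mul 2 k n, ← pow_mul 2 n k, mul_comm n k]
                field_simp
            _ ≤ 2 * (2 ^ j₀) ^ n * (f y / 2 * (cdC n lam Lam (2 ^ n) *
                  Real.sqrt (ρ / 2 ^ (j₀ + k)) ^ n)) := by gcongr
            _ ≤ _ := by gcongr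
        linarith
      · push Not at hB
        obtain ⟨z, hz, hfz⟩ := hB
        have hfz0 : 0 < f z := lt_trans (by positivity) hfz
        refine ⟨z, (hf z (hinc hz) hfz0).1, hnext z hz, ?_⟩
        calc (2 ^ n) ^ (k + 1) * f x = 2 ^ n * ((2 ^ n) ^ k * f x) := by ring
          _ ≤ 2 ^ n * f y := by gcongr
          _ ≤ f z := hfz.le
  obtain ⟨M, hM⟩ := (h.csec_isCompact x ρ).bddAbove_image hfc
  have h2n : (1 : ℝ) < 2 ^ n := one_lt_pow₀ (by norm_num) hn.ne'
  obtain ⟨k, hk⟩ := pow_unbounded_of_one_lt (M / f x) h2n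
  obtain ⟨y, hyV, hby, hfy⟩ := hstep k
  have hyF : y ∈ csec Ω u x ρ := by
    refine ⟨subset_closure (hVΩ hyV), hby.trans ?_⟩
    have hτk : 0 < τ ^ k := by positivity
    have hτk1 : τ ^ k ≤ 1 := pow_le_one₀ hτ0.le hτ1.le
    have : D * τ ^ j₀ / (1 - τ) * (1 - τ ^ k) ≤ ρ / 2 * 1 :=
      mul_le_mul hDj (by linarith) (by linarith) (by positivity)
    linarith
  have := hM (Set.mem_image_of_mem f hyF)
  rw [div_lt_iff₀ hfx] at hk
  linarith

end localMaximum

section piola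
variable {n : ℕ}

theorem hasFDerivAt_det {F : E n → Matrix (Fin n) (Fin n) ℝ} {F' : Fin n → Fin n → E n →L[ℝ] ℝ}
    {x : E n} (hF : ∀ i j, HasFDerivAt (fun y => F y i j) (F' i j) x) :
    HasFDerivAt (fun y => (F y).det) (∑ i, ∑ j, (F x).adjugate j i • F' i j) x := by
  let f : ContinuousMultilinearMap ℝ (fun _ : Fin n => Fin n → ℝ) ℝ :=
    { Matrix.detRowAlternating.toMultilinearMap with
      cont := by
        change Continuous fun M : Matrix (Fin n) (Fin n) ℝ => M.det
        exact continuous_id.matrix_det }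
  have h1 : HasFDerivAt (fun y => (fun i j => F y i j : Fin n → Fin n → ℝ))
      (ContinuousLinearMap.pi fun i => ContinuousLinearMap.pi fun j => F' i j) x :=
    hasFDerivAt_pi.2 fun i => hasFDerivAt_pi.2 fun j => hF i j
  refine ((f.hasFDerivAt (fun i j => F x i j)).comp x h1).congr_fderiv ?_
  ext v
  simp only [ContinuousLinearMap.comp_apply, ContinuousMultilinearMap.linearDeriv_apply,
    _root_.sum_apply, _root_.smul_apply, smul_eq_mul]
  refine Finset.sum_congr rfl fun i _ => ?_
  change ((F x).updateRow i fun j => F' i j v).det = _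
  rw [← Matrix.cramer_transpose_apply, Matrix.cramer_eq_adjugate_mulVec, ← Matrix.adjugate_transpose]
  simp [Matrix.mulVec, dotProduct]

theorem three_le_smooth : (1 + 1 + 1 : WithTop ℕ∞) ≤ ((⊤ : ℕ∞) : WithTop ℕ∞) := by
  norm_num
  exact WithTop.coe_le_coe.2 (le_top : (3 : ℕ∞) ≤ ⊤)

theorem ContDiffAt.pd {f : E n → ℝ} {x : E n} {m k : WithTop ℕ∞} (hf : ContDiffAt ℝ m f x)
    (hk : k + 1 ≤ m) (i : Fin n) : ContDiffAt ℝ k (fun y => pd f y i) x :=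
  (hf.fderiv_right hk).clm_apply contDiffAt_const

theorem ContDiffAt.pd2 {f : E n → ℝ} {x : E n} {m k : WithTop ℕ∞} (hf : ContDiffAt ℝ m f x)
    (hk : k + 1 + 1 ≤ m) (i j : Fin n) : ContDiffAt ℝ k (fun y => pd2 f y i j) x :=
  (hf.pd hk j).pd le_rfl i

theorem contDiffAt_cofU {u : E n → ℝ} {x : E n} (hu : ContDiffAt ℝ (⊤ : ℕ∞) u x) (i j : Fin n) :
    ContDiffAt ℝ (⊤ : ℕ∞) (fun y => cofU u y i j) x := by
  simp only [cofU, Matrix.adjugate_apply, Matrix.det_apply']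
  refine ContDiffAt.sum fun σ _ => contDiffAt_const.mul (contDiffAt_prod fun k _ => ?_)
  by_cases hk : σ k = j
  · simp only [Matrix.updateRow_apply, hk, if_true]
    exact contDiffAt_const
  · simp only [Matrix.updateRow_apply, hk, if_false]
    exact hu.pd2 (by simp) _ _

theorem cofU_symm {u : E n → ℝ} {x : E n} (hu : ContDiffAt ℝ 2 u x) (i j : Fin n) :
    cofU u x i j = cofU u x j i := by
  have : (Hess u x).adjugate.transpose = (Hess u x).adjugate := by
    rw [Matrix.adjugate_transpose, Hess_isSymm hu]
  exact congrFun (congrFun this j) i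

/-- The cofactor matrix of a Hessian is divergence free. -/
theorem sum_pd_cofU_eq_zero {u : E n → ℝ} {x : E n} (hu : ContDiffAt ℝ (⊤ : ℕ∞) u x)
    (hdet : (Hess u x).det ≠ 0) (l : Fin n) : ∑ i, pd (fun y => cofU u y i l) x i = 0 := by
  have hF : ∀ i j, HasFDerivAt (fun y => Hess u y i j) (fderiv ℝ (fun y => pd2 u y i j) x) x :=
    fun i j => ((hu.pd2 (k := 1) three_le_smooth i j).differentiableAt
      (by norm_num)).hasFDerivAt
  have hA : ∀ i j, HasFDerivAt (fun y => cofU u y i j) (fderiv ℝ (fun y => cofU u y i j) x) x :=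
    fun i j => ((contDiffAt_cofU hu i j).differentiableAt (by simp)).hasFDerivAt
  have hu2 : ContDiffAt ℝ 2 u x := hu.of_le two_le_smooth
  have hsymm : ∀ i j k, pd (fun y => pd2 u y j k) x i = pd (fun y => pd2 u y i k) x j := by
    intro i j k
    have h1 : ContDiffAt ℝ 2 (fun y => pd u y k) x := hu.pd (by norm_num; exact WithTop.coe_le_coe.2 (le_top : (3 : ℕ∞) ≤ ⊤)) k
    exact (Hess_isSymm h1).apply j i
  have hdd := hasFDerivAt_det hF
  have hkey : ∀ k, ∑ j, Hess u x k j * (∑ i, pd (fun y => cofU u y j i) x i) = 0 := by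
    intro k
    have h1 : ∀ i, ∑ j, (Hess u x k j * pd (fun y => cofU u y j i) x i +
        cofU u x j i * pd (fun y => pd2 u y k j) x i) =
        if k = i then ∑ a, ∑ b, cofU u x b a * pd (fun y => pd2 u y a b) x i else 0 := by
      intro i
      have h2 : HasFDerivAt (fun y => ∑ j, Hess u y k j * cofU u y j i)
          (∑ j, (Hess u x k j • fderiv ℝ (fun y => cofU u y j i) x +
            cofU u x j i • fderiv ℝ (fun y => pd2 u y k j) x)) x :=
        HasFDerivAt.fun_sum fun j _ => (hF k j).mul (hA j i)
      have h3 : (fun y => ∑ j, Hess u y k j * cofU u y j i) =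
          fun y => (Hess u y).det * (if k = i then 1 else 0) := by
        funext y
        have := congrFun (congrFun (Matrix.mul_adjugate (Hess u y)) k) i
        rw [Matrix.mul_apply] at this
        simpa [cofU, Matrix.one_apply] using this
      rw [h3] at h2
      have h4 := h2.unique (hdd.mul_const _)
      have h5 := congrArg (fun L => L (EuclideanSpace.single i 1)) h4
      simp only [_root_.sum_apply, _root_.add_apply, _root_.smul_apply, smul_eq_mul] at h5
      refine Eq.trans h5 ?_
      split_ifs <;> simp [cofU, pd]
    have h6 := Finset.sum_congr rfl fun i (_ : i ∈ Finset.univ) => h1 i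
    simp only [Finset.sum_add_distrib, Finset.sum_ite_eq, Finset.mem_univ, if_true] at h6
    rw [Finset.sum_comm] at h6
    simp only [← Finset.mul_sum] at h6
    have h7 : ∑ i, ∑ j, cofU u x j i * pd (fun y => pd2 u y k j) x i =
        ∑ a, ∑ b, cofU u x b a * pd (fun y => pd2 u y a b) x k :=
      Finset.sum_congr rfl fun i _ => Finset.sum_congr rfl fun j _ => by rw [hsymm]
    linarith
  have hz : (Hess u x).mulVec (fun j => ∑ i, pd (fun y => cofU u y j i) x i) = 0 := by
    funext k
    exact hkey k
  have hz' := congrFun (Matrix.eq_zero_of_mulVec_eq_zero hdet hz) l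
  refine Eq.trans (Finset.sum_congr rfl fun i _ => ?_) hz'
  have hev : (fun y => cofU u y i l) =ᶠ[nhds x] fun y => cofU u y l i := by
    filter_upwards [hu2.eventually (by norm_num)] with y hy
    exact cofU_symm hy i l
  simp only [pd, hev.fderiv_eq]

end piola

section ibp
variable {n : ℕ} {Ω : Set (E n)} {u : E n → ℝ} {lam Lam : ℝ}

theorem contDiff_of_eq_zero_off {F : E n → ℝ} {K : Set (E n)} {m : WithTop ℕ∞} (hK : IsCompact K)
    (hF : ∀ x ∈ K, ContDiffAt ℝ m F x) (h0 : ∀ x ∉ K, F x = 0) : ContDiff ℝ m F := by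
  refine contDiff_iff_contDiffAt.2 fun x => ?_
  by_cases hx : x ∈ K
  · exact hF x hx
  · have hev : F =ᶠ[nhds x] fun _ => 0 := by
      filter_upwards [hK.isClosed.isOpen_compl.mem_nhds hx] with y hy using h0 y hy
    exact contDiffAt_const.congr_of_eventuallyEq hev

theorem continuous_of_eq_zero_off {F : E n → ℝ} {K : Set (E n)} (hK : IsCompact K)
    (hF : ∀ x ∈ K, ContinuousAt F x) (h0 : ∀ x ∉ K, F x = 0) : Continuous F :=
  continuous_iff_continuousAt.2 fun x => by
    by_cases hx : x ∈ K
    · exact hF x hx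
    · have hev : F =ᶠ[nhds x] fun _ => 0 := by
        filter_upwards [hK.isClosed.isOpen_compl.mem_nhds hx] with y hy using h0 y hy
      exact continuousAt_const.congr hev.symm

theorem integrable_of_eq_zero_off {F : E n → ℝ} {K : Set (E n)} (hK : IsCompact K)
    (hF : ∀ x ∈ K, ContinuousAt F x) (h0 : ∀ x ∉ K, F x = 0) : Integrable F :=
  (continuous_of_eq_zero_off hK hF h0).integrable_of_hasCompactSupport
    (HasCompactSupport.intro hK h0)

theorem integral_fderiv_apply_eq_zero {F : E n → ℝ} (hF : ContDiff ℝ 1 F)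
    (hc : HasCompactSupport F) (v : E n) : ∫ x, fderiv ℝ F x v = 0 := by
  have h1 : Integrable (fun x => fderiv ℝ F x v) :=
    ((hF.continuous_fderiv (by norm_num)).clm_apply continuous_const).integrable_of_hasCompactSupport
      (hc.fderiv_apply ℝ v)
  have := integral_mul_fderiv_eq_neg_fderiv_mul_of_integrable (μ := (volume : Measure (E n)))
    (f := fun _ => (1 : ℝ)) (g := F) (v := v) (by simp) (by simpa using h1)
    (by simpa using hF.continuous.integrable_of_hasCompactSupport hc) (by simp)
    (fun x _ => hF.differentiable (by norm_num) x)
  simpa using this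

/-- The linearized operator. -/
def linMA (u f : E n → ℝ) (x : E n) : ℝ := ∑ i, ∑ j, cofU u x i j * pd2 f x i j

theorem contDiffAt_linMA {f : E n → ℝ} {x : E n} {m : WithTop ℕ∞} (hu : ContDiffAt ℝ (⊤ : ℕ∞) u x)
    (hf : ContDiffAt ℝ (m + 1 + 1) f x) (hm : m ≤ (⊤ : ℕ∞)) : ContDiffAt ℝ m (linMA u f) x :=
  ContDiffAt.sum fun i _ => ContDiffAt.sum fun j _ =>
    ((contDiffAt_cofU hu i j).of_le hm).mul (hf.pd2 le_rfl i j)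

theorem continuousAt_linMA {f : E n → ℝ} {x : E n} (hu : ContDiffAt ℝ (⊤ : ℕ∞) u x)
    (hf : ContDiffAt ℝ 2 f x) : ContinuousAt (linMA u f) x :=
  (contDiffAt_linMA (m := 0) hu (by norm_num; exact hf) zero_le).continuousAt

theorem pd_eq_zero_of_notMem_tsupport {f : E n → ℝ} {x : E n} (hx : x ∉ tsupport f) (i : Fin n) :
    pd f x i = 0 := by
  have : f =ᶠ[nhds x] fun _ => 0 := notMem_tsupport_iff_eventuallyEq.1 hx
  simp [pd, this.fderiv_eq]

theorem pd2_eq_zero_of_notMem_tsupport {f : E n → ℝ} {x : E n} (hx : x ∉ tsupport f)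
    (i j : Fin n) : pd2 f x i j = 0 := by
  have : f =ᶠ[nhds x] fun _ => 0 := notMem_tsupport_iff_eventuallyEq.1 hx
  rw [pd2_congr this]
  simp [pd2]

theorem linMA_eq_zero_of_notMem_tsupport {f : E n → ℝ} {x : E n} (hx : x ∉ tsupport f) :
    linMA u f x = 0 := by
  simp [linMA, pd2_eq_zero_of_notMem_tsupport hx]

/-- The flux whose divergence is `a L b - b L a`. -/
def greenFlux (u a b : E n → ℝ) (i : Fin n) (x : E n) : ℝ :=
  ∑ j, cofU u x i j * (a x * pd b x j - pd a x j * b x)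

theorem sum_pd_greenFlux {a b : E n → ℝ} {x : E n} (hu : ContDiffAt ℝ (⊤ : ℕ∞) u x)
    (hdet : (Hess u x).det ≠ 0) (ha : ContDiffAt ℝ 2 a x) (hb : ContDiffAt ℝ 2 b x) :
    ∑ i, pd (greenFlux u a b i) x i = a x * linMA u b x - b x * linMA u a x := by
  have hA : ∀ i j, HasFDerivAt (fun y => cofU u y i j) (fderiv ℝ (fun y => cofU u y i j) x) x :=
    fun i j => ((contDiffAt_cofU hu i j).differentiableAt (by simp)).hasFDerivAt
  have hd : ∀ {f : E n → ℝ}, ContDiffAt ℝ 2 f x → HasFDerivAt f (fderiv ℝ f x) x :=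
    fun hf => (hf.differentiableAt (by norm_num)).hasFDerivAt
  have hdp : ∀ {f : E n → ℝ}, ContDiffAt ℝ 2 f x → ∀ j,
      HasFDerivAt (fun y => pd f y j) (fderiv ℝ (fun y => pd f y j) x) x :=
    fun hf j => ((hf.pd (k := 1) (by norm_num) j).differentiableAt (by norm_num)).hasFDerivAt
  have h1 : ∀ i, pd (greenFlux u a b i) x i =
      ∑ j, (cofU u x i j * (a x * pd2 b x i j + pd a x i * pd b x j -
        (pd a x j * pd b x i + pd2 a x i j * b x)) +
        pd (fun y => cofU u y i j) x i * (a x * pd b x j - pd a x j * b x)) := by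
    intro i
    have h2 : HasFDerivAt (greenFlux u a b i) _ x := HasFDerivAt.fun_sum fun j _ =>
      (hA i j).mul (((hd ha).mul (hdp hb j)).sub ((hdp ha j).mul (hd hb)))
    rw [pd, h2.fderiv]
    simp only [_root_.sum_apply, _root_.add_apply, _root_.smul_apply, _root_.sub_apply, smul_eq_mul]
    refine Finset.sum_congr rfl fun j _ => ?_
    simp only [pd, pd2]
    ring
  simp only [h1, Finset.sum_add_distrib]
  have h3 : ∑ i, ∑ j, pd (fun y => cofU u y i j) x i * (a x * pd b x j - pd a x j * b x) = 0 := by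
    rw [Finset.sum_comm]
    simp only [← Finset.sum_mul, sum_pd_cofU_eq_zero hu hdet, zero_mul, Finset.sum_const_zero]
  have h4 : ∑ i, ∑ j, cofU u x i j * (pd a x i * pd b x j) =
      ∑ i, ∑ j, cofU u x i j * (pd a x j * pd b x i) := by
    rw [Finset.sum_comm]
    refine Finset.sum_congr rfl fun i _ => Finset.sum_congr rfl fun j _ => ?_
    rw [cofU_symm (hu.of_le two_le_smooth)]
  rw [h3, add_zero]
  simp only [linMA, Finset.mul_sum, ← Finset.sum_sub_distrib]
  have h5 := sub_eq_zero.2 h4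
  simp only [← Finset.sum_sub_distrib] at h5
  rw [← sub_eq_zero, ← h5]
  simp only [← Finset.sum_sub_distrib]
  refine Finset.sum_congr rfl fun i _ => Finset.sum_congr rfl fun j _ => ?_
  ring

theorem MAData.det_ne_zero (h : MAData Ω u lam Lam) {x : E n} (hx : x ∈ Ω) :
    (Hess u x).det ≠ 0 := (h.lam_pos.trans_le (h.le_det x hx)).ne'

/-- Symmetry of the linearized operator. -/
theorem MAData.integral_mul_linMA (h : MAData Ω u lam Lam) {a b : E n → ℝ}
    (ha : ∀ x ∈ Ω, ContDiffAt ℝ 2 a x) (hb : ContDiff ℝ 2 b) (hbc : HasCompactSupport b)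
    (hbΩ : tsupport b ⊆ Ω) :
    Integrable (fun x => b x * linMA u a x) ∧ Integrable (fun x => a x * linMA u b x) ∧
      ∫ x, b x * linMA u a x = ∫ x, a x * linMA u b x := by
  have hi1 : Integrable (fun x => b x * linMA u a x) :=
    integrable_of_eq_zero_off (K := tsupport b) hbc
      (fun x hx => hb.continuous.continuousAt.mul
        (continuousAt_linMA (h.smooth x (hbΩ hx)) (ha x (hbΩ hx))))
      (fun x hx => by rw [image_eq_zero_of_notMem_tsupport hx, zero_mul])
  have hi2 : Integrable (fun x => a x * linMA u b x) :=
    integrable_of_eq_zero_off (K := tsupport b) hbc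
      (fun x hx => (ha x (hbΩ hx)).continuousAt.mul
        (continuousAt_linMA (h.smooth x (hbΩ hx)) hb.contDiffAt))
      (fun x hx => by rw [linMA_eq_zero_of_notMem_tsupport hx, mul_zero])
  refine ⟨hi1, hi2, ?_⟩
  have hX0 : ∀ i, ∀ x ∉ tsupport b, greenFlux u a b i x = 0 := by
    intro i x hx
    simp [greenFlux, pd_eq_zero_of_notMem_tsupport hx, image_eq_zero_of_notMem_tsupport hx]
  have hX : ∀ i, ContDiff ℝ 1 (greenFlux u a b i) := fun i =>
    contDiff_of_eq_zero_off (K := tsupport b) hbc (fun x hx => by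
      refine ContDiffAt.sum fun j _ => ContDiffAt.mul
        ((contDiffAt_cofU (h.smooth x (hbΩ hx)) i j).of_le ?_)
        (((ha x (hbΩ hx)).of_le (by norm_num)).mul (hb.contDiffAt.pd (by norm_num) j) |>.sub
          (((ha x (hbΩ hx)).pd (by norm_num) j).mul (hb.contDiffAt.of_le (by norm_num))))
      exact WithTop.coe_le_coe.2 (le_top : (1 : ℕ∞) ≤ ⊤)) (hX0 i)
  have hXc : ∀ i, HasCompactSupport (greenFlux u a b i) := fun i =>
    HasCompactSupport.intro (K := tsupport b) hbc (hX0 i)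
  have h0 : ∫ x, ∑ i, pd (greenFlux u a b i) x i = 0 := by
    rw [integral_finsetSum]
    · exact Finset.sum_eq_zero fun i _ => integral_fderiv_apply_eq_zero (hX i) (hXc i) _
    · exact fun i _ => (((hX i).continuous_fderiv (by norm_num)).clm_apply
        continuous_const).integrable_of_hasCompactSupport ((hXc i).fderiv_apply ℝ _)
  have h1 : ∀ x, ∑ i, pd (greenFlux u a b i) x i = a x * linMA u b x - b x * linMA u a x := by
    intro x
    by_cases hx : x ∈ tsupport b
    · exact sum_pd_greenFlux (h.smooth x (hbΩ hx)) (h.det_ne_zero (hbΩ hx)) (ha x (hbΩ hx))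
        hb.contDiffAt
    · have h2 : ∀ i, greenFlux u a b i =ᶠ[nhds x] fun _ => 0 := by
        intro i
        filter_upwards [(isClosed_tsupport b).isOpen_compl.mem_nhds hx] with y hy using hX0 i y hy
      rw [linMA_eq_zero_of_notMem_tsupport hx, image_eq_zero_of_notMem_tsupport hx]
      simp [pd, (h2 _).fderiv_eq]
  simp only [h1] at h0
  rw [integral_sub hi2 hi1] at h0
  linarith

end ibp

/-- A smooth convex nondecreasing function, zero on the negatives, close to the positive part. -/
def softPos (s : ℝ) : ℝ := ∫ t in (0 : ℝ)..s, Real.smoothTransition t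

theorem hasDerivAt_softPos (s : ℝ) : HasDerivAt softPos (Real.smoothTransition s) s :=
  intervalIntegral.integral_hasDerivAt_right
    (Real.smoothTransition.continuous.intervalIntegrable _ _)
    (Real.smoothTransition.continuous.stronglyMeasurableAtFilter _ _)
    Real.smoothTransition.continuous.continuousAt

theorem deriv_softPos : deriv softPos = Real.smoothTransition :=
  funext fun s => (hasDerivAt_softPos s).deriv

theorem contDiff_softPos : ContDiff ℝ (⊤ : ℕ∞) softPos :=
  contDiff_infty_iff_deriv.2 ⟨fun s => (hasDerivAt_softPos s).differentiableAt, by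
    rw [deriv_softPos]; exact Real.smoothTransition.contDiff⟩

theorem softPos_of_nonpos {s : ℝ} (hs : s ≤ 0) : softPos s = 0 := by
  unfold softPos
  rw [intervalIntegral.integral_symm, intervalIntegral.integral_congr (g := fun _ => (0 : ℝ))]
  · simp
  · intro t ht
    rw [Set.uIcc_of_le hs] at ht
    exact Real.smoothTransition.zero_of_nonpos ht.2

theorem monotone_softPos : Monotone softPos :=
  monotone_of_deriv_nonneg (fun s => (hasDerivAt_softPos s).differentiableAt) fun s => by
    rw [deriv_softPos]; exact Real.smoothTransition.nonneg s

theorem softPos_nonneg (s : ℝ) : 0 ≤ softPos s := by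
  rcases le_total s 0 with hs | hs
  · rw [softPos_of_nonpos hs]
  · have := monotone_softPos hs
    rwa [softPos_of_nonpos le_rfl] at this

theorem monotone_sub_softPos : Monotone fun s => s - softPos s := by
  have h1 : ∀ s, HasDerivAt (fun s => s - softPos s) (1 - Real.smoothTransition s) s :=
    fun s => (hasDerivAt_id s).sub (hasDerivAt_softPos s)
  refine monotone_of_deriv_nonneg (fun s => (h1 s).differentiableAt) fun s => ?_
  rw [(h1 s).deriv]
  linarith [Real.smoothTransition.le_one s]

theorem softPos_le {s : ℝ} (hs : 0 ≤ s) : softPos s ≤ s := by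
  have := monotone_sub_softPos hs
  simp only [softPos_of_nonpos le_rfl] at this
  linarith

theorem sub_one_le_softPos (s : ℝ) : s - 1 ≤ softPos s := by
  rcases le_total s 1 with hs | hs
  · linarith [softPos_nonneg s]
  · have h1 : ∀ t, HasDerivAt (fun t => softPos t - t) (Real.smoothTransition t - 1) t :=
      fun t => (hasDerivAt_softPos t).sub (hasDerivAt_id t)
    have hm : MonotoneOn (fun t => softPos t - t) (Set.Ici 1) := by
      refine monotoneOn_of_deriv_nonneg (convex_Ici 1)
        (fun t _ => (h1 t).continuousAt.continuousWithinAt)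
        (fun t _ => (h1 t).differentiableAt.differentiableWithinAt) fun t ht => ?_
      rw [interior_Ici] at ht
      rw [(h1 t).deriv, Real.smoothTransition.one_of_one_le (le_of_lt ht), sub_self]
    have h2 := hm Set.self_mem_Ici hs hs
    simp only at h2
    linarith [softPos_nonneg 1]

/-- A smooth convex truncation of `s ↦ max (s - k) 0` at scale `ε`. -/
def softTrunc (k ε s : ℝ) : ℝ := ε * softPos ((s - k) / ε)

section softTrunc
variable {k ε : ℝ}

theorem hasDerivAt_softTrunc (hε : 0 < ε) (s : ℝ) :
    HasDerivAt (softTrunc k ε) (Real.smoothTransition ((s - k) / ε)) s := by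
  have h1 : HasDerivAt (fun s => (s - k) / ε) (1 / ε) s :=
    ((hasDerivAt_id s).sub_const k).div_const ε
  have h2 := ((hasDerivAt_softPos ((s - k) / ε)).comp s h1).const_mul ε
  refine h2.congr_deriv ?_
  field_simp

theorem contDiff_softTrunc : ContDiff ℝ (⊤ : ℕ∞) (softTrunc k ε) :=
  contDiff_const.mul (contDiff_softPos.comp ((contDiff_id.sub contDiff_const).div_const ε))

theorem deriv_deriv_softTrunc_nonneg (hε : 0 < ε) (s : ℝ) :
    0 ≤ deriv (deriv (softTrunc k ε)) s := by
  have : deriv (softTrunc k ε) = fun s => Real.smoothTransition ((s - k) / ε) :=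
    funext fun s => (hasDerivAt_softTrunc hε s).deriv
  rw [this]
  refine Monotone.deriv_nonneg fun a b hab => Real.smoothTransition.monotone ?_
  gcongr

theorem softTrunc_of_le (hε : 0 < ε) {s : ℝ} (hs : s ≤ k) : softTrunc k ε s = 0 := by
  rw [softTrunc, softPos_of_nonpos (div_nonpos_of_nonpos_of_nonneg (by linarith) hε.le), mul_zero]

theorem softTrunc_nonneg (hε : 0 < ε) (s : ℝ) : 0 ≤ softTrunc k ε s :=
  mul_nonneg hε.le (softPos_nonneg _)

theorem sub_le_softTrunc (hε : 0 < ε) (s : ℝ) : s - k - ε ≤ softTrunc k ε s := by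
  have := mul_le_mul_of_nonneg_left (sub_one_le_softPos ((s - k) / ε)) hε.le
  rw [mul_sub, mul_div_cancel₀ _ hε.ne', mul_one] at this
  exact this

theorem softTrunc_le (hε : 0 < ε) (hk : 0 ≤ k) {s : ℝ} (hs : 0 ≤ s) : softTrunc k ε s ≤ s := by
  rcases le_total s k with h | h
  · rwa [softTrunc_of_le hε h]
  · have := mul_le_mul_of_nonneg_left
      (softPos_le (div_nonneg (sub_nonneg.2 h) hε.le)) hε.le
    rw [mul_div_cancel₀ _ hε.ne'] at this
    exact this.trans (by linarith)

end softTrunc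

section derivatives
variable {n : ℕ} {Ω : Set (E n)} {u : E n → ℝ} {lam Lam : ℝ}

theorem hasFDerivAt_pd {f : E n → ℝ} {x : E n} (hf : ContDiffAt ℝ 2 f x) (j : Fin n) :
    HasFDerivAt (fun y => pd f y j) (fderiv ℝ (fun y => pd f y j) x) x :=
  ((hf.pd (k := 1) (by norm_num) j).differentiableAt (by norm_num)).hasFDerivAt

theorem pd2_comp {T : ℝ → ℝ} {g : E n → ℝ} {x : E n} (hT : ContDiff ℝ 2 T)
    (hg : ContDiffAt ℝ 2 g x) (i j : Fin n) :
    pd2 (fun y => T (g y)) x i j =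
      deriv (deriv T) (g x) * (pd g x i * pd g x j) + deriv T (g x) * pd2 g x i j := by
  have hT1 : ∀ s, HasDerivAt T (deriv T s) s :=
    fun s => (hT.differentiable (by norm_num) s).hasDerivAt
  have hT2 : HasDerivAt (deriv T) (deriv (deriv T) (g x)) (g x) :=
    ((contDiff_succ_iff_deriv.1 (by exact_mod_cast hT : ContDiff ℝ (1 + 1) T)).2.2.differentiable
      (by norm_num) (g x)).hasDerivAt
  have hev : (fun y => fderiv ℝ (fun y => T (g y)) y (EuclideanSpace.single j 1)) =ᶠ[nhds x]
      fun y => deriv T (g y) * pd g y j := by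
    filter_upwards [hg.eventually (by norm_num)] with y hy
    have h1 := (hT1 (g y)).comp_hasFDerivAt y (hy.differentiableAt (by norm_num)).hasFDerivAt
    have h2 : fderiv ℝ (fun y => T (g y)) y = deriv T (g y) • fderiv ℝ g y := h1.fderiv
    rw [h2]
    rfl
  have h3 := hT2.comp_hasFDerivAt x (hg.differentiableAt (by norm_num)).hasFDerivAt
  have h4 := h3.mul (hasFDerivAt_pd hg j)
  rw [pd2, hev.fderiv_eq]
  refine (congrArg (fun L => L (EuclideanSpace.single i 1)) h4.fderiv).trans ?_
  simp only [_root_.add_apply, _root_.smul_apply, smul_eq_mul, pd, pd2, Function.comp_apply]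
  ring

theorem sum_cofU_mul_nonneg (h : MAData Ω u lam Lam) {x : E n} (hx : x ∈ Ω) (ξ : Fin n → ℝ) :
    0 ≤ ∑ i, ∑ j, cofU u x i j * (ξ i * ξ j) := by
  have hP := h.Hess_posDef hx
  have hadj : (Hess u x).adjugate = (Hess u x).det • (Hess u x)⁻¹ := by
    rw [Matrix.inv_def, Ring.inverse_eq_inv', smul_smul, mul_inv_cancel₀ hP.det_pos.ne', one_smul]
  have h1 := (hP.inv.posSemidef.smul hP.det_pos.le).dotProduct_mulVec_nonneg ξ
  rw [← hadj] at h1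
  refine h1.trans_eq ?_
  simp only [dotProduct, Matrix.mulVec, star_trivial, Finset.mul_sum, cofU]
  refine Finset.sum_congr rfl fun i _ => Finset.sum_congr rfl fun j _ => ?_
  ring

theorem linMA_comp_nonneg (h : MAData Ω u lam Lam) {T : ℝ → ℝ} {g : E n → ℝ} {x : E n}
    (hx : x ∈ Ω) (hT : ContDiff ℝ 2 T) (hT2 : 0 ≤ deriv (deriv T) (g x))
    (hg : ContDiffAt ℝ 2 g x) (hLg : linMA u g x = 0) : 0 ≤ linMA u (fun y => T (g y)) x := by
  have : linMA u (fun y => T (g y)) x =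
      deriv (deriv T) (g x) * ∑ i, ∑ j, cofU u x i j * (pd g x i * pd g x j) +
        deriv T (g x) * linMA u g x := by
    simp only [linMA, pd2_comp hT hg, Finset.mul_sum, ← Finset.sum_add_distrib]
    refine Finset.sum_congr rfl fun i _ => Finset.sum_congr rfl fun j _ => ?_
    ring
  rw [this, hLg, mul_zero, add_zero]
  exact mul_nonneg hT2 (sum_cofU_mul_nonneg h hx _)

theorem pd2_mul {f g : E n → ℝ} {x : E n} (hf : ContDiffAt ℝ 2 f x) (hg : ContDiffAt ℝ 2 g x)
    (i j : Fin n) :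
    pd2 (fun y => f y * g y) x i j =
      f x * pd2 g x i j + pd f x i * pd g x j + (pd f x j * pd g x i + pd2 f x i j * g x) := by
  have hev : (fun y => fderiv ℝ (fun y => f y * g y) y (EuclideanSpace.single j 1)) =ᶠ[nhds x]
      fun y => f y * pd g y j + g y * pd f y j := by
    filter_upwards [hf.eventually (by norm_num), hg.eventually (by norm_num)] with y hy hy'
    have h1 := (hy.differentiableAt (by norm_num)).hasFDerivAt.mul
      (hy'.differentiableAt (by norm_num)).hasFDerivAt
    have h2 : fderiv ℝ (fun y => f y * g y) y = f y • fderiv ℝ g y + g y • fderiv ℝ f y := h1.fderiv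
    rw [h2]
    rfl
  have hd : ∀ {f : E n → ℝ}, ContDiffAt ℝ 2 f x → HasFDerivAt f (fderiv ℝ f x) x :=
    fun hf => (hf.differentiableAt (by norm_num)).hasFDerivAt
  have h4 := ((hd hf).mul (hasFDerivAt_pd hg j)).add ((hd hg).mul (hasFDerivAt_pd hf j))
  rw [pd2, hev.fderiv_eq]
  refine (congrArg (fun L => L (EuclideanSpace.single i 1)) h4.fderiv).trans ?_
  simp only [_root_.add_apply, _root_.smul_apply, smul_eq_mul, pd, pd2]
  ring

theorem pd_rescale (f : E n → ℝ) (x₀ : E n) (c : ℝ) (hf : Differentiable ℝ f) (x : E n)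
    (i : Fin n) : pd (fun y => f (c • (y - x₀))) x i = c * pd f (c • (x - x₀)) i := by
  have h1 : HasFDerivAt (fun y : E n => c • (y - x₀)) (c • ContinuousLinearMap.id ℝ (E n)) x :=
    ((hasFDerivAt_id x).sub_const x₀).const_smul c
  have h2 := (hf (c • (x - x₀))).hasFDerivAt.comp x h1
  refine (congrArg (fun L => L (EuclideanSpace.single i 1)) h2.fderiv).trans ?_
  simp [pd]

theorem pd2_rescale (f : E n → ℝ) (x₀ : E n) (c : ℝ) (hf : ContDiff ℝ 2 f) (x : E n)
    (i j : Fin n) : pd2 (fun y => f (c • (y - x₀))) x i j = c ^ 2 * pd2 f (c • (x - x₀)) i j := by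
  have hd : Differentiable ℝ fun y => pd f y j := fun y =>
    (hf.contDiffAt.pd (k := 1) (by norm_num) j).differentiableAt (by norm_num)
  have h1 : (fun y => fderiv ℝ (fun y => f (c • (y - x₀))) y (EuclideanSpace.single j 1)) =
      fun y => c * pd f (c • (y - x₀)) j :=
    funext fun y => pd_rescale f x₀ c (hf.differentiable (by norm_num)) y j
  have h2 := pd_rescale (fun y => pd f y j) x₀ c hd x i
  have h3 : DifferentiableAt ℝ (fun y => pd f (c • (y - x₀)) j) x :=
    DifferentiableAt.comp (g := fun y => pd f y j) (f := fun y => c • (y - x₀)) x (hd _)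
      (by fun_prop)
  rw [pd2, h1, fderiv_const_mul h3]
  simp only [_root_.smul_apply, smul_eq_mul]
  rw [pow_two, mul_assoc]
  congr 1

end derivatives

section cutoff
variable {n : ℕ} {Ω : Set (E n)} {u : E n → ℝ} {lam Lam : ℝ}

/-- A smooth cutoff at the origin, equal to `1` on the ball of radius `1/2`. -/
def bump (n : ℕ) : ContDiffBump (0 : E n) := ⟨1 / 2, 1, by norm_num, by norm_num⟩

/-- The cutoff at `x₀` at scale `r`. -/
def cutoff (x₀ : E n) (r : ℝ) (x : E n) : ℝ := bump n (r⁻¹ • (x - x₀))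

theorem contDiff_cutoff (x₀ : E n) (r : ℝ) : ContDiff ℝ (⊤ : ℕ∞) (cutoff x₀ r) :=
  (bump n).contDiff.comp ((contDiff_id.sub contDiff_const).const_smul r⁻¹)

theorem cutoff_le_one (x₀ : E n) (r : ℝ) (x : E n) : cutoff x₀ r x ≤ 1 := (bump n).le_one

theorem cutoff_eq_one {x₀ x : E n} {r : ℝ} (hr : 0 < r)
    (hx : x ∈ Metric.closedBall x₀ (r / 2)) : cutoff x₀ r x = 1 := by
  refine (bump n).one_of_mem_closedBall ?_
  rw [Metric.mem_closedBall, dist_eq_norm] at hx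
  rw [mem_closedBall_zero_iff, norm_smul, norm_inv, Real.norm_of_nonneg hr.le,
    inv_mul_le_iff₀ hr]
  change _ ≤ r * (1 / 2)
  linarith

theorem cutoff_eq_zero {x₀ x : E n} {r : ℝ} (hr : 0 < r)
    (hx : x ∉ Metric.closedBall x₀ r) : cutoff x₀ r x = 0 := by
  refine (bump n).zero_of_le_dist ?_
  rw [Metric.mem_closedBall, dist_eq_norm, not_le] at hx
  rw [dist_zero_right, norm_smul, norm_inv, Real.norm_of_nonneg hr.le, le_inv_mul_iff₀ hr]
  change r * 1 ≤ _
  linarith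

theorem tsupport_cutoff_subset {x₀ : E n} {r : ℝ} (hr : 0 < r) :
    tsupport (cutoff x₀ r) ⊆ Metric.closedBall x₀ r :=
  closure_minimal (fun x hx => by
    by_contra hx'
    exact hx (cutoff_eq_zero hr hx')) Metric.isClosed_closedBall

/-- The rescaled operator applied to a cutoff function. -/
def scaledOp (u φ : E n → ℝ) (x₀ : E n) (p : ℝ × E n) : ℝ :=
  ∑ i, ∑ j, cofU u (x₀ + p.1 • p.2) i j *
    (p.1 ^ 2 * (bump n p.2 * pd2 φ (x₀ + p.1 • p.2) i j) +
      p.1 * (pd (bump n) p.2 i * pd φ (x₀ + p.1 • p.2) j) +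
      (p.1 * (pd (bump n) p.2 j * pd φ (x₀ + p.1 • p.2) i) +
        pd2 (bump n) p.2 i j * φ (x₀ + p.1 • p.2)))

theorem linMA_cutoff_mul {φ : E n → ℝ} {x₀ x : E n} {r : ℝ} (hr : 0 < r)
    (hφ : ContDiffAt ℝ 2 φ x) :
    linMA u (fun y => cutoff x₀ r y * φ y) x =
      (r ^ 2)⁻¹ * scaledOp u φ x₀ (r, r⁻¹ • (x - x₀)) := by
  have hb : ContDiff ℝ 2 (bump n) := (bump n).contDiff
  have hx : x₀ + r • r⁻¹ • (x - x₀) = x := by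
    rw [smul_inv_smul₀ hr.ne', add_sub_cancel]
  simp only [linMA, scaledOp, hx, Finset.mul_sum]
  refine Finset.sum_congr rfl fun i _ => Finset.sum_congr rfl fun j _ => ?_
  have hc : ContDiffAt ℝ 2 (cutoff x₀ r) x := (contDiff_cutoff x₀ r).contDiffAt.of_le two_le_smooth
  have h1 : ∀ i, pd (cutoff x₀ r) x i = r⁻¹ * pd (bump n) (r⁻¹ • (x - x₀)) i :=
    pd_rescale _ x₀ r⁻¹ (hb.differentiable (by norm_num)) x
  have h2 : pd2 (cutoff x₀ r) x i j = r⁻¹ ^ 2 * pd2 (bump n) (r⁻¹ • (x - x₀)) i j :=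
    pd2_rescale _ x₀ r⁻¹ hb x i j
  have h3 : cutoff x₀ r x = bump n (r⁻¹ • (x - x₀)) := rfl
  rw [pd2_mul hc hφ, h1, h1, h2, h3]
  field_simp

theorem continuousOn_scaledOp {φ : E n → ℝ} {x₀ : E n} {s : Set (ℝ × E n)}
    (h : MAData Ω u lam Lam) (hφ : ∀ x ∈ Ω, ContDiffAt ℝ (⊤ : ℕ∞) φ x)
    (hs : ∀ p ∈ s, x₀ + p.1 • p.2 ∈ Ω) : ContinuousOn (scaledOp u φ x₀) s := by
  intro p hp
  refine ContinuousAt.continuousWithinAt ?_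
  have hx := hs p hp
  have hm : ContinuousAt (fun p : ℝ × E n => x₀ + p.1 • p.2) p := by fun_prop
  have hb : ContDiff ℝ (⊤ : ℕ∞) (bump n) := (bump n).contDiff
  have hc : ∀ {f : E n → ℝ}, ContDiffAt ℝ (⊤ : ℕ∞) f (x₀ + p.1 • p.2) →
      ContinuousAt (fun p : ℝ × E n => f (x₀ + p.1 • p.2)) p :=
    fun hf => ContinuousAt.comp (f := fun p : ℝ × E n => x₀ + p.1 • p.2) hf.continuousAt hm
  have hc' : ∀ {f : E n → ℝ}, ContDiffAt ℝ (⊤ : ℕ∞) f p.2 →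
      ContinuousAt (fun p : ℝ × E n => f p.2) p :=
    fun hf => ContinuousAt.comp (f := Prod.snd) hf.continuousAt continuousAt_snd
  have h1 : ∀ {f : E n → ℝ} {x : E n}, ContDiffAt ℝ (⊤ : ℕ∞) f x → ∀ i,
      ContDiffAt ℝ (⊤ : ℕ∞) (fun y => pd f y i) x := fun hf i => hf.pd (by simp) i
  have h2 : ∀ {f : E n → ℝ} {x : E n}, ContDiffAt ℝ (⊤ : ℕ∞) f x → ∀ i j,
      ContDiffAt ℝ (⊤ : ℕ∞) (fun y => pd2 f y i j) x := fun hf i j => hf.pd2 (by simp) i j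
  have hf1 : ContinuousAt (fun p : ℝ × E n => p.1) p := continuousAt_fst
  refine tendsto_finsetSum _ fun i _ => tendsto_finsetSum _ fun j _ => ?_
  exact (hc (contDiffAt_cofU (h.smooth _ hx) i j)).mul
    ((((hf1.pow 2).mul ((hc' hb.contDiffAt).mul (hc (h2 (hφ _ hx) i j)))).add
      (hf1.mul ((hc' (h1 hb.contDiffAt i)).mul (hc (h1 (hφ _ hx) j))))).add
    ((hf1.mul ((hc' (h1 hb.contDiffAt j)).mul (hc (h1 (hφ _ hx) i)))).add
      ((hc' (h2 hb.contDiffAt i j)).mul (hc (hφ _ hx)))))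

theorem contDiff_cutoff_mul {φ : E n → ℝ} {x₀ : E n} {r : ℝ} (hr : 0 < r)
    (hφ : ∀ x ∈ Ω, ContDiffAt ℝ (⊤ : ℕ∞) φ x) (hsub : Metric.closedBall x₀ r ⊆ Ω) :
    ContDiff ℝ (⊤ : ℕ∞) (fun y => cutoff x₀ r y * φ y) :=
  contDiff_of_eq_zero_off (isCompact_closedBall x₀ r)
    (fun x hx => (contDiff_cutoff x₀ r).contDiffAt.mul (hφ x (hsub hx)))
    fun x hx => by rw [cutoff_eq_zero hr hx, zero_mul]

theorem tsupport_cutoff_mul_subset {φ : E n → ℝ} {x₀ : E n} {r : ℝ} (hr : 0 < r) :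
    tsupport (fun y => cutoff x₀ r y * φ y) ⊆ Metric.closedBall x₀ r :=
  (tsupport_mul_subset_left (f := cutoff x₀ r) (g := φ)).trans (tsupport_cutoff_subset hr)

/-- In dimension at least three, cutoffs have small energy. -/
theorem exists_cutoff_small (hn : 3 ≤ n) (h : MAData Ω u lam Lam) {x₀ : E n} (hx : x₀ ∈ Ω)
    {φ : E n → ℝ} (hφ : ∀ x ∈ Ω, ContDiffAt ℝ (⊤ : ℕ∞) φ x) {D : Set (E n)} (hD : D ∈ nhds x₀)
    {η : ℝ} (hη : 0 < η) :
    ∃ r > 0, Metric.closedBall x₀ r ⊆ D ∩ Ω ∧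
      ∫ x, |linMA u (fun y => cutoff x₀ r y * φ y) x| ≤ η := by
  obtain ⟨r₁, hr₁, hsub⟩ := Metric.nhds_basis_closedBall.mem_iff.1
    (Filter.inter_mem hD (h.isOpen.mem_nhds hx))
  have hmem : ∀ p ∈ Set.Icc (0 : ℝ) r₁ ×ˢ Metric.closedBall (0 : E n) 1,
      x₀ + p.1 • p.2 ∈ Ω := by
    rintro ⟨r, z⟩ ⟨hr, hz⟩
    refine (hsub ?_).2
    rw [Metric.mem_closedBall, dist_eq_norm, add_sub_cancel_left, norm_smul,
      Real.norm_of_nonneg hr.1]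
    exact (mul_le_mul hr.2 (mem_closedBall_zero_iff.1 hz) (norm_nonneg _) hr₁.le).trans
      (mul_one _).le
  obtain ⟨B, hB⟩ := (isCompact_Icc.prod (isCompact_closedBall (0 : E n) 1)).exists_bound_of_continuousOn
    (continuousOn_scaledOp h hφ hmem)
  have hB0 : 0 ≤ B := (norm_nonneg _).trans
    (hB (0, 0) ⟨⟨le_rfl, hr₁.le⟩, Metric.mem_closedBall_self zero_le_one⟩)
  set v := (volume (Metric.ball (0 : E n) 1)).toReal with hv
  have hv0 : 0 ≤ v := ENNReal.toReal_nonneg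
  refine ⟨min r₁ (min 1 (η / (B * v + 1))), by positivity, ?_, ?_⟩
  · exact (Metric.closedBall_subset_closedBall (min_le_left _ _)).trans hsub
  set r := min r₁ (min 1 (η / (B * v + 1))) with hr_def
  have hr : 0 < r := by positivity
  have hrr : r ≤ r₁ := min_le_left _ _
  have hr1 : r ≤ 1 := (min_le_right _ _).trans (min_le_left _ _)
  have hrη : r * (B * v + 1) ≤ η :=
    (le_div_iff₀ (by positivity)).1 ((min_le_right _ _).trans (min_le_right _ _))
  have hball := (Metric.closedBall_subset_closedBall (x := x₀) hrr).trans hsub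
  have hpt : ∀ x ∈ Metric.closedBall x₀ r,
      |linMA u (fun y => cutoff x₀ r y * φ y) x| ≤ (r ^ 2)⁻¹ * B := by
    intro x hx
    rw [linMA_cutoff_mul hr ((hφ x (hball hx).2).of_le two_le_smooth), abs_mul,
      abs_of_pos (by positivity)]
    refine mul_le_mul_of_nonneg_left (hB _ ⟨⟨hr.le, hrr⟩, ?_⟩) (by positivity)
    rw [Metric.mem_closedBall, dist_eq_norm] at hx
    rw [mem_closedBall_zero_iff, norm_smul, norm_inv, Real.norm_of_nonneg hr.le,
      inv_mul_le_iff₀ hr, mul_one]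
    exact hx
  have hzero : ∀ x ∉ Metric.closedBall x₀ r, |linMA u (fun y => cutoff x₀ r y * φ y) x| = 0 :=
    fun x hx => by
      rw [linMA_eq_zero_of_notMem_tsupport fun hx' => hx (tsupport_cutoff_mul_subset hr hx'),
        abs_zero]
  rw [← setIntegral_eq_integral_of_forall_compl_eq_zero hzero]
  have h1 := norm_setIntegral_le_of_norm_le_const (μ := volume) (C := (r ^ 2)⁻¹ * B)
    (isCompact_closedBall x₀ r).measure_lt_top (fun x hx => by
      rw [Real.norm_eq_abs, abs_abs]
      exact hpt x hx)
  refine (le_abs_self _).trans (h1.trans ?_)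
  have h2 : volume.real (Metric.closedBall x₀ r) = r ^ n * v := by
    rw [Measure.real, Measure.addHaar_closedBall _ _ hr.le, ENNReal.toReal_mul,
      ENNReal.toReal_ofReal (by positivity), finrank_euclideanSpace_fin]
  rw [h2]
  have h3 : (r ^ 2)⁻¹ * B * (r ^ n * v) = r ^ (n - 2) * (B * v) := by
    obtain ⟨k, rfl⟩ := Nat.exists_eq_add_of_le (show 2 ≤ n by omega)
    rw [Nat.add_sub_cancel_left, pow_add]
    field_simp
  rw [h3]
  have h4 : r ^ (n - 2) ≤ r := by
    calc r ^ (n - 2) ≤ r ^ 1 := pow_le_pow_of_le_one hr.le hr1 (by omega)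
      _ = r := pow_one r
  calc r ^ (n - 2) * (B * v) ≤ r * (B * v) := mul_le_mul_of_nonneg_right h4 (by positivity)
    _ ≤ r * (B * v + 1) := by nlinarith
    _ ≤ η := hrη

end cutoff

section green
variable {n : ℕ} {Ω V D : Set (E n)} {u g φ : E n → ℝ} {lam Lam M ε : ℝ} {x₀ : E n}

/-- The part of `D` where `g` is at least `k`, together with the pole. -/
def superlevel (g : E n → ℝ) (x₀ : E n) (D : Set (E n)) (k : ℝ) : Set (E n) :=
  {x ∈ closure D | x = x₀ ∨ k ≤ g x}

theorem isClosed_superlevel (hg : ContinuousOn g (closure V \ {x₀})) (hDV : D ⊆ V)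
    (k : ℝ) : IsClosed (superlevel g x₀ D k) := by
  refine ⟨isOpen_iff_mem_nhds.2 fun x hx => ?_⟩
  by_cases hxD : x ∈ closure D
  · have hne : x ≠ x₀ := fun he => hx ⟨hxD, Or.inl he⟩
    have hlt : g x < k := by
      by_contra hle
      exact hx ⟨hxD, Or.inr (not_lt.1 hle)⟩
    have hc := hg x ⟨closure_mono hDV hxD, hne⟩
    filter_upwards [eventually_nhdsWithin_iff.1 (hc.eventually_lt_const hlt),
      isOpen_ne.mem_nhds hne] with y hy hyne hyS
    rcases hyS.2 with he | he
    · exact hyne he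
    · exact absurd (hy ⟨closure_mono hDV hyS.1, hyne⟩) (not_lt.2 he)
  · filter_upwards [isClosed_closure.isOpen_compl.mem_nhds hxD] with y hy hyS using hy hyS.1

theorem superlevel_subset {k : ℝ} (hx₀ : x₀ ∈ D) (hgM : ∀ x ∈ frontier D, g x < k) :
    superlevel g x₀ D k ⊆ D := by
  rintro x ⟨hxD, rfl | hk⟩
  · exact hx₀
  · by_contra hx
    exact absurd (hgM x ⟨hxD, fun hx' => hx (interior_subset hx')⟩) (not_lt.2 hk)

open Classical in
/-- The smooth truncation of a Green's function, extended by zero. -/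
def truncGreen (g : E n → ℝ) (x₀ : E n) (D : Set (E n)) (M ε : ℝ) (x : E n) : ℝ :=
  if x ∈ D ∧ x ≠ x₀ then softTrunc (M + ε) ε (g x) else 0

theorem truncGreen_of_mem {x : E n} (hx : x ∈ D) (hne : x ≠ x₀) :
    truncGreen g x₀ D M ε x = softTrunc (M + ε) ε (g x) := if_pos ⟨hx, hne⟩

theorem truncGreen_of_notMem {x : E n} (hx : x ∉ D) : truncGreen g x₀ D M ε x = 0 :=
  if_neg fun h => hx h.1

theorem truncGreen_nonneg (hε : 0 < ε) (x : E n) : 0 ≤ truncGreen g x₀ D M ε x := by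
  unfold truncGreen
  split_ifs
  exacts [softTrunc_nonneg hε _, le_rfl]

theorem truncGreen_eventuallyEq (hDo : IsOpen D) {x : E n} (hx : x ∈ D) (hne : x ≠ x₀) :
    truncGreen g x₀ D M ε =ᶠ[nhds x] fun y => softTrunc (M + ε) ε (g y) := by
  filter_upwards [hDo.mem_nhds hx, isOpen_ne.mem_nhds hne] with y hy hyne
  exact truncGreen_of_mem hy hyne

theorem truncGreen_eventuallyEq_zero (hg : ContinuousOn g (closure V \ {x₀})) (hDV : D ⊆ V)
    (hε : 0 < ε) {x : E n} (hx : x ∉ superlevel g x₀ D (M + ε)) :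
    truncGreen g x₀ D M ε =ᶠ[nhds x] fun _ => 0 := by
  filter_upwards [(isClosed_superlevel hg hDV _).isOpen_compl.mem_nhds hx] with y hy
  unfold truncGreen
  split_ifs with hyD
  · refine softTrunc_of_le hε (not_lt.1 fun hlt => hy ⟨subset_closure hyD.1, Or.inr hlt.le⟩)
  · rfl

theorem IsGreen.contDiffAt (hg : IsGreen u V x₀ g) (hV : IsOpen V) {x : E n} (hx : x ∈ V)
    (hne : x ≠ x₀) : ContDiffAt ℝ (⊤ : ℕ∞) g x :=
  hg.2.1.contDiffAt ((hV.sdiff isClosed_singleton).mem_nhds ⟨hx, hne⟩)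

theorem contDiffAt_truncGreen (hg : IsGreen u V x₀ g) (hV : IsOpen V) (hDo : IsOpen D)
    (hDV : D ⊆ V) (hx₀ : x₀ ∈ D) (hε : 0 < ε) (hgM : ∀ x ∈ frontier D, g x ≤ M)
    {x : E n} (hne : x ≠ x₀) : ContDiffAt ℝ (⊤ : ℕ∞) (truncGreen g x₀ D M ε) x := by
  by_cases hx : x ∈ superlevel g x₀ D (M + ε)
  · have hxD := superlevel_subset hx₀ (fun x hx => (hgM x hx).trans_lt (by linarith)) hx
    exact (contDiff_softTrunc.contDiffAt.comp x (hg.contDiffAt hV (hDV hxD) hne)).congr_of_eventuallyEq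
      (truncGreen_eventuallyEq hDo hxD hne)
  · exact contDiffAt_const.congr_of_eventuallyEq
      (truncGreen_eventuallyEq_zero hg.2.2.2.1 hDV hε hx)

theorem linMA_congr {f f' : E n → ℝ} {x : E n} (h : f =ᶠ[nhds x] f') :
    linMA u f x = linMA u f' x := by
  simp only [linMA, pd2_congr h]

theorem linMA_truncGreen_nonneg (h : MAData Ω u lam Lam) (hVΩ : V ⊆ Ω) (hg : IsGreen u V x₀ g)
    (hV : IsOpen V) (hDo : IsOpen D) (hDV : D ⊆ V) (hx₀ : x₀ ∈ D) (hε : 0 < ε)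
    (hgM : ∀ x ∈ frontier D, g x ≤ M) {x : E n} (hne : x ≠ x₀) :
    0 ≤ linMA u (truncGreen g x₀ D M ε) x := by
  by_cases hx : x ∈ superlevel g x₀ D (M + ε)
  · have hxD := superlevel_subset hx₀ (fun x hx => (hgM x hx).trans_lt (by linarith)) hx
    rw [linMA_congr (truncGreen_eventuallyEq hDo hxD hne)]
    exact linMA_comp_nonneg h (hVΩ (hDV hxD)) (contDiff_softTrunc.of_le two_le_smooth)
      (deriv_deriv_softTrunc_nonneg hε _)
      ((hg.contDiffAt hV (hDV hxD) hne).of_le two_le_smooth) (hg.2.2.1 x ⟨hDV hxD, hne⟩)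
  · rw [linMA_congr (truncGreen_eventuallyEq_zero hg.2.2.2.1 hDV hε hx)]
    simp [linMA, pd2]

theorem truncGreen_le (hg : IsGreen u V x₀ g) (hDV : D ⊆ V) (hε : 0 < ε) (hM : 0 ≤ M)
    {x : E n} (hx : x ∈ D) (hne : x ≠ x₀) : truncGreen g x₀ D M ε x ≤ g x := by
  rw [truncGreen_of_mem hx hne]
  exact softTrunc_le hε (by positivity) (hg.1 x ⟨hDV hx, hne⟩).le

theorem sub_le_truncGreen (hε : 0 < ε) {x : E n} (hx : x ∈ D) (hne : x ≠ x₀) :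
    g x - (M + 2 * ε) ≤ truncGreen g x₀ D M ε x := by
  rw [truncGreen_of_mem hx hne]
  have := sub_le_softTrunc (k := M + ε) hε (g x)
  linarith

/-- The weak formulation, with its integrability made explicit. -/
theorem IsGreen.integral_eq (hg : IsGreen u V x₀ g) {ψ : E n → ℝ}
    (hψ : ContDiff ℝ (⊤ : ℕ∞) ψ) (hc : HasCompactSupport ψ) (hs : tsupport ψ ⊆ V)
    (hne : ψ x₀ ≠ 0) :
    Integrable (fun x => g x * linMA u ψ x) ∧ ∫ x, g x * linMA u ψ x = -ψ x₀ := by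
  have h0 : ∀ x ∉ V, g x * linMA u ψ x = 0 := fun x hx => by
    rw [linMA_eq_zero_of_notMem_tsupport fun hx' => hx (hs hx'), mul_zero]
  have h1 : ∫ x, g x * linMA u ψ x = -ψ x₀ := by
    rw [← setIntegral_eq_integral_of_forall_compl_eq_zero h0]
    exact hg.2.2.2.2.2 ψ hψ hc hs
  refine ⟨?_, h1⟩
  by_contra hni
  rw [integral_undef hni] at h1
  exact hne (by linarith)

theorem truncGreen_mul_integral_le (hn : 3 ≤ n) (h : MAData Ω u lam Lam) (hVΩ : V ⊆ Ω)
    (hVc : IsCompact (closure V)) (hg : IsGreen u V x₀ g) (hV : IsOpen V) (hDo : IsOpen D)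
    (hDV : D ⊆ V) (hx₀ : x₀ ∈ D) (hε : 0 < ε) (hM : 0 ≤ M) (hgM : ∀ x ∈ frontier D, g x ≤ M)
    (hφ : ∀ x ∈ Ω, ContDiffAt ℝ (⊤ : ℕ∞) φ x) (hφ0 : ∀ x ∈ D, 0 ≤ φ x) (hφx : 0 < φ x₀) :
    Integrable (fun x => truncGreen g x₀ D M ε x * -linMA u φ x) ∧
      ∫ x, truncGreen g x₀ D M ε x * -linMA u φ x ≤ 2 * φ x₀ := by
  set G := truncGreen g x₀ D M ε with hG
  have hne₀ : ∀ᵐ x ∂(volume : Measure (E n)), x ≠ x₀ := by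
    have : Nonempty (Fin n) := ⟨⟨0, by omega⟩⟩
    exact Measure.ae_ne volume x₀
  have hGs : ∀ {x}, x ≠ x₀ → ContDiffAt ℝ (⊤ : ℕ∞) G x :=
    fun hne => contDiffAt_truncGreen hg hV hDo hDV hx₀ hε hgM hne
  have hx₀Ω := hVΩ (hDV hx₀)
  have hk : 0 < M + 2 * ε := by positivity
  obtain ⟨r, hr, hball, hsmall⟩ := exists_cutoff_small hn h hx₀Ω hφ (hDo.mem_nhds hx₀)
    (div_pos hφx hk)
  have hballD : Metric.closedBall x₀ r ⊆ D := hball.trans Set.inter_subset_left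
  have hballΩ : Metric.closedBall x₀ r ⊆ Ω := hball.trans Set.inter_subset_right
  set ψ : E n → ℝ := fun y => cutoff x₀ r y * φ y with hψ_def
  have hψ : ContDiff ℝ (⊤ : ℕ∞) ψ := contDiff_cutoff_mul hr hφ hballΩ
  have hψs : tsupport ψ ⊆ Metric.closedBall x₀ r := tsupport_cutoff_mul_subset hr
  have hψc : HasCompactSupport ψ :=
    HasCompactSupport.of_support_subset_isCompact (isCompact_closedBall x₀ r)
      ((subset_tsupport ψ).trans hψs)
  have hψx : ψ x₀ = φ x₀ := by
    rw [hψ_def]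
    simp only
    rw [cutoff_eq_one hr (Metric.mem_closedBall_self (by positivity)), one_mul]
  have hψ0 : ∀ x ∉ D, linMA u ψ x = 0 := fun x hx =>
    linMA_eq_zero_of_notMem_tsupport fun hx' => hx (hballD (hψs hx'))
  obtain ⟨hgi, hge⟩ := hg.integral_eq hψ hψc ((hψs.trans hballD).trans hDV)
    (by rw [hψx]; exact hφx.ne')
  have hLψi : Integrable (linMA u ψ) :=
    integrable_of_eq_zero_off (K := tsupport ψ) hψc
      (fun x hx => continuousAt_linMA (h.smooth x (hballΩ (hψs hx)))
        (hψ.contDiffAt.of_le two_le_smooth)) fun x hx => linMA_eq_zero_of_notMem_tsupport hx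
  have hGm : AEStronglyMeasurable G volume := by
    have h1 : ContinuousOn G {x₀}ᶜ := fun x hx => (hGs hx).continuousAt.continuousWithinAt
    have h2 := h1.aestronglyMeasurable (μ := volume) (measurableSet_singleton x₀).compl
    rwa [Measure.restrict_eq_self_of_ae_mem (s := {x₀}ᶜ) hne₀] at h2
  have hGi : Integrable (fun x => G x * linMA u ψ x) := by
    refine hgi.mono (hGm.mul hLψi.1) ?_
    filter_upwards [hne₀] with x hne
    by_cases hx : x ∈ D
    · rw [norm_mul, norm_mul]
      refine mul_le_mul_of_nonneg_right ?_ (norm_nonneg _)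
      rw [Real.norm_of_nonneg (truncGreen_nonneg hε x)]
      exact (truncGreen_le hg hDV hε hM hx hne).trans (le_abs_self _)
    · rw [hψ0 x hx]
      simp
  have hdiff : ∫ x, (g x * linMA u ψ x - G x * linMA u ψ x) ≤ φ x₀ := by
    have h1 : ∫ x, (g x * linMA u ψ x - G x * linMA u ψ x) ≤
        ∫ x, (M + 2 * ε) * |linMA u ψ x| := by
      refine integral_mono_ae (hgi.sub hGi) (hLψi.abs.const_mul _) ?_
      filter_upwards [hne₀] with x hne
      by_cases hx : x ∈ D
      · have h2 := truncGreen_le (M := M) hg hDV hε hM hx hne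
        have h3 := sub_le_truncGreen (g := g) (M := M) hε hx hne
        rw [← sub_mul]
        refine (le_abs_self _).trans ?_
        rw [abs_mul]
        refine mul_le_mul_of_nonneg_right ?_ (abs_nonneg _)
        rw [abs_of_nonneg (by linarith)]
        linarith
      · simp [hψ0 x hx]
    rw [integral_const_mul] at h1
    calc _ ≤ _ := h1
      _ ≤ (M + 2 * ε) * (φ x₀ / (M + 2 * ε)) := mul_le_mul_of_nonneg_left hsmall hk.le
      _ = φ x₀ := mul_div_cancel₀ _ hk.ne'
  -- the part away from the pole
  set a : E n → ℝ := fun y => φ y - ψ y with ha_def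
  have ha : ∀ x ∈ Ω, ContDiffAt ℝ 2 a x := fun x hx =>
    ((hφ x hx).of_le two_le_smooth).sub (hψ.contDiffAt.of_le two_le_smooth)
  have ha_in : ∀ x ∈ Metric.closedBall x₀ (r / 2), a x = 0 := fun x hx => by
    simp only [ha_def, hψ_def]
    rw [cutoff_eq_one hr hx, one_mul, sub_self]
  have hLa_in : ∀ x ∈ Metric.ball x₀ (r / 2), linMA u a x = 0 := fun x hx => by
    have hev : a =ᶠ[nhds x] fun _ => 0 := by
      filter_upwards [Metric.isOpen_ball.mem_nhds hx] with y hy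
        using ha_in y (Metric.ball_subset_closedBall hy)
    rw [linMA_congr hev]
    simp [linMA, pd2]
  have ha0 : ∀ x ∈ D, 0 ≤ a x := fun x hx => by
    have : a x = (1 - cutoff x₀ r x) * φ x := by simp only [ha_def, hψ_def]; ring
    rw [this]
    exact mul_nonneg (by linarith [cutoff_le_one x₀ r x]) (hφ0 x hx)
  have hr4 : 0 < r / 4 := by positivity
  set b : E n → ℝ := fun y => (1 - cutoff x₀ (r / 4) y) * G y with hb_def
  set S := superlevel g x₀ D (M + ε) with hS
  have hSD : S ⊆ D := superlevel_subset hx₀ fun x hx => (hgM x hx).trans_lt (by linarith)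
  have hScl : IsClosed S := isClosed_superlevel hg.2.2.2.1 hDV _
  have hSc : IsCompact S := hVc.of_isClosed_subset hScl fun x hx => closure_mono hDV hx.1
  have hGS : ∀ x ∉ S, G x = 0 := fun x hx =>
    (truncGreen_eventuallyEq_zero hg.2.2.2.1 hDV hε hx).eq_of_nhds
  have hbS : ∀ x ∉ S, b x = 0 := fun x hx => by
    simp only [hb_def]
    rw [hGS x hx, mul_zero]
  have hb : ContDiff ℝ 2 b := by
    refine contDiff_of_eq_zero_off hSc (fun x _ => ?_) hbS
    by_cases hne : x = x₀
    · have hev : b =ᶠ[nhds x] fun _ => 0 := by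
        rw [hne]
        filter_upwards [Metric.closedBall_mem_nhds x₀ (show 0 < r / 4 / 2 by positivity)] with y hy
        simp only [hb_def]
        rw [cutoff_eq_one hr4 hy, sub_self, zero_mul]
      exact contDiffAt_const.congr_of_eventuallyEq hev
    · exact ((contDiffAt_const.sub (contDiff_cutoff x₀ (r / 4)).contDiffAt).mul
        (hGs hne)).of_le two_le_smooth
  have hbs : tsupport b ⊆ S := closure_minimal (fun x hx => by
    by_contra hx'
    exact hx (hbS x hx')) hScl
  have hbc : HasCompactSupport b := hSc.of_isClosed_subset (isClosed_tsupport b) hbs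
  obtain ⟨hi1, -, hsymm⟩ := h.integral_mul_linMA ha hb hbc (hbs.trans ((hSD.trans hDV).trans hVΩ))
  have hbG : ∀ x, b x * linMA u a x = G x * linMA u a x := fun x => by
    by_cases hx : x ∈ Metric.ball x₀ (r / 2)
    · rw [hLa_in x hx, mul_zero, mul_zero]
    · have : x ∉ Metric.closedBall x₀ (r / 4) := fun hx' =>
        hx (Metric.closedBall_subset_ball (by linarith) hx')
      simp only [hb_def]
      rw [cutoff_eq_zero hr4 this, sub_zero, one_mul]
  have hpos : 0 ≤ ∫ x, a x * linMA u b x := by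
    refine integral_nonneg fun x => ?_
    by_cases hx : x ∈ Metric.closedBall x₀ (r / 2)
    · simp [ha_in x hx]
    · have hx4 : x ∉ Metric.closedBall x₀ (r / 4) := fun hx' =>
        hx (Metric.closedBall_subset_closedBall (by linarith) hx')
      have hne : x ≠ x₀ := fun he => hx (by
        rw [he]
        exact Metric.mem_closedBall_self (by positivity))
      have hev : b =ᶠ[nhds x] G := by
        filter_upwards [Metric.isClosed_closedBall.isOpen_compl.mem_nhds hx4] with y hy
        simp only [hb_def]
        rw [cutoff_eq_zero hr4 hy, sub_zero, one_mul]
      by_cases hxD : x ∈ D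
      · rw [linMA_congr hev]
        exact mul_nonneg (ha0 x hxD)
          (linMA_truncGreen_nonneg h hVΩ hg hV hDo hDV hx₀ hε hgM hne)
      · rw [linMA_eq_zero_of_notMem_tsupport fun hx' => hxD (hSD (hbs hx')), mul_zero]
        exact le_rfl
  simp only [hbG] at hi1 hsymm
  have hsplit : ∀ x, G x * -linMA u φ x = -(G x * linMA u ψ x + G x * linMA u a x) := fun x => by
    by_cases hx : x ∈ D
    · have hxΩ := hVΩ (hDV hx)
      have : linMA u a x = linMA u φ x - linMA u ψ x := by
        simp only [linMA, ha_def, pd2_sub ((hφ x hxΩ).of_le two_le_smooth)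
          (hψ.contDiffAt.of_le two_le_smooth), mul_sub, Finset.sum_sub_distrib]
      rw [this]
      ring
    · have : G x = 0 := truncGreen_of_notMem hx
      rw [this]
      ring
  simp only [hsplit]
  refine ⟨(hGi.add hi1).neg, ?_⟩
  rw [integral_neg, integral_add hGi hi1]
  rw [integral_sub hgi hGi, hge, hψx] at hdiff
  linarith

/-- Weak-type estimate for a Green's function above its boundary values on `D`. -/
theorem green_mul_volume_le (hn : 3 ≤ n) (h : MAData Ω u lam Lam) (hVΩ : V ⊆ Ω)
    (hVc : IsCompact (closure V)) (hg : IsGreen u V x₀ g) (hV : IsOpen V) (hDo : IsOpen D)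
    (hDV : D ⊆ V) (hx₀ : x₀ ∈ D) (hM : 0 ≤ M) (hgM : ∀ x ∈ frontier D, g x ≤ M)
    (hφ : ∀ x ∈ Ω, ContDiffAt ℝ (⊤ : ℕ∞) φ x) (hLφ : ∀ x ∈ Ω, linMA u φ x ≤ -lam)
    (hφ0 : ∀ x ∈ D, 0 ≤ φ x) (hφx : 0 < φ x₀) {a : ℝ} (ha : 0 < a) {A : Set (E n)}
    (hA : ∀ x ∈ A, x ≠ x₀ → x ∈ D ∧ a ≤ g x - M) :
    ENNReal.ofReal a * volume A ≤ ENNReal.ofReal (4 * φ x₀ / lam) := by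
  have hlam := h.lam_pos
  obtain ⟨hi, hle⟩ := truncGreen_mul_integral_le (ε := a / 4) hn h hVΩ hVc hg hV hDo hDV hx₀
    (by positivity) hM hgM hφ hφ0 hφx
  set F : E n → ℝ := fun x => truncGreen g x₀ D M (a / 4) x * -linMA u φ x with hF
  have hF0 : ∀ x, 0 ≤ F x := fun x => by
    by_cases hx : x ∈ D
    · exact mul_nonneg (truncGreen_nonneg (by positivity) x)
        (by linarith [hLφ x (hVΩ (hDV hx))])
    · simp only [hF]
      rw [truncGreen_of_notMem hx, zero_mul]
  have hsub : A ⊆ {x | ENNReal.ofReal (a / 2 * lam) ≤ ENNReal.ofReal (F x)} ∪ {x₀} := by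
    intro x hx
    by_cases hne : x = x₀
    · exact Or.inr hne
    · obtain ⟨hxD, hxa⟩ := hA x hx hne
      refine Or.inl (ENNReal.ofReal_le_ofReal (mul_le_mul ?_ ?_ hlam.le ?_))
      · have := sub_le_truncGreen (g := g) (M := M) (ε := a / 4) (by positivity) hxD hne
        linarith
      · linarith [hLφ x (hVΩ (hDV hxD))]
      · exact truncGreen_nonneg (by positivity) x
  have : Nonempty (Fin n) := ⟨⟨0, by omega⟩⟩
  have hvol : volume A ≤ volume {x | ENNReal.ofReal (a / 2 * lam) ≤ ENNReal.ofReal (F x)} := by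
    refine (measure_mono hsub).trans ((measure_union_le _ _).trans ?_)
    rw [measure_singleton, add_zero]
  have hmark := mul_meas_ge_le_lintegral₀ hi.1.aemeasurable.ennreal_ofReal
    (ENNReal.ofReal (a / 2 * lam))
  rw [← ofReal_integral_eq_lintegral_ofReal hi (Filter.Eventually.of_forall hF0)] at hmark
  have h1 : ENNReal.ofReal (a / 2 * lam) * volume A ≤ ENNReal.ofReal (2 * φ x₀) :=
    (mul_le_mul_right hvol _).trans (hmark.trans (ENNReal.ofReal_le_ofReal hle))
  have h2 : ENNReal.ofReal a = ENNReal.ofReal (2 / lam) * ENNReal.ofReal (a / 2 * lam) := by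
    rw [← ENNReal.ofReal_mul (by positivity)]
    congr 1
    field_simp
  have h3 : ENNReal.ofReal (4 * φ x₀ / lam) =
      ENNReal.ofReal (2 / lam) * ENNReal.ofReal (2 * φ x₀) := by
    rw [← ENNReal.ofReal_mul (by positivity)]
    congr 1
    field_simp
    norm_num
  rw [h3, h2, mul_assoc]
  exact mul_le_mul_right h1 _

end green

section upper
variable {n : ℕ} {Ω V D : Set (E n)} {u g φ : E n → ℝ} {lam Lam M : ℝ} {x₀ : E n}

theorem continuousOn_indicator_green (hg : IsGreen u V x₀ g) (hV : IsOpen V) :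
    ContinuousOn (V.indicator g) {x₀}ᶜ := by
  intro y hy
  refine ContinuousAt.continuousWithinAt ?_
  by_cases hyV : y ∈ V
  · have hev : V.indicator g =ᶠ[nhds y] g := by
      filter_upwards [hV.mem_nhds hyV] with z hz using Set.indicator_of_mem hz g
    exact (hg.contDiffAt hV hyV hy).continuousAt.congr_of_eventuallyEq hev
  · have hy0 : V.indicator g y = 0 := Set.indicator_of_notMem hyV g
    rw [ContinuousAt, hy0]
    by_cases hyc : y ∈ closure V
    · have hgy : g y = 0 := hg.2.2.2.2.1 y ⟨hyc, fun h => hyV (interior_subset h)⟩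
      have ht : Filter.Tendsto g (nhdsWithin y (closure V \ {x₀})) (nhds 0) := by
        have := hg.2.2.2.1 y ⟨hyc, hy⟩
        rwa [ContinuousWithinAt, hgy] at this
      refine Filter.tendsto_def.2 fun s hs => ?_
      filter_upwards [eventually_nhdsWithin_iff.1 (ht hs), isOpen_ne.mem_nhds hy] with z hz hne
      by_cases hzV : z ∈ V
      · simpa [hzV] using hz ⟨subset_closure hzV, hne⟩
      · simpa [hzV] using mem_of_mem_nhds hs
    · refine tendsto_const_nhds.congr' ?_
      filter_upwards [isClosed_closure.isOpen_compl.mem_nhds hyc] with z hz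
      exact (Set.indicator_of_notMem (fun h => hz (subset_closure h)) g).symm

/-- A pointwise bound for a Green's function in terms of its boundary values on `D`. -/
theorem green_sub_mul_sqrt_pow_le (hn : 3 ≤ n) (h : MAData Ω u lam Lam) (hVΩ : V ⊆ Ω)
    (hVc : IsCompact (closure V)) (hg : IsGreen u V x₀ g) (hV : IsOpen V) {c₀ K : ℝ}
    (hmax : LocalMax n Ω V u lam Lam c₀ K) (hDo : IsOpen D)
    (hDV : D ⊆ V) (hx₀ : x₀ ∈ D) (hM : 0 ≤ M) (hgM : ∀ x ∈ frontier D, g x ≤ M)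
    (hφ : ∀ x ∈ Ω, ContDiffAt ℝ (⊤ : ℕ∞) φ x) (hLφ : ∀ x ∈ Ω, linMA u φ x ≤ -lam)
    (hφ0 : ∀ x ∈ D, 0 ≤ φ x) (hφx : 0 < φ x₀) {x : E n} (hx : x ∈ V) {ρ : ℝ} (hρ : 0 < ρ)
    (hρc : 2 * engC n lam Lam * ρ ≤ c₀) (hx₀ρ : x₀ ∉ csec Ω u x ρ)
    (hcD : ∀ y ∈ csec Ω u x ρ, y ∈ V → y ∈ D) :
    (g x - M) * Real.sqrt ρ ^ n ≤ K * (4 * φ x₀ / lam) := by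
  have hlam := h.lam_pos
  have hpos : ∀ {y : E n}, 0 < max (V.indicator g y - M) 0 → y ∈ V ∧ M < g y := by
    intro y hy
    have h1 : 0 < V.indicator g y - M := by
      rcases lt_max_iff.1 hy with h | h
      exacts [h, absurd h (lt_irrefl _)]
    have hyV : y ∈ V := by
      by_contra hyV
      rw [Set.indicator_of_notMem hyV] at h1
      linarith
    rw [Set.indicator_of_mem hyV] at h1
    exact ⟨hyV, by linarith⟩
  have hne : ∀ {y : E n}, y ∈ csec Ω u x ρ → y ≠ x₀ := fun hy he => hx₀ρ (he ▸ hy)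
  have hc : ContinuousOn (fun y => max (V.indicator g y - M) 0) (csec Ω u x ρ) :=
    ContinuousOn.sup (((continuousOn_indicator_green hg hV).mono fun y hy => hne hy).sub
      continuousOn_const) continuousOn_const
  have key := hmax x hx ρ hρ hρc (fun y => max (V.indicator g y - M) 0) hc ?_
    (4 * φ x₀ / lam) (by positivity) ?_
  · refine (mul_le_mul_of_nonneg_right ?_ (by positivity)).trans key
    rw [Set.indicator_of_mem hx]
    exact le_max_left _ _
  · intro y hy hy0
    obtain ⟨hyV, hyM⟩ := hpos hy0
    have hgy := hg.contDiffAt hV hyV (hne hy)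
    have hev : (fun y => max (V.indicator g y - M) 0) =ᶠ[nhds y] fun y => g y - M := by
      filter_upwards [hV.mem_nhds hyV, hgy.continuousAt.eventually_const_lt hyM] with z hz hzM
      rw [Set.indicator_of_mem hz, max_eq_left (by linarith)]
    have hgy2 := hgy.of_le two_le_smooth
    refine ⟨hyV, (hgy2.sub contDiffAt_const).congr_of_eventuallyEq hev, ?_⟩
    refine Eq.trans ?_ (hg.2.2.1 y ⟨hyV, hne hy⟩)
    refine Finset.sum_congr rfl fun i _ => Finset.sum_congr rfl fun j _ => ?_
    rw [pd2_congr hev, pd2_sub hgy2 contDiffAt_const]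
    simp [pd2]
  · intro a ha
    refine green_mul_volume_le hn h hVΩ hVc hg hV hDo hDV hx₀ hM hgM hφ hLφ hφ0 hφx ha ?_
    rintro y ⟨hy, hya⟩ -
    obtain ⟨hyV, hyM⟩ := hpos (ha.trans_le hya)
    rw [Set.indicator_of_mem hyV, max_eq_left (by linarith)] at hya
    exact ⟨hcD y hy hyV, hya⟩

/-- Functions differing from `-u` by an affine function are strict supersolutions. -/
theorem linMA_const_sub_le (hn : 0 < n) (h : MAData Ω u lam Lam) {ψ : E n → ℝ} {x : E n}
    (hx : x ∈ Ω) (hψ : ContDiffAt ℝ 2 ψ x) (hH : Hess ψ x = Hess u x) (c : ℝ) :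
    linMA u (fun y => c - ψ y) x ≤ -lam := by
  have h1 : linMA u (fun y => c - ψ y) x = -linMA u ψ x := by
    simp only [linMA, pd2_sub contDiffAt_const hψ]
    simp [pd2]
  have h2 : linMA u ψ x = n * (Hess u x).det := by
    rw [linMA, ← trace_adjugate_mul_Hess hψ, hH, Matrix.adjugate_mul, Matrix.trace_smul,
      Matrix.trace_one, Fintype.card_fin, smul_eq_mul, mul_comm]
  have h3 : (1 : ℝ) ≤ n := by exact_mod_cast hn
  have h4 := h.le_det x hx
  have h5 := h.lam_pos
  rw [h1, h2]
  nlinarith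

theorem frontier_sublevel (h : MAData Ω u lam Lam) (hVΩ : V ⊆ Ω) (hV : IsOpen V)
    {s : ℝ} {y : E n} (hy : y ∈ frontier {y ∈ V | breg u x₀ y < s}) :
    y ∈ frontier V ∨ y ∈ V ∧ breg u x₀ y = s := by
  have hyV : y ∈ closure V := closure_mono (fun z hz => hz.1) hy.1
  by_cases hyV' : y ∈ V
  · refine Or.inr ⟨hyV', le_antisymm ?_ ?_⟩
    · have hsub : closure {y ∈ V | breg u x₀ y < s} ⊆ csec Ω u x₀ s :=
        closure_minimal (fun z hz => ⟨subset_closure (hVΩ hz.1), hz.2.le⟩) (h.csec_isClosed _ _)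
      exact (hsub hy.1).2
    · by_contra! hlt
      refine hy.2 (mem_interior_iff_mem_nhds.2 ?_)
      filter_upwards [hV.mem_nhds hyV',
        (h.breg_contDiffAt x₀ (hVΩ hyV')).continuousAt.eventually_lt_const hlt] with z h1 h2
      exact ⟨h1, h2⟩
  · exact Or.inl ⟨hyV, fun h => hyV' (interior_subset h)⟩

theorem isOpen_sublevel (h : MAData Ω u lam Lam) (hVΩ : V ⊆ Ω) (hV : IsOpen V) (s : ℝ) :
    IsOpen {y ∈ V | breg u x₀ y < s} :=
  isOpen_iff_mem_nhds.2 fun y hy => by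
    filter_upwards [hV.mem_nhds hy.1,
      (h.breg_contDiffAt x₀ (hVΩ hy.1)).continuousAt.eventually_lt_const hy.2] with z h1 h2
    exact ⟨h1, h2⟩

/-- The pole is outside small sections centred at points far from it. -/
theorem pole_notMem_csec (hn : 0 < n) (h : MAData Ω u lam Lam) {c₀ : ℝ}
    (hc₀ : ∀ y ∈ V, csec Ω u y c₀ ⊆ Ω) (hVΩ : V ⊆ Ω) {x : E n} (hx : x ∈ V) {ρ : ℝ}
    (hρ : 0 < ρ) (hρc : 2 * ρ ≤ c₀) (hlt : 2 * engC n lam Lam * ρ < breg u x₀ x) :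
    x₀ ∉ csec Ω u x ρ := by
  intro hmem
  have h1 := h.csec_engulf hn (hVΩ hx) (show 0 < 2 * ρ by positivity)
    ((csec_mono x hρc).trans (hc₀ x hx)) (by rwa [mul_div_cancel_left₀ ρ two_ne_zero])
  have h2 := (h1 (mem_csec_self (hVΩ hx) (by positivity))).2
  linarith

/-- The decay profile of the Green's function. -/
def decay (n : ℕ) (s : ℝ) : ℝ := (Real.sqrt s ^ (n - 2))⁻¹

theorem decay_eq_rpow (hn : 2 ≤ n) {s : ℝ} (hs : 0 < s) :
    decay n s = s ^ (-(((n : ℝ) - 2) / 2)) := by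
  rw [decay, Real.rpow_neg hs.le, Real.sqrt_eq_rpow, ← Real.rpow_mul_natCast hs.le]
  congr 2
  push_cast [Nat.cast_sub hn]
  ring

theorem one_le_decay {s : ℝ} (hs : 0 < s) (hs1 : s ≤ 1) : 1 ≤ decay n s :=
  (one_le_inv₀ (by positivity)).2 (pow_le_one₀ (Real.sqrt_nonneg _) (Real.sqrt_le_one.2 hs1))

theorem decay_two_mul_le (hn : 3 ≤ n) {s : ℝ} (hs : 0 < s) :
    decay n (2 * s) ≤ 3 / 4 * decay n s := by
  have h1 : 4 / 3 ≤ Real.sqrt 2 := Real.le_sqrt_of_sq_le (by norm_num)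
  have h2 : 4 / 3 ≤ Real.sqrt 2 ^ (n - 2) :=
    h1.trans (le_self_pow₀ (by linarith) (by omega))
  have h3 : (Real.sqrt 2 ^ (n - 2))⁻¹ ≤ 3 / 4 := by
    rw [inv_le_comm₀ (by positivity) (by norm_num)]
    norm_num
    linarith
  rw [decay, decay, Real.sqrt_mul zero_le_two, mul_pow, mul_inv]
  gcongr

theorem mul_sqrt_pow_le_iff (hn : 2 ≤ n) {a b s : ℝ} (hs : 0 < s) :
    a * Real.sqrt s ^ n ≤ b * s ↔ a ≤ b * decay n s := by
  obtain ⟨k, rfl⟩ := Nat.exists_eq_add_of_le' hn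
  rw [decay, Nat.add_sub_cancel, pow_add, Real.sq_sqrt hs.le, ← mul_assoc,
    mul_le_mul_iff_of_pos_right hs, ← div_eq_mul_inv, le_div_iff₀ (by positivity)]

end upper

section decay
variable {n : ℕ} {Ω V : Set (E n)} {u g : E n → ℝ} {lam Lam : ℝ} {x₀ : E n}

theorem green_le_far (hn : 3 ≤ n) (h : MAData Ω u lam Lam) (hVΩ : V ⊆ Ω)
    (hVc : IsCompact (closure V)) (hg : IsGreen u V x₀ g) (hV : IsOpen V) (hx₀ : x₀ ∈ V)
    {c₀ K B ρ : ℝ} (hmax : LocalMax n Ω V u lam Lam c₀ K) (hK : 0 ≤ K)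
    (hu : ∀ y ∈ V, u y < 0) (hB : -u x₀ ≤ B) {x : E n} (hx : x ∈ V) (hρ : 0 < ρ)
    (hρc : 2 * engC n lam Lam * ρ ≤ c₀) (hx₀ρ : x₀ ∉ csec Ω u x ρ) :
    g x * Real.sqrt ρ ^ n ≤ K * (4 * B / lam) := by
  have hlam := h.lam_pos
  have hgV : ∀ y ∈ frontier V, g y ≤ 0 := fun y hy => (hg.2.2.2.2.1 y hy).le
  have h1 := green_sub_mul_sqrt_pow_le (φ := fun y => 0 - u y) hn h hVΩ hVc hg hV hmax hV
    subset_rfl hx₀ le_rfl hgV (fun y hy => contDiffAt_const.sub (h.smooth y hy))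
    (fun y hy => linMA_const_sub_le (by omega) h hy (h.smooth_two hy) rfl 0)
    (fun y hy => by linarith [hu y hy]) (by linarith [hu x₀ hx₀]) hx hρ hρc hx₀ρ
    fun y _ hy => hy
  rw [sub_zero] at h1
  refine h1.trans (mul_le_mul_of_nonneg_left ?_ hK)
  gcongr
  linarith

theorem green_le_near (hn : 3 ≤ n) (h : MAData Ω u lam Lam) (hVΩ : V ⊆ Ω)
    (hVc : IsCompact (closure V)) (hg : IsGreen u V x₀ g) (hV : IsOpen V) (hx₀ : x₀ ∈ V)
    {c₀ K M s ρ : ℝ} (hmax : LocalMax n Ω V u lam Lam c₀ K)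
    (hc₀ : ∀ y ∈ V, csec Ω u y c₀ ⊆ Ω) {x : E n} (hx : x ∈ V) (hs : 0 < s)
    (hxs : breg u x₀ x = s) (hsc : 4 * engC n lam Lam * s ≤ c₀) (hρ : 0 < ρ)
    {J : ℕ} (hρs : ρ ≤ 2 * s / 2 ^ J)
    (hJ : 4 * engC n lam Lam ^ 2 * (1 + starC n lam Lam)⁻¹ ^ J < 1)
    (hρ1 : 2 * engC n lam Lam * ρ < s) (hM : 0 ≤ M)
    (hgM : ∀ y ∈ V, breg u x₀ y = 2 * s → g y ≤ M) :
    (g x - M) * Real.sqrt ρ ^ n ≤ K * (4 * (2 * s) / lam) := by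
  have hn0 : 0 < n := by omega
  have hC := h.three_le_engC hn0 (hVΩ hx)
  have hCs : 3 * s ≤ engC n lam Lam * s := mul_le_mul_of_nonneg_right hC hs.le
  have hx₀ρ := pole_notMem_csec hn0 h hc₀ hVΩ (x₀ := x₀) hx hρ
    (by nlinarith) (by rwa [hxs])
  have hφx : 2 * s - breg u x₀ x₀ = 2 * s := by rw [breg_self, sub_zero]
  have hchain : ∀ y ∈ csec Ω u x ρ, y ∈ V → y ∈ {y ∈ V | breg u x₀ y < 2 * s} := by
    intro y hy hyV
    refine ⟨hyV, ?_⟩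
    have h1 := h.breg_chain hn0 (hVΩ hx₀) (show 0 < 2 * s by positivity)
      ((csec_mono x₀ (by linarith)).trans (hc₀ x₀ hx₀))
      (y := x) ⟨subset_closure (hVΩ hx), by rw [hxs]; linarith⟩
      ((csec_mono x (by linarith)).trans (hc₀ x hx)) J (csec_mono x hρs hy)
    have h2 := mul_lt_mul_of_pos_left hJ hs
    rw [hxs] at h1
    linarith
  have h1 := green_sub_mul_sqrt_pow_le (φ := fun y => 2 * s - breg u x₀ y) hn h hVΩ hVc hg hV hmax
    (isOpen_sublevel h hVΩ hV (2 * s)) (fun y hy => hy.1)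
    ⟨hx₀, by rw [breg_self]; positivity⟩ hM
    (fun y hy => by
      rcases frontier_sublevel h hVΩ hV hy with h' | ⟨hyV, h'⟩
      · rw [hg.2.2.2.2.1 y h']
        exact hM
      · exact hgM y hyV h')
    (fun y hy => contDiffAt_const.sub (h.breg_contDiffAt x₀ hy))
    (fun y hy => linMA_const_sub_le hn0 h hy ((h.breg_contDiffAt x₀ hy).of_le two_le_smooth)
      (h.Hess_breg x₀ hy) (2 * s))
    (fun y hy => sub_nonneg.2 hy.2.le) (by rw [hφx]; positivity) hx hρ
    (by linarith) hx₀ρ hchain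
  rwa [hφx] at h1

theorem green_le_decay (hn : 3 ≤ n) (h : MAData Ω u lam Lam) (hVΩ : V ⊆ Ω)
    (hVc : IsCompact (closure V)) (hg : IsGreen u V x₀ g) (hV : IsOpen V) (hx₀ : x₀ ∈ V)
    {c₀ K B κ s₁ C : ℝ} (hmax : LocalMax n Ω V u lam Lam c₀ K) (hK : 0 ≤ K)
    (hc₀ : ∀ y ∈ V, csec Ω u y c₀ ⊆ Ω) (hu : ∀ y ∈ V, u y < 0) (hB : -u x₀ ≤ B)
    (hκ : 0 < κ) (hκ1 : 4 * engC n lam Lam * κ ≤ 1) {J : ℕ} (hκJ : κ ≤ 2 / 2 ^ J)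
    (hJ : 4 * engC n lam Lam ^ 2 * (1 + starC n lam Lam)⁻¹ ^ J < 1)
    (hs₁ : 0 < s₁) (hs₁2 : s₁ ≤ 1 / 2) (hs₁c : 4 * engC n lam Lam * s₁ ≤ c₀)
    (hC : 0 ≤ C) (hC1 : K * (4 * B / lam) ≤ C * Real.sqrt (κ * s₁) ^ n)
    (hC2 : 32 * K / lam ≤ C * Real.sqrt κ ^ n) {x : E n} (hx : x ∈ V)
    (hpos : 0 < breg u x₀ x) (hle : breg u x₀ x ≤ 1) :
    g x ≤ C * decay n (breg u x₀ x) := by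
  have hn0 : 0 < n := by omega
  have hE := h.three_le_engC hn0 (hVΩ hx)
  have hκ2 : ∀ {s : ℝ}, 0 < s → 2 * engC n lam Lam * (κ * s) < s := fun hs => by
    have := mul_le_mul_of_nonneg_right hκ1 hs.le
    linarith
  suffices hind : ∀ k : ℕ, ∀ x ∈ V, s₁ / 2 ^ k ≤ breg u x₀ x → breg u x₀ x ≤ 1 →
      g x ≤ C * decay n (breg u x₀ x) by
    obtain ⟨k, hk⟩ := exists_pow_lt_of_lt_one (div_pos hpos hs₁) (show (1 / 2 : ℝ) < 1 by norm_num)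
    refine hind k x hx ?_ hle
    rw [lt_div_iff₀ hs₁, one_div, inv_pow] at hk
    rw [div_eq_inv_mul]
    exact hk.le
  have hfar : ∀ x ∈ V, s₁ ≤ breg u x₀ x → breg u x₀ x ≤ 1 → g x ≤ C * decay n (breg u x₀ x) := by
    intro x hx hs hs1
    have hκs : 0 < κ * s₁ := by positivity
    have h2 := hκ2 hs₁
    have h0 := pole_notMem_csec hn0 h hc₀ hVΩ (x₀ := x₀) hx hκs (by nlinarith) (by linarith)
    have h1 := (green_le_far hn h hVΩ hVc hg hV hx₀ hmax hK hu hB hx hκs (by nlinarith) h0).trans hC1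
    have h3 : g x ≤ C := le_of_mul_le_mul_right h1 (by positivity)
    exact h3.trans (le_mul_of_one_le_right hC (one_le_decay (hs₁.trans_le hs) hs1))
  intro k
  induction k with
  | zero =>
    intro x hx hs
    rw [pow_zero, div_one] at hs
    exact hfar x hx hs
  | succ k ih =>
    intro x hx hs hs1
    rcases le_or_gt s₁ (breg u x₀ x) with hc | hc
    · exact hfar x hx hc hs1
    set s := breg u x₀ x with hs_def
    have hs0 : 0 < s := lt_of_lt_of_le (by positivity) hs
    have h1 := green_le_near (M := C * decay n (2 * s)) hn h hVΩ hVc hg hV hx₀ hmax hc₀ hx hs0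
      rfl (by nlinarith) (show 0 < κ * s by positivity) (J := J)
      (by
        have := mul_le_mul_of_nonneg_right hκJ hs0.le
        rwa [div_mul_eq_mul_div] at this)
      hJ (hκ2 hs0) (mul_nonneg hC (by unfold decay; positivity)) fun y hy hys => by
        rw [← hys]
        refine ih y hy ?_ (by linarith)
        rw [hys]
        rw [pow_succ, ← div_div, div_le_iff₀ two_pos] at hs
        linarith
    rw [Real.sqrt_mul hκ.le, mul_pow, ← mul_assoc] at h1
    have h4 : K * (4 * (2 * s) / lam) ≤ C * Real.sqrt κ ^ n / 4 * s := by
      have := mul_le_mul_of_nonneg_right hC2 hs0.le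
      have e : K * (4 * (2 * s) / lam) = 32 * K / lam * s / 4 := by ring
      rw [e]
      linarith
    have h5 := (mul_sqrt_pow_le_iff (by omega) hs0).1 (h1.trans h4)
    have h6 : g x - C * decay n (2 * s) ≤ C / 4 * decay n s := by
      refine le_of_mul_le_mul_right (h5.trans_eq ?_) (show 0 < Real.sqrt κ ^ n by positivity)
      ring
    have h7 := mul_le_mul_of_nonneg_left (decay_two_mul_le hn hs0) hC
    linarith

/-- Topological boundaries of sections consist of points at the exact height. -/
theorem breg_eq_of_mem_frontier (h : MAData Ω u lam Lam) {x : E n} {t : ℝ} (hxΩ : x ∈ Ω)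
    (hx : x ∈ frontier (MASection Ω u x₀ t)) : breg u x₀ x = t := by
  have hsub : closure (MASection Ω u x₀ t) ⊆ csec Ω u x₀ t :=
    closure_minimal (fun y hy => ⟨hy.1, by
      have := hy.2
      unfold breg
      linarith⟩) (h.csec_isClosed _ _)
  refine le_antisymm (hsub hx.1).2 ?_
  by_contra! hlt
  refine hx.2 (mem_interior_iff_mem_nhds.2 ?_)
  filter_upwards [h.csec_mem_nhds hxΩ (show breg u x₀ x < (breg u x₀ x + t) / 2 by linarith)]
    with y hy
  refine ⟨hy.1, ?_⟩
  have := hy.2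
  rw [breg] at this
  linarith

end decay

/-- Theorem 1.1(i), upper bound, `n ≥ 3`. -/
theorem green_upper_bound_dim_ge_three (n : ℕ) (hn : 3 ≤ n)
    (lam Lam : ℝ) (hlam : 0 < lam) (hlL : lam ≤ Lam)
    (Ω V : Set (E n)) (hV : IsOpen V) (hVΩ : CptIn V Ω) :
    ∃ C > 0, ∀ u : E n → ℝ,
      MASetup Ω u → DetBounds Ω u lam Lam →
      ∀ x₀ ∈ V, ∀ t : ℝ, 0 < t → t < 1 / 4 →
      CptIn (MASection Ω u x₀ (2 * t)) V →
      ∀ g : E n → ℝ, IsGreen u V x₀ g →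
      ∀ x ∈ frontier (MASection Ω u x₀ t), g x ≤ C * t ^ (-(((n : ℝ) - 2) / 2)) := by
  have hn0 : 0 < n := by omega
  by_cases hΩ : IsOpen Ω ∧ Bornology.IsBounded Ω
  swap
  · exact ⟨1, one_pos, fun u hu => absurd (And.intro hu.1 hu.2.1) hΩ⟩
  obtain ⟨c₀, hc₀, m, hm, B, hB, hunif⟩ :=
    exists_uniform_bounds hn0 hlam hlL hΩ.1 hΩ.2 hVΩ
  obtain ⟨K, hK, hmax⟩ := exists_local_maximum_const hn0 hlam hlL
  have hE := three_le_engC hn0 hlam hlL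
  have hθ := starC_pos_of_le hn0 hlam hlL
  obtain ⟨J, hJ⟩ := exists_pow_lt_of_lt_one
    (show 0 < 1 / (4 * engC n lam Lam ^ 2) by positivity)
    (inv_lt_one_of_one_lt₀ (show 1 < 1 + starC n lam Lam by linarith))
  rw [lt_div_iff₀ (by positivity), mul_comm] at hJ
  set κ := min (2 / 2 ^ J) (1 / (4 * engC n lam Lam)) with hκ_def
  have hκ : 0 < κ := by positivity
  have hκ1 : 4 * engC n lam Lam * κ ≤ 1 := by
    rw [mul_comm]
    exact (le_div_iff₀ (by positivity)).1 (min_le_right _ _)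
  set s₁ := min (1 / 2) (c₀ / (4 * engC n lam Lam)) with hs₁_def
  have hs₁ : 0 < s₁ := by positivity
  have hs₁c : 4 * engC n lam Lam * s₁ ≤ c₀ := by
    rw [mul_comm]
    exact (le_div_iff₀ (by positivity)).1 (min_le_right _ _)
  set C := max (K * (4 * B / lam) / Real.sqrt (κ * s₁) ^ n) (32 * K / lam / Real.sqrt κ ^ n)
    with hC_def
  have hC : 0 < C := lt_max_of_lt_left (by positivity)
  refine ⟨C, hC, fun u hu hd x₀ hx₀ t ht ht4 hsec g hg x hx => ?_⟩
  have h := hu.toMAData hd hlam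
  have hVΩ' : V ⊆ Ω := subset_closure.trans hVΩ.2
  have hxV : x ∈ V := hsec.2 (closure_mono
    (show MASection Ω u x₀ t ⊆ MASection Ω u x₀ (2 * t) from
      fun y hy => ⟨hy.1, hy.2.trans (by linarith)⟩) hx.1)
  have hbx := breg_eq_of_mem_frontier h (hVΩ' hxV) hx
  have hc := fun y hy => ((hunif u h).1 y hy).1
  have key := green_le_decay hn h hVΩ' hVΩ.1 hg hV hx₀ (hmax Ω V u h hVΩ' c₀ hc) hK.le hc
    (fun y hy => ((hunif u h).1 y hy).2.trans_lt (by linarith))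
    ((hunif u h).2 x₀ (subset_closure (hVΩ' hx₀))) hκ hκ1 (min_le_left _ _) hJ hs₁
    (min_le_left _ _) hs₁c hC.le ((div_le_iff₀ (by positivity)).1 (le_max_left _ _))
    ((div_le_iff₀ (by positivity)).1 (le_max_right _ _)) hxV (by rw [hbx]; exact ht)
    (by rw [hbx]; linarith)
  rwa [hbx, decay_eq_rpow (by omega) ht] at key
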